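/- Let B be a planar graph that has a planar embedding with two nested cycles C_1 and C_2 such that C_1 is the boundary of the outer face and C_2 is the boundary of an inner face, and such that B contains at least two vertex-disjoint paths joining vertices of C_1 to vertices of C_2. Let I be a graph with B ∩ I = C_2 such that the graph R = B ∪ I is planar. Then R has a planar embedding in which C_1 is the boundary of the outer face. -/

import Mathlib

open SimpleGraph

/-- A bundled finite simple graph. -/
structure FinGraph where
  V : Type
  [finV : Finite V]
  G : SimpleGraph V

attribute [instance] FinGraph.finV

/-- The bundled version of a finite simple graph. -/
def FinGraph.of (V : Type) [Finite V] (G : SimpleGraph V) : FinGraph := ⟨V, G⟩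

/-- `H` is (an isomorphic copy of) the graph obtained from `G` by contracting the edge `uv`:
there is a surjection `f` identifying exactly `u` and `v`, with `H` having precisely the
images of edges of `G` as edges. -/
def IsEdgeContractionOf {V W : Type} (G : SimpleGraph V) (u v : V) (H : SimpleGraph W) : Prop :=
  G.Adj u v ∧ ∃ f : V → W, f u = f v ∧ Function.Surjective f ∧
    (∀ a b : V, a ≠ b → f a = f b → (a = u ∧ b = v) ∨ (a = v ∧ b = u)) ∧
    (∀ x y : W, H.Adj x y ↔ x ≠ y ∧ ∃ a b : V, f a = x ∧ f b = y ∧ G.Adj a b)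

/-- `B` is obtained from `A` by contracting one edge. -/
def ContractionStep (A B : FinGraph) : Prop :=
  ∃ u v : A.V, IsEdgeContractionOf A.G u v B.G

/-- `B` is obtained from `A` by at most `k` edge contractions. -/
def ContractsInAtMost (k : ℕ) (A B : FinGraph) : Prop :=
  ∃ n : ℕ, n ≤ k ∧ ∃ c : ℕ → FinGraph, c 0 = A ∧ c n = B ∧
    ∀ i, i < n → ContractionStep (c i) (c (i + 1))

/-- `B` is a contraction of `A`, i.e. `B` can be obtained (up to isomorphism) from `A`
by a sequence of edge contractions. -/
def IsContraction (A B : FinGraph) : Prop :=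
  ∃ C : FinGraph, Relation.ReflTransGen ContractionStep A C ∧ Nonempty (C.G ≃g B.G)

/-- `B` is obtained from `A` by deleting one edge. -/
def EdgeDeletionStep (A B : FinGraph) : Prop :=
  ∃ e : Sym2 A.V, e ∈ A.G.edgeSet ∧ Nonempty (B.G ≃g A.G.deleteEdges {e})

/-- `B` is obtained from `A` by deleting one vertex. -/
def VertexDeletionStep (A B : FinGraph) : Prop :=
  ∃ v : A.V, Nonempty (B.G ≃g A.G.induce {x : A.V | x ≠ v})

/-- One minor operation: an edge contraction, an edge deletion or a vertex deletion. -/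
def MinorStep (A B : FinGraph) : Prop :=
  ContractionStep A B ∨ EdgeDeletionStep A B ∨ VertexDeletionStep A B

/-- `A` contains `B` as a minor: `A` can be modified to (an isomorphic copy of) `B` by a
sequence of edge contractions, edge deletions and vertex deletions. -/
def HasMinor (A B : FinGraph) : Prop :=
  ∃ C : FinGraph, Relation.ReflTransGen MinorStep A C ∧ Nonempty (C.G ≃g B.G)

/-- The complete graph on five vertices, bundled. -/
def K5 : FinGraph := FinGraph.of (Fin 5) ⊤

/-- The complete bipartite graph `K_{3,3}`, bundled. -/
def K33 : FinGraph := FinGraph.of (Fin 3 ⊕ Fin 3) (completeBipartiteGraph (Fin 3) (Fin 3))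

/-- A finite graph is planar iff (by Kuratowski's theorem) it has no `K₅` and no `K_{3,3}`
minor. -/
def FinGraph.IsPlanar (A : FinGraph) : Prop := ¬ HasMinor A K5 ∧ ¬ HasMinor A K33

/-- `A` can be contracted to a planar graph using at most `k` edge contractions. -/
def ContractiblePlanar (k : ℕ) (A : FinGraph) : Prop :=
  ∃ B : FinGraph, ContractsInAtMost k A B ∧ B.IsPlanar

/-- `P` is an `H`-witness structure of `G`: a partition of `V(G)` into nonempty connected
pieces `P x`, one for each vertex `x` of `H`, such that distinct pieces are adjacent iff the
corresponding vertices of `H` are adjacent. -/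
def IsWitnessStructure {V X : Type} (G : SimpleGraph V) (H : SimpleGraph X)
    (P : X → Set V) : Prop :=
  (∀ x : X, (P x).Nonempty) ∧
  (∀ x y : X, x ≠ y → Disjoint (P x) (P y)) ∧
  (∀ v : V, ∃ x : X, v ∈ P x) ∧
  (∀ x : X, (G.induce (P x)).Connected) ∧
  (∀ x y : X, x ≠ y → (H.Adj x y ↔ ∃ a ∈ P x, ∃ b ∈ P y, G.Adj a b))

/-- `uv` is a witness edge: an edge of `G` whose end-vertices belong to two different
witness sets of `P`. -/
def IsWitnessEdge {V X : Type} (G : SimpleGraph V) (P : X → Set V) (u v : V) : Prop :=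
  G.Adj u v ∧ ¬ ∃ x : X, u ∈ P x ∧ v ∈ P x

/-- A topological plane embedding of the subgraph `B` of an ambient graph `G`: points for the
vertices of `B` and arcs (homeomorphic images of `[0,1]`) for the edges of `B`, such that arcs
meet vertices only in their endpoints and meet each other only in common endpoints. -/
structure PlaneEmb {W : Type} {G : SimpleGraph W} (B : G.Subgraph) where
  vert : W → ℝ × ℝ
  arc : Sym2 W → Set (ℝ × ℝ)
  vert_inj : Set.InjOn vert B.verts
  arc_spec : ∀ u v : W, B.Adj u v → ∃ γ : ℝ → ℝ × ℝ,
    ContinuousOn γ (Set.Icc 0 1) ∧ Set.InjOn γ (Set.Icc 0 1) ∧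
    γ 0 = vert u ∧ γ 1 = vert v ∧ γ '' Set.Icc 0 1 = arc s(u, v)
  arc_vert : ∀ u v w : W, B.Adj u v → w ∈ B.verts → vert w ∈ arc s(u, v) → w = u ∨ w = v
  arc_inter : ∀ e₁ e₂ : Sym2 W, e₁ ∈ B.edgeSet → e₂ ∈ B.edgeSet → e₁ ≠ e₂ →
    ∀ p ∈ arc e₁ ∩ arc e₂, ∃ w ∈ B.verts, p = vert w

/-- The set of points of the plane used by the embedding. -/
def PlaneEmb.drawing {W : Type} {G : SimpleGraph W} {B : G.Subgraph}
    (D : PlaneEmb B) : Set (ℝ × ℝ) :=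
  D.vert '' B.verts ∪ ⋃ e ∈ B.edgeSet, D.arc e

/-- The set of points of the plane used by a subgraph `C` (of the embedded graph). -/
def PlaneEmb.image {W : Type} {G : SimpleGraph W} {B : G.Subgraph}
    (D : PlaneEmb B) (C : G.Subgraph) : Set (ℝ × ℝ) :=
  D.vert '' C.verts ∪ ⋃ e ∈ C.edgeSet, D.arc e

/-- A face of the embedding: a connected component of the complement of the drawing. -/
def PlaneEmb.IsFace {W : Type} {G : SimpleGraph W} {B : G.Subgraph}
    (D : PlaneEmb B) (F : Set (ℝ × ℝ)) : Prop :=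
  ∃ p : ℝ × ℝ, p ∉ D.drawing ∧ F = connectedComponentIn D.drawingᶜ p

/-- The subgraph `C` is the boundary of the outer (unbounded) face of the embedding `D`. -/
def PlaneEmb.BoundsOuterFace {W : Type} {G : SimpleGraph W} {B : G.Subgraph}
    (D : PlaneEmb B) (C : G.Subgraph) : Prop :=
  ∃ F : Set (ℝ × ℝ), D.IsFace F ∧ ¬ Bornology.IsBounded F ∧ frontier F = D.image C

/-- The subgraph `C` is the boundary of an inner (bounded) face of the embedding `D`. -/
def PlaneEmb.BoundsInnerFace {W : Type} {G : SimpleGraph W} {B : G.Subgraph}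
    (D : PlaneEmb B) (C : G.Subgraph) : Prop :=
  ∃ F : Set (ℝ × ℝ), D.IsFace F ∧ Bornology.IsBounded F ∧ frontier F = D.image C

/-- The cycles `C₁` and `C₂` are nested in the embedding `D`: there are disks `Δ₁ ⊃ Δ₂`
such that `Cᵢ` is drawn as the boundary of `Δᵢ`. -/
def PlaneEmb.Nested {W : Type} {G : SimpleGraph W} {B : G.Subgraph}
    (D : PlaneEmb B) (C₁ C₂ : G.Subgraph) : Prop :=
  ∃ Δ₁ Δ₂ : Set (ℝ × ℝ),
    Nonempty (↥Δ₁ ≃ₜ ↥(Metric.closedBall (0 : ℝ × ℝ) 1)) ∧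
    Nonempty (↥Δ₂ ≃ₜ ↥(Metric.closedBall (0 : ℝ × ℝ) 1)) ∧
    frontier Δ₁ = D.image C₁ ∧ frontier Δ₂ = D.image C₂ ∧ Δ₂ ⊂ Δ₁

/-- The subgraph `C` is a cycle: it carries a closed walk that is a cycle and uses all of its
vertices and edges. -/
def IsCycleSubgraph {W : Type} {G : SimpleGraph W} (C : G.Subgraph) : Prop :=
  ∃ (v : ↥C.verts) (w : C.coe.Walk v v), w.IsCycle ∧
    (∀ x : ↥C.verts, x ∈ w.support) ∧ ∀ e ∈ C.coe.edgeSet, e ∈ w.edges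

/-- There are two vertex-disjoint paths of `B` joining vertices of `C₁` to vertices of `C₂`. -/
def TwoDisjointPathsBetween {W : Type} {G : SimpleGraph W}
    (B C₁ C₂ : G.Subgraph) : Prop :=
  ∃ (a₁ b₁ a₂ b₂ : W) (p₁ : G.Walk a₁ b₁) (p₂ : G.Walk a₂ b₂),
    p₁.IsPath ∧ p₂.IsPath ∧
    (∀ e ∈ p₁.edges, e ∈ B.edgeSet) ∧ (∀ e ∈ p₂.edges, e ∈ B.edgeSet) ∧
    (∀ x ∈ p₁.support, x ∈ B.verts) ∧ (∀ x ∈ p₂.support, x ∈ B.verts) ∧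
    a₁ ∈ C₁.verts ∧ b₁ ∈ C₂.verts ∧ a₂ ∈ C₁.verts ∧ b₂ ∈ C₂.verts ∧
    List.Disjoint p₁.support p₂.support


namespace PB
section
open Classical Finset

variable {V : Type}

abbrev Vec (V : Type) := Sym2 V → ZMod 2

noncomputable def dg (E : Finset (Sym2 V)) (h : Vec V) (v : V) : ZMod 2 :=
  ∑ e ∈ E, if v ∈ e then h e else 0

def Spt (E : Finset (Sym2 V)) (h : Vec V) : Prop := ∀ e, e ∉ E → h e = 0

def LL (E : Finset (Sym2 V)) : Prop := ∀ e ∈ E, ¬ e.IsDiag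

noncomputable def vs (E : Finset (Sym2 V)) : Set V := {v | ∃ e ∈ E, v ∈ e}

noncomputable def ind (P : Finset (Sym2 V)) : Vec V := fun e => if e ∈ P then 1 else 0

lemma dg_add (E : Finset (Sym2 V)) (h k : Vec V) (v : V) :
    dg E (h + k) v = dg E h v + dg E k v := by
  unfold dg
  rw [← sum_add_distrib]
  refine sum_congr rfl fun e _ => ?_
  split_ifs <;> simp

lemma dg_smul (E : Finset (Sym2 V)) (c : ZMod 2) (h : Vec V) (v : V) :
    dg E (c • h) v = c * dg E h v := by
  unfold dg
  rw [mul_sum]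
  refine sum_congr rfl fun e _ => ?_
  split_ifs <;> simp

lemma dg_zero (E : Finset (Sym2 V)) (v : V) : dg E (0 : Vec V) v = 0 := by simp [dg]

lemma dg_sum {ι : Type} (s : Finset ι) (E : Finset (Sym2 V)) (f : ι → Vec V) (v : V) :
    dg E (∑ i ∈ s, f i) v = ∑ i ∈ s, dg E (f i) v := by
  induction s using Finset.induction_on with
  | empty => simp [dg_zero]
  | insert a s ha ih => rw [sum_insert ha, sum_insert ha, dg_add, ih]

lemma dg_mono {E E' : Finset (Sym2 V)} (hs : E ⊆ E') {h : Vec V} (hh : Spt E h) (v : V) :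
    dg E' h v = dg E h v := by
  unfold dg
  symm
  apply sum_subset hs
  intro e _ he
  simp [hh e he]

/-- cycle space -/
noncomputable def Zc (E : Finset (Sym2 V)) : Submodule (ZMod 2) (Vec V) where
  carrier := {h | Spt E h ∧ ∀ v, dg E h v = 0}
  add_mem' := by
    rintro a b ⟨ha, ha'⟩ ⟨hb, hb'⟩
    refine ⟨fun e he => by simp [ha e he, hb e he], fun v => by rw [dg_add, ha', hb', add_zero]⟩
  zero_mem' := ⟨fun e _ => rfl, fun v => dg_zero E v⟩
  smul_mem' := by
    rintro c a ⟨ha, ha'⟩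
    refine ⟨fun e he => by simp [ha e he], fun v => by rw [dg_smul, ha', mul_zero]⟩

lemma mem_Zc {E : Finset (Sym2 V)} {h : Vec V} :
    h ∈ Zc E ↔ Spt E h ∧ ∀ v, dg E h v = 0 := Iff.rfl

lemma Zc_mono {E E' : Finset (Sym2 V)} (hs : E ⊆ E') : Zc E ≤ Zc E' := by
  rintro h ⟨h1, h2⟩
  exact ⟨fun e he => h1 e fun h' => he (hs h'), fun v => by rw [dg_mono hs h1, h2]⟩

lemma Zc_of_spt {E E' : Finset (Sym2 V)} (hs : E ⊆ E') {h : Vec V} (hh : h ∈ Zc E')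
    (h' : Spt E h) : h ∈ Zc E :=
  ⟨h', fun v => by rw [← dg_mono hs h', hh.2]⟩

def Pl (E : Finset (Sym2 V)) : Prop :=
  ∃ (ι : Type) (_ : Fintype ι) (f : ι → Vec V), (∀ i, f i ∈ Zc E) ∧
    (∀ z ∈ Zc E, ∃ c : ι → ZMod 2, z = ∑ i, c i • f i) ∧
    ∀ e, #{i | f i e ≠ 0} ≤ 2

lemma z2 (a : ZMod 2) : a = 0 ∨ a = 1 := by revert a; decide
lemma z2ne {a : ZMod 2} (h : a ≠ 0) : a = 1 := (z2 a).resolve_left h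
lemma z2self (a : ZMod 2) : a + a = 0 := CharTwo.add_self_eq_zero a
lemma vself (a : Vec V) : a + a = 0 := by ext e; exact z2self _

lemma Pl_del {E : Finset (Sym2 V)} {g : Sym2 V} (h : Pl (insert g E)) (hg : g ∉ E) : Pl E := by
  obtain ⟨ι, _, f, h1, h2, h3⟩ := h
  by_cases hex : ∃ a, f a g ≠ 0
  · obtain ⟨a, ha⟩ := hex
    have ha1 := z2ne ha
    refine ⟨ι, inferInstance, fun i => f i + f i g • f a, ?_, ?_, ?_⟩
    · intro i
      refine Zc_of_spt (subset_insert g E)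
        (add_mem (h1 i) (Submodule.smul_mem _ _ (h1 a))) ?_
      intro e he
      by_cases heg : e = g
      · subst heg; simp [ha1, z2self]
      · have : e ∉ insert g E := by simp [heg, he]
        simp [(h1 i).1 e this, (h1 a).1 e this]
    · intro z hz
      obtain ⟨c, hc⟩ := h2 z (Zc_mono (subset_insert g E) hz)
      refine ⟨c, ?_⟩
      have hzg : z g = 0 := hz.1 g hg
      rw [hc] at hzg
      have : ∑ i, c i • (f i + f i g • f a) = z + z g • f a := by
        rw [hc]
        simp only [smul_add, sum_add_distrib, Finset.sum_apply, Pi.smul_apply, sum_smul, smul_eq_mul,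
          mul_smul]
      rw [this, hc, hzg, zero_smul, add_zero]
    · intro e
      by_cases hae : f a e = 0
      · refine le_trans (card_le_card ?_) (h3 e)
        intro i; simp [hae]
      · have h4 : #(({i | f i e ≠ 0} : Finset ι).erase a) ≤ 1 := by
          rw [card_erase_of_mem (by simpa using hae)]
          have := h3 e; omega
        have h5 : #(({i | f i g ≠ 0} : Finset ι).erase a) ≤ 1 := by
          rw [card_erase_of_mem (by simpa using ha)]
          have := h3 g; omega
        refine le_trans (card_le_card (t := (({i | f i e ≠ 0} : Finset ι).erase a) ∪
          (({i | f i g ≠ 0} : Finset ι).erase a)) ?_) (le_trans (card_union_le _ _) (by omega))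
        intro i
        simp only [mem_filter, mem_univ, true_and, mem_union, mem_erase, Pi.add_apply,
          Pi.smul_apply, smul_eq_mul]
        intro hi
        have hia : i ≠ a := by
          rintro rfl; apply hi; rw [ha1, one_mul, z2self]
        by_cases h0 : f i e = 0
        · right; refine ⟨hia, fun h' => hi (by simp [h0, h'])⟩
        · left; exact ⟨hia, h0⟩
  · push Not at hex
    refine ⟨ι, inferInstance, f, fun i => Zc_of_spt (subset_insert g E) (h1 i) ?_,
      fun z hz => h2 z (Zc_mono (subset_insert g E) hz), h3⟩
    intro e he
    by_cases heg : e = g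
    · subst heg; exact hex i
    · exact (h1 i).1 e (by simp [heg, he])

lemma Pl_mono {E E' : Finset (Sym2 V)} (hs : E ⊆ E') (h : Pl E') : Pl E := by
  obtain ⟨D, hD⟩ : ∃ D, D = E' \ E := ⟨_, rfl⟩
  induction D using Finset.induction_on generalizing E with
  | empty =>
    have : E = E' := subset_antisymm hs (sdiff_eq_empty_iff_subset.1 hD.symm)
    rwa [this]
  | insert a D ha ih =>
    have haE : a ∈ E' \ E := by rw [← hD]; simp
    rw [mem_sdiff] at haE
    refine Pl_del (g := a) (ih (E := insert a E) ?_ ?_) haE.2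
    · intro x; simp only [mem_insert]; rintro (rfl | h)
      · exact haE.1
      · exact hs h
    · ext x
      have := congrArg (x ∈ ·) hD
      simp only [mem_insert, mem_sdiff, eq_iff_iff] at this ⊢
      by_cases hx : x = a
      · subst hx; simp [ha]
      · simp only [hx, false_or] at this ⊢; exact this

/-- normalized: sum is zero -/
lemma Pl_norm {E : Finset (Sym2 V)} (h : Pl E) :
    ∃ (ι : Type) (_ : Fintype ι) (f : ι → Vec V), (∀ i, f i ∈ Zc E) ∧
    (∀ z ∈ Zc E, ∃ c : ι → ZMod 2, z = ∑ i, c i • f i) ∧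
    (∀ e, #{i | f i e ≠ 0} ≤ 2) ∧ ∑ i, f i = 0 := by
  obtain ⟨ι, _, f, h1, h2, h3⟩ := h
  refine ⟨Option ι, inferInstance, fun o => o.elim (∑ i, f i) f, ?_, ?_, ?_, ?_⟩
  · rintro (_ | i)
    · exact sum_mem fun i _ => h1 i
    · exact h1 i
  · intro z hz
    obtain ⟨c, hc⟩ := h2 z hz
    refine ⟨fun o => o.elim 0 c, ?_⟩
    rw [Fintype.sum_option]; simp [hc]
  · intro e
    have hcount : #{o : Option ι | (o.elim (∑ i, f i) f) e ≠ 0} =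
        (if (∑ i, f i) e ≠ 0 then 1 else 0) + #{i | f i e ≠ 0} := by
      rw [card_filter, Fintype.sum_option, card_filter]; rfl
    rw [hcount]
    have hs : (∑ i, f i) e = (#{i | f i e ≠ 0} : ZMod 2) := by
      rw [Finset.sum_apply, card_filter, Nat.cast_sum]
      refine sum_congr rfl fun i _ => ?_
      rcases z2 (f i e) with h | h <;> simp [h]
    have := h3 e
    interval_cases hk : #{i | f i e ≠ 0}
    · simp at hs; simp [hs]
    · split_ifs <;> omega
    · have : (2 : ZMod 2) = 0 := rfl
      simp only [Nat.cast_ofNat, this] at hs; rw [hs]; simp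
  · rw [Fintype.sum_option]
    exact vself _

/-- handshake -/
lemma handshake {E : Finset (Sym2 V)} (hE : LL E) (h : Vec V) (U : Finset V) :
    ∑ v ∈ U, dg E h v =
      ∑ e ∈ E, if (∃ v ∈ e, v ∈ U) ∧ (∃ v ∈ e, v ∉ U) then h e else 0 := by
  unfold dg
  rw [sum_comm]
  refine sum_congr rfl fun e he => ?_
  have hd := hE e he
  induction e using Sym2.ind with
  | _ a b =>
    have hab : a ≠ b := by simpa using hd
    have : ∀ v, (if v ∈ s(a,b) then h s(a,b) else 0) =
        (if v = a then h s(a,b) else 0) + (if v = b then h s(a,b) else 0) := by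
      intro v
      by_cases h1 : v = a
      · subst h1; simp [hab]
      · simp [h1]
    simp only [this, sum_add_distrib, sum_ite_eq']
    by_cases ha : a ∈ U <;> by_cases hb : b ∈ U <;> simp [ha, hb, z2self]

noncomputable def dl (a v : V) : ZMod 2 := if v = a then 1 else 0

lemma dg_single {A : Finset (Sym2 V)} {a b : V} (hab : a ≠ b) (h : s(a,b) ∈ A) (v : V) :
    dg A (ind {s(a,b)}) v = dl a v + dl b v := by
  unfold dg ind dl
  rw [sum_eq_single s(a,b)]
  · by_cases h1 : v = a
    · subst h1; simp [hab]
    · simp [h1]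
  · intro e _ he; simp [he]
  · intro h'; exact absurd h h'

lemma tjoin {A : Finset (Sym2 V)} (hA : LL A) {a b : V}
    (h : Relation.ReflTransGen (fun x y => s(x,y) ∈ A) a b) :
    ∃ k : Vec V, Spt A k ∧ ∀ v, dg A k v = dl a v + dl b v := by
  induction h with
  | refl => exact ⟨0, fun _ _ => rfl, fun v => by rw [dg_zero, z2self]⟩
  | @tail x y _ hxy ih =>
    obtain ⟨k, hk, hd⟩ := ih
    have hne : x ≠ y := by simpa using hA _ hxy
    refine ⟨k + ind {s(x,y)}, ?_, ?_⟩
    · intro e he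
      have : e ≠ s(x,y) := by rintro rfl; exact he hxy
      simp [hk e he, ind, this]
    · intro v
      rw [dg_add, hd, dg_single hne hxy]
      have := z2self (dl x v)
      linear_combination this

end
end PB

namespace PB
section
open Classical Finset

variable {V U : Type}

/-- connectivity inside a vertex set `S` with edges in `E` -/
def Rch (E : Finset (Sym2 V)) (S : Set V) : V → V → Prop :=
  Relation.ReflTransGen (fun x y => s(x,y) ∈ E ∧ x ∈ S ∧ y ∈ S)

lemma Pl_empty : Pl (∅ : Finset (Sym2 U)) := by
  refine ⟨Empty, inferInstance, fun i => i.elim, fun i => i.elim, ?_, by simp⟩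
  intro z hz
  refine ⟨fun i => i.elim, ?_⟩
  ext e
  simp [hz.1 e]

lemma ind_spt {P E : Finset (Sym2 V)} (h : P ⊆ E) : Spt E (ind P) := by
  intro e he
  have : e ∉ P := fun h' => he (h h')
  simp [ind, this]

set_option maxHeartbeats 1000000 in
lemma minor {E : Finset (Sym2 V)} {H : Finset (Sym2 U)} (hE : LL E) (hH : LL H)
    (hPl : Pl E) (φ : V → Option U)
    (hconn : ∀ u a b, φ a = some u → φ b = some u → Rch E {x | φ x = some u} a b)
    (hrep : ∀ u v, s(u,v) ∈ H → ∃ a b, s(a,b) ∈ E ∧ φ a = some u ∧ φ b = some v) : Pl H := by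
  rcases H.eq_empty_or_nonempty with rfl | hne
  · exact Pl_empty
  have hV : Nonempty V := by
    obtain ⟨e, he⟩ := hne
    induction e using Sym2.ind with
    | _ u v => exact ⟨(hrep u v he).choose⟩
  have hrep' : ∀ e : Sym2 U, ∃ g : Sym2 V, e ∈ H → g ∈ E ∧ g.map φ = e.map some := by
    intro e
    by_cases he : e ∈ H
    · induction e using Sym2.ind with
      | _ u v =>
        obtain ⟨a, b, h1, h2, h3⟩ := hrep u v he
        exact ⟨s(a,b), fun _ => ⟨h1, by simp [h2, h3]⟩⟩
    · exact ⟨s(hV.some, hV.some), fun h => absurd h he⟩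
  choose r hr using hrep'
  have rinj : ∀ e ∈ H, ∀ e' ∈ H, r e = r e' → e = e' := by
    intro e he e' he' h
    apply Sym2.map.injective (Option.some_injective U)
    rw [← (hr e he).2, ← (hr e' he').2, h]
  set A : Finset (Sym2 V) := E.filter (fun e => ∃ u, ∀ x ∈ e, φ x = some u) with hA
  have hAE : A ⊆ E := filter_subset _ _
  have hAL : LL A := fun e he => hE e (hAE he)
  have hrA : ∀ e ∈ H, r e ∉ A := by
    intro e he hre
    obtain ⟨u, hu⟩ := (mem_filter.1 hre).2
    have h2 := (hr e he).2
    have h3 := hH e he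
    generalize r e = g at *
    induction e using Sym2.ind with
    | _ x y =>
    induction g using Sym2.ind with
    | _ a b =>
      have ha := hu a (by simp); have hb := hu b (by simp)
      simp only [Sym2.map_mk, ha, hb, Sym2.eq_iff, Option.some.injEq] at h2
      apply h3
      rcases h2 with ⟨h, h'⟩ | ⟨h, h'⟩ <;> simp [← h, ← h']
  set E' : Finset (Sym2 V) := A ∪ H.image r with hE'
  have hE'E : E' ⊆ E := by
    intro e he
    rcases mem_union.1 he with h | h
    · exact hAE h
    · obtain ⟨x, hx, rfl⟩ := mem_image.1 h; exact (hr x hx).1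
  have hE'L : LL E' := fun e he => hE e (hE'E he)
  have hrE' : ∀ e ∈ H, r e ∈ E' := fun e he => mem_union_right _ (mem_image_of_mem _ he)
  obtain ⟨ι, _, f, h1, h2, h3⟩ := Pl_mono hE'E hPl
  let π : Vec V → Vec U := fun w e => if e ∈ H then w (r e) else 0
  have hπ : ∀ w ∈ Zc E', π w ∈ Zc H := by
    intro w hw
    refine ⟨fun e he => by simp [π, he], fun u => ?_⟩
    have hs := handshake hE'L w ((E'.biUnion (fun e => e.toFinset)).filter (fun x => φ x = some u))
    rw [sum_eq_zero (fun v _ => hw.2 v)] at hs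
    rw [sum_union, sum_image rinj] at hs
    · rw [sum_eq_zero, zero_add] at hs
      · rw [hs]
        refine sum_congr rfl fun e he => ?_
        simp only [π, he, if_true]
        have h5 := hrE' e he
        have h4 := (hr e he).2
        have h6 := hH e he
        have key : ((∃ v ∈ r e, v ∈ (E'.biUnion (fun e => e.toFinset)).filter (fun x => φ x = some u)) ∧
          (∃ v ∈ r e, v ∉ (E'.biUnion (fun e => e.toFinset)).filter (fun x => φ x = some u))) ↔ u ∈ e := by
          have hin : ∀ v ∈ r e, (v ∈ (E'.biUnion (fun e => e.toFinset)).filter (fun x => φ x = some u) ↔ φ v = some u) := by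
            intro v hv
            simp only [mem_filter, mem_biUnion, Sym2.mem_toFinset, and_iff_right_iff_imp]
            exact fun _ => ⟨r e, h5, hv⟩
          generalize r e = g at *
          induction e using Sym2.ind with
          | _ x y =>
          induction g using Sym2.ind with
          | _ a b =>
            have hxy : x ≠ y := by simpa using h6
            have hia := hin a (by simp)
            have hib := hin b (by simp)
            simp only [Sym2.mem_iff, exists_eq_or_imp, exists_eq_left, hia, hib]
            simp only [Sym2.map_mk, Sym2.eq_iff] at h4
            have q : ¬ (x = u ∧ y = u) := fun q => hxy (q.1.trans q.2.symm)
            rw [eq_comm (a := u), eq_comm (a := u)]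
            clear * - h4 q
            rcases h4 with ⟨h, h'⟩ | ⟨h, h'⟩ <;> simp only [h, h', Option.some.injEq] <;> tauto
        simp only [key]
      · intro e he
        obtain ⟨u', hu'⟩ := (mem_filter.1 he).2
        rw [if_neg]
        rintro ⟨⟨a, ha, ha'⟩, b, hb, hb'⟩
        apply hb'
        rw [mem_filter] at ha' ⊢
        refine ⟨?_, ?_⟩
        · rw [mem_biUnion]; exact ⟨e, mem_union_left _ he, by simpa using hb⟩
        · rw [hu' b hb, ← hu' a ha, ha'.2]
    · rw [Finset.disjoint_left]
      intro e he he'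
      obtain ⟨x, hx, rfl⟩ := mem_image.1 he'
      exact hrA x hx he
  -- roots
  let root : U → V := fun u => if h : ∃ a, φ a = some u then h.choose else hV.some
  have hroot : ∀ u a, φ a = some u → φ (root u) = some u := by
    intro u a ha
    have : ∃ a, φ a = some u := ⟨a, ha⟩
    simp only [root, this, dite_true]; exact this.choose_spec
  have hrch : ∀ u a, φ a = some u → Relation.ReflTransGen (fun x y => s(x,y) ∈ A) a (root u) := by
    intro u a ha
    refine Relation.ReflTransGen.mono ?_ _ _ (hconn u a (root u) ha (hroot u a ha))
    rintro x y ⟨h, hx, hy⟩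
    rw [hA, mem_filter]
    refine ⟨h, u, ?_⟩
    simp only [Sym2.mem_iff]; rintro z (rfl | rfl) <;> assumption
  have hp : ∀ e ∈ H, ∃ p : Vec V, Spt E' p ∧ (∀ e' ∈ H, p (r e') = if e' = e then 1 else 0) ∧
      ∀ x, dg E' p x = if ∃ u ∈ e, root u = x then 1 else 0 := by
    intro e he
    have h5 := hrE' e he
    obtain ⟨h0, h4⟩ := hr e he
    have h6 := hH e he
    obtain ⟨g, hg⟩ : ∃ g, r e = g := ⟨_, rfl⟩
    have hgind : ∀ e' ∈ H, ind {r e} (r e') = if e' = e then 1 else 0 := by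
      intro e' he'
      simp only [ind, mem_singleton]
      refine if_congr ⟨fun h => rinj _ he' _ he h, fun h => by rw [h]⟩ rfl rfl
    have main : ∃ x y a b, e = s(x,y) ∧ g = s(a,b) ∧ φ a = some x ∧ φ b = some y := by
      rw [hg] at h4
      clear hg h5 h0 hgind
      induction e using Sym2.ind with
      | _ x y =>
      induction g using Sym2.ind with
      | _ a b =>
        simp only [Sym2.map_mk, Sym2.eq_iff] at h4
        rcases h4 with ⟨h, h'⟩ | ⟨h, h'⟩
        · exact ⟨x, y, a, b, rfl, rfl, h, h'⟩
        · exact ⟨y, x, a, b, Sym2.eq_swap, rfl, h, h'⟩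
    obtain ⟨x, y, a, b, rfl, rfl, ha, hb⟩ := main
    have hxy : x ≠ y := by simpa using h6
    have hab : a ≠ b := by rintro rfl; exact hxy (Option.some_injective _ (ha.symm.trans hb))
    obtain ⟨k1, hk1, hk1'⟩ := tjoin hAL (hrch x a ha)
    obtain ⟨k2, hk2, hk2'⟩ := tjoin hAL (hrch y b hb)
    have hAE' : A ⊆ E' := subset_union_left
    refine ⟨ind {r s(x,y)} + k1 + k2, ?_, ?_, ?_⟩
    · intro e' he'
      have hA' : e' ∉ A := fun h => he' (hAE' h)
      have : e' ≠ r s(x,y) := by rintro rfl; exact he' h5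
      simp [ind, this, hk1 e' hA', hk2 e' hA']
    · intro e' he'
      have := hrA e' he'
      rw [Pi.add_apply, Pi.add_apply, hgind e' he', hk1 _ this, hk2 _ this, add_zero, add_zero]
    · intro v
      rw [dg_add, dg_add, dg_mono hAE' hk1, dg_mono hAE' hk2, hk1', hk2', hg,
        dg_single hab (hg ▸ h5)]
      have e1 : dl a v + dl b v + (dl a v + dl (root x) v) + (dl b v + dl (root y) v)
        = dl (root x) v + dl (root y) v := by
        linear_combination z2self (dl a v) + z2self (dl b v)
      rw [e1]
      have hne : root x ≠ root y := by
        intro h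
        apply hxy
        have := hroot x a ha
        rw [h, hroot y b hb] at this
        exact (Option.some_injective _ this).symm
      simp only [Sym2.mem_iff, exists_eq_or_imp, exists_eq_left, dl]
      by_cases c1 : root x = v
      · subst c1; simp [hne.symm, hne]
      · simp [c1, Ne.symm c1, eq_comm]
  choose! p hp1 hp2 hp3 using hp
  refine ⟨ι, inferInstance, fun i => π (f i), fun i => hπ _ (h1 i), ?_, ?_⟩
  · intro z hz
    have hw : (∑ e ∈ H, z e • p e) ∈ Zc E' := by
      refine ⟨?_, ?_⟩
      · intro g hg
        rw [Finset.sum_apply]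
        exact sum_eq_zero fun e he => by simp [hp1 e he g hg]
      · intro x
        rw [dg_sum]
        simp only [dg_smul]
        by_cases hx : ∃ u, φ x = some u ∧ root u = x
        · obtain ⟨u, hu, hux⟩ := hx
          rw [← hz.2 u]
          refine sum_congr rfl fun e he => ?_
          rw [hp3 e he]
          have : (∃ u ∈ e, root u = x) ↔ u ∈ e := by
            constructor
            · rintro ⟨u', hu', h'⟩
              have hex : ∃ a, φ a = some u' := by
                obtain ⟨h0, h4⟩ := hr e he
                have : some u' ∈ (r e).map φ := by rw [h4, Sym2.mem_map]; exact ⟨u', hu', rfl⟩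
                obtain ⟨a, _, ha⟩ := Sym2.mem_map.1 this
                exact ⟨a, ha⟩
              obtain ⟨a, ha⟩ := hex
              have := hroot u' a ha
              rw [h', hu] at this
              rwa [Option.some_injective _ this]
            · exact fun h => ⟨u, h, hux⟩
          simp only [this]; split_ifs <;> simp
        · apply sum_eq_zero
          intro e he
          rw [hp3 e he, if_neg, mul_zero]
          rintro ⟨u', hu', h'⟩
          obtain ⟨h0, h4⟩ := hr e he
          have : some u' ∈ (r e).map φ := by rw [h4, Sym2.mem_map]; exact ⟨u', hu', rfl⟩
          obtain ⟨a, _, ha⟩ := Sym2.mem_map.1 this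
          exact hx ⟨u', by rw [← h']; exact hroot u' a ha, h'⟩
    obtain ⟨c, hc⟩ := h2 _ hw
    refine ⟨c, ?_⟩
    ext e
    by_cases he : e ∈ H
    · have h4 := congrFun hc (r e)
      rw [Finset.sum_apply] at h4 ⊢
      simp only [Pi.smul_apply, π, he, if_true]
      simp only [Finset.sum_apply, Pi.smul_apply] at h4
      rw [← h4, sum_eq_single e]
      · simp [hp2 e he e he]
      · intro e' he' hne'; simp [hp2 e' he' e he, hne'.symm]
      · intro h; exact absurd he h
    · rw [hz.1 e he, Finset.sum_apply]
      simp [π, he]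
  · intro e
    by_cases he : e ∈ H
    · simpa [π, he] using h3 (r e)
    · simp [π, he]
end
end PB

namespace PB
section
open Classical Finset

variable {V U : Type}

lemma Rch.symm {E : Finset (Sym2 V)} {S : Set V} {a b : V} (h : Rch E S a b) : Rch E S b a := by
  induction h with
  | refl => exact .refl
  | tail _ h ih => exact .head ⟨by rw [Sym2.eq_swap]; exact h.1, h.2.2, h.2.1⟩ ih

lemma Rch.mono {E E' : Finset (Sym2 V)} {S S' : Set V} (hE : E ⊆ E') (hs : S ⊆ S') {a b : V}
    (h : Rch E S a b) : Rch E' S' a b :=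
  Relation.ReflTransGen.mono (fun _ _ h => ⟨hE h.1, hs h.2.1, hs h.2.2⟩) _ _ h

lemma Rch.restrict {E : Finset (Sym2 V)} {S : Set V} {p a : V} (h : Rch E S p a) :
    Rch E {v | v ∈ S ∧ Rch E S p v} p a := by
  induction h with
  | refl => exact .refl
  | tail h hxy ih => exact ih.tail ⟨hxy.1, ⟨hxy.2.1, h⟩, hxy.2.2, h.tail hxy⟩

/-- minor via disjoint sets -/
lemma minor_sets {E : Finset (Sym2 V)} {H : Finset (Sym2 U)} (hE : LL E) (hH : LL H)
    (hPl : Pl E) (T : U → Set V) (hT : ∀ u w, u ≠ w → ∀ x, x ∈ T u → x ∉ T w)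
    (hconn : ∀ u, ∀ a ∈ T u, ∀ b ∈ T u, Rch E (T u) a b)
    (hrep : ∀ u v, s(u,v) ∈ H → ∃ a ∈ T u, ∃ b ∈ T v, s(a,b) ∈ E) : Pl H := by
  have hφ : ∃ φ : V → Option U, ∀ x u, φ x = some u ↔ x ∈ T u := by
    refine ⟨fun x => if h : ∃ u, x ∈ T u then some h.choose else none, fun x u => ?_⟩
    by_cases h : ∃ u, x ∈ T u
    · simp only [h, dite_true, Option.some.injEq]
      have hs := h.choose_spec
      refine ⟨fun h' => h' ▸ hs, fun h' => ?_⟩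
      by_contra hne
      exact hT _ _ hne _ hs h'
    · simp only [h, dite_false]
      refine ⟨fun h' => by simp at h', fun h' => absurd ⟨u, h'⟩ h⟩
  obtain ⟨φ, hφ⟩ := hφ
  refine minor hE hH hPl φ ?_ ?_
  · intro u a b ha hb
    have : {x | φ x = some u} = T u := by ext x; exact hφ x u
    rw [this]
    exact hconn u a ((hφ _ _).1 ha) b ((hφ _ _).1 hb)
  · intro u v h
    obtain ⟨a, ha, b, hb, hab⟩ := hrep u v h
    exact ⟨a, b, hab, (hφ _ _).2 ha, (hφ _ _).2 hb⟩

lemma minor_model {E : Finset (Sym2 V)} {H : Finset (Sym2 U)} (hE : LL E) (hH : LL H)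
    (hPl : Pl E) (X : U → Set V) (Y : Sym2 U → Set V)
    (hX : ∀ u w, u ≠ w → ∀ x, x ∈ X u → x ∉ X w)
    (hXc : ∀ u, ∀ a ∈ X u, ∀ b ∈ X u, Rch E (X u) a b)
    (hYc : ∀ e ∈ H, ∀ a ∈ Y e, ∀ b ∈ Y e, Rch E (Y e) a b)
    (hXY : ∀ e ∈ H, ∀ u ∈ e, ∃ x ∈ X u, x ∈ Y e)
    (hXY' : ∀ e ∈ H, ∀ u ∉ e, ∀ x ∈ X u, x ∉ Y e)
    (hYY : ∀ e ∈ H, ∀ e' ∈ H, e ≠ e' → ∀ x ∈ Y e, x ∉ Y e') : Pl H := by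
  let hd : Sym2 U → U := fun e => e.out.1
  let tl : Sym2 U → U := fun e => e.out.2
  have hht : ∀ e, e = s(hd e, tl e) := fun e => (Quot.out_eq e).symm
  have hm : ∀ e, hd e ∈ e ∧ tl e ∈ e := fun e => ⟨Sym2.out_fst_mem e, Sym2.out_snd_mem e⟩
  let R : Sym2 U → Set V := fun e => {v | v ∈ Y e ∧ v ∉ X (tl e) ∧
    ∃ p ∈ X (hd e), Rch E (Y e \ X (tl e)) p v}
  let T : U → Set V := fun u => {v | v ∈ X u ∨ ∃ e ∈ H, hd e = u ∧ v ∈ R e}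
  have hne : ∀ e ∈ H, hd e ≠ tl e := by
    intro e he h
    have := hH e he
    rw [hht e, h] at this; simp at this
  have hXR : ∀ u, ∀ x ∈ X u, ∀ e ∈ H, x ∈ R e → u = hd e := by
    intro u x hx e he hxe
    by_contra hu
    by_cases hut : u = tl e
    · exact hxe.2.1 (hut ▸ hx)
    · refine hXY' e he u ?_ x hx hxe.1
      rw [hht e, Sym2.mem_iff]; tauto
  have key : ∀ e ∈ H, ∃ a ∈ T (hd e), ∃ b ∈ T (tl e), s(a,b) ∈ E := by
    intro e he
    obtain ⟨p, hp, hp'⟩ := hXY e he (hd e) (hm e).1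
    obtain ⟨q, hq, hq'⟩ := hXY e he (tl e) (hm e).2
    have hpR : p ∈ R e := ⟨hp', hX _ _ (hne e he) p hp, p, hp, .refl⟩
    have hqR : q ∉ R e := fun h => h.2.1 hq
    have hr := hYc e he p hp' q hq'
    by_contra hcon
    push Not at hcon
    apply hqR
    clear hq hq' hqR
    induction hr with
    | refl => exact hpR
    | @tail x y _ hxy ih =>
      have hyt : y ∉ X (tl e) := fun h =>
        hcon x (Or.inr ⟨e, he, rfl, ih⟩) y (Or.inl h) hxy.1
      obtain ⟨h1, h2, p', hp', hr⟩ := ih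
      exact ⟨hxy.2.2, hyt, p', hp', hr.tail ⟨hxy.1, ⟨h1, h2⟩, hxy.2.2, hyt⟩⟩
  refine minor_sets hE hH hPl T ?_ ?_ ?_
  · rintro u w huw x (hx | ⟨e, he, heu, hx⟩) (hx' | ⟨e', he', heu', hx'⟩)
    · exact hX _ _ huw x hx hx'
    · exact huw ((hXR u x hx e' he' hx').trans heu')
    · exact huw ((hXR w x hx' e he hx).trans heu).symm
    · by_cases hee : e = e'
      · subst hee; exact huw (heu.symm.trans heu')
      · exact hYY e he e' he' hee x hx.1 hx'.1
  · intro u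
    have hXT : X u ⊆ T u := fun x hx => Or.inl hx
    have h1 : ∀ a ∈ T u, ∃ b ∈ X u, Rch E (T u) b a := by
      rintro a (ha | ⟨e, he, heu, ha⟩)
      · exact ⟨a, ha, .refl⟩
      · obtain ⟨h1, h2, p, hp, hr⟩ := ha
        refine ⟨p, heu ▸ hp, ?_⟩
        refine hr.restrict.mono (subset_refl _) ?_
        rintro v ⟨⟨h3, h4⟩, h5⟩
        exact Or.inr ⟨e, he, heu, h3, h4, p, hp, h5⟩
    intro a ha b hb
    obtain ⟨a', ha', hra⟩ := h1 a ha
    obtain ⟨b', hb', hrb⟩ := h1 b hb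
    exact (hra.symm.trans ((hXc u a' ha' b' hb').mono (subset_refl _) hXT)).trans hrb
  · intro u v h
    obtain ⟨a, ha, b, hb, hab⟩ := key _ h
    have := hht s(u,v)
    rw [Sym2.eq_iff] at this
    rcases this with ⟨h1, h2⟩ | ⟨h1, h2⟩
    · exact ⟨a, h1 ▸ ha, b, h2 ▸ hb, hab⟩
    · exact ⟨b, h1 ▸ hb, a, h2 ▸ ha, by rwa [Sym2.eq_swap]⟩
end
end PB

namespace PB
section
open Classical Finset

abbrev Zp := ℤ × ℤ
def gv (p : Zp) : Sym2 Zp := s((p.1, p.2), (p.1, p.2 + 1))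
def gh (p : Zp) : Sym2 Zp := s((p.1, p.2), (p.1 + 1, p.2))

lemma gv_inj {p q : Zp} : gv p = gv q ↔ p = q := by
  obtain ⟨a, b⟩ := p; obtain ⟨c, d⟩ := q
  simp only [gv, Sym2.eq_iff, Prod.ext_iff]; omega
lemma gh_inj {p q : Zp} : gh p = gh q ↔ p = q := by
  obtain ⟨a, b⟩ := p; obtain ⟨c, d⟩ := q
  simp only [gh, Sym2.eq_iff, Prod.ext_iff]; omega
lemma gv_ne_gh {p q : Zp} : gv p ≠ gh q := by
  obtain ⟨a, b⟩ := p; obtain ⟨c, d⟩ := q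
  simp only [gv, gh, Sym2.eq_iff, Prod.ext_iff, ne_eq]; omega

noncomputable def grid (m : ℤ) : Finset (Sym2 Zp) :=
  (Icc 0 m ×ˢ Ico 0 m).image gv ∪ (Ico 0 m ×ˢ Icc 0 m).image gh

lemma gv_mem {m : ℤ} {p : Zp} : gv p ∈ grid m ↔ 0 ≤ p.1 ∧ p.1 ≤ m ∧ 0 ≤ p.2 ∧ p.2 < m := by
  simp only [grid, mem_union, mem_image, gv_inj, exists_eq_right, mem_product, mem_Icc, mem_Ico]
  constructor
  · rintro (h | ⟨q, _, h⟩)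
    · tauto
    · exact absurd h.symm gv_ne_gh
  · tauto

lemma gh_mem {m : ℤ} {p : Zp} : gh p ∈ grid m ↔ 0 ≤ p.1 ∧ p.1 < m ∧ 0 ≤ p.2 ∧ p.2 ≤ m := by
  simp only [grid, mem_union, mem_image, gh_inj, exists_eq_right, mem_product, mem_Icc, mem_Ico]
  constructor
  · rintro (⟨q, _, h⟩ | h)
    · exact absurd h gv_ne_gh
    · tauto
  · tauto

lemma grid_cases {m : ℤ} {e : Sym2 Zp} (h : e ∈ grid m) : (∃ p, e = gv p) ∨ ∃ p, e = gh p := by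
  simp only [grid, mem_union, mem_image] at h
  rcases h with ⟨p, _, h⟩ | ⟨p, _, h⟩
  · exact Or.inl ⟨p, h.symm⟩
  · exact Or.inr ⟨p, h.symm⟩

lemma grid_LL (m : ℤ) : LL (grid m) := by
  intro e he
  rcases grid_cases he with ⟨p, rfl⟩ | ⟨p, rfl⟩ <;> simp [gv, gh, Prod.ext_iff]

lemma grid_dg {m : ℤ} {z : Vec Zp} (hz : z ∈ Zc (grid m)) (i j : ℤ) :
    z (gv (i,j)) + z (gv (i,j-1)) + z (gh (i,j)) + z (gh (i-1,j)) = 0 := by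
  rw [← hz.2 (i,j)]
  set T : Finset (Sym2 Zp) := {gv (i,j), gv (i,j-1), gh (i,j), gh (i-1,j)} with hT
  rw [← dg_mono (E' := grid m ∪ T) subset_union_left hz.1]
  have : dg (grid m ∪ T) z (i,j) = ∑ e ∈ T, z e := by
    unfold dg
    rw [← sum_subset (s₁ := T) subset_union_right]
    · refine sum_congr rfl fun e he => ?_
      rw [if_pos]
      simp only [hT, mem_insert, mem_singleton] at he
      rcases he with rfl | rfl | rfl | rfl <;> simp [gv, gh]
    · intro e he heT
      rw [if_neg]
      intro hm
      rcases mem_union.1 he with he | he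
      · apply heT
        rcases grid_cases he with ⟨⟨a, b⟩, rfl⟩ | ⟨⟨a, b⟩, rfl⟩
        · simp only [gv, Sym2.mem_iff, Prod.ext_iff] at hm
          simp only [hT, mem_insert, mem_singleton, gv_inj, Prod.ext_iff]
          omega
        · simp only [gh, Sym2.mem_iff, Prod.ext_iff] at hm
          simp only [hT, mem_insert, mem_singleton, gh_inj, Prod.ext_iff]
          omega
      · exact heT he
  rw [this, hT, sum_insert, sum_insert, sum_insert, sum_singleton]
  · ring
  · simp only [mem_singleton, gh_inj, Prod.ext_iff]; omega
  · simp [gv_ne_gh]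
  · simp [gv_ne_gh, gv_inj]; omega

noncomputable def gf (p : Zp) : Vec Zp :=
  ind {gv p} + ind {gv (p.1 + 1, p.2)} + (ind {gh p} + ind {gh (p.1, p.2 + 1)})

lemma gf_v (p : Zp) (i j : ℤ) : gf p (gv (i,j)) = (if (i,j) = p then 1 else 0) +
    (if (i-1,j) = p then 1 else 0) := by
  obtain ⟨a, b⟩ := p
  simp only [gf, ind, Pi.add_apply, mem_singleton, gv_inj, gv_ne_gh, if_false, add_zero,
    Prod.ext_iff]
  congr 1
  exact if_congr (by omega) rfl rfl

lemma gf_h (p : Zp) (i j : ℤ) : gf p (gh (i,j)) = (if (i,j) = p then 1 else 0) +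
    (if (i,j-1) = p then 1 else 0) := by
  obtain ⟨a, b⟩ := p
  simp only [gf, ind, Pi.add_apply, mem_singleton, gh_inj, gv_ne_gh.symm, if_false, zero_add,
    Prod.ext_iff]
  congr 1
  exact if_congr (by omega) rfl rfl

lemma gf_mem {m : ℤ} {p : Zp} (h1 : 0 ≤ p.1) (h2 : p.1 < m) (h3 : 0 ≤ p.2) (h4 : p.2 < m) :
    gf p ∈ Zc (grid m) := by
  obtain ⟨a, b⟩ := p
  simp only at *
  have m1 : gv (a,b) ∈ grid m := gv_mem.2 ⟨h1, by simp; omega, h3, h4⟩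
  have m2 : gv (a+1,b) ∈ grid m := gv_mem.2 ⟨by simp; omega, by simp; omega, h3, h4⟩
  have m3 : gh (a,b) ∈ grid m := gh_mem.2 ⟨h1, h2, h3, by simp; omega⟩
  have m4 : gh (a,b+1) ∈ grid m := gh_mem.2 ⟨h1, h2, by simp; omega, by simp; omega⟩
  refine ⟨fun e he => ?_, fun v => ?_⟩
  · simp only [gf, Pi.add_apply]
    rw [ind_spt (singleton_subset_iff.2 m1) e he, ind_spt (singleton_subset_iff.2 m2) e he,
      ind_spt (singleton_subset_iff.2 m3) e he, ind_spt (singleton_subset_iff.2 m4) e he]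
    simp
  · simp only [gf, dg_add]
    simp only [gv, gh] at *
    rw [dg_single (by simp) m1, dg_single (by simp) m2, dg_single (by simp) m3,
      dg_single (by simp) m4]
    linear_combination z2self (dl (a,b) v) + z2self (dl (a,b+1) v) +
      z2self (dl (a+1,b) v) + z2self (dl (a+1,b+1) v)

lemma grid_Pl (m : ℤ) : Pl (grid m) := by
  set s : Finset Zp := Ico 0 m ×ˢ Ico 0 m with hs
  have hms : ∀ p, p ∈ s ↔ 0 ≤ p.1 ∧ p.1 < m ∧ 0 ≤ p.2 ∧ p.2 < m := by
    intro p; simp only [hs, mem_product, mem_Ico]; tauto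
  refine ⟨s, inferInstance, fun p => gf p.1, ?_, ?_, ?_⟩
  · rintro ⟨p, hp⟩
    obtain ⟨h1, h2, h3, h4⟩ := (hms p).1 hp
    exact gf_mem h1 h2 h3 h4
  · intro z hz
    let c : Zp → ZMod 2 := fun p => ∑ k ∈ Icc 0 p.1, z (gv (k, p.2))
    have c1 : ∀ i j, 0 ≤ i → c (i,j) = c (i-1,j) + z (gv (i,j)) := by
      intro i j hi
      have : Icc 0 i = insert i (Icc 0 (i-1)) := by ext k; simp only [mem_Icc, mem_insert]; omega
      simp only [c]
      rw [this, sum_insert (by simp), add_comm]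
    have c0 : ∀ i j, i < 0 → c (i,j) = 0 := by
      intro i j hi
      simp only [c]
      rw [Icc_eq_empty (by omega), sum_empty]
    have hv0 : ∀ p, ¬ (0 ≤ p.1 ∧ p.1 ≤ m ∧ 0 ≤ p.2 ∧ p.2 < m) → z (gv p) = 0 :=
      fun p h => hz.1 _ (by rwa [gv_mem])
    have hh0 : ∀ p, ¬ (0 ≤ p.1 ∧ p.1 < m ∧ 0 ≤ p.2 ∧ p.2 ≤ m) → z (gh p) = 0 :=
      fun p h => hz.1 _ (by rwa [gh_mem])
    have hrow : ∀ (j : ℤ) (n : ℕ), z (gh ((n:ℤ) - 1, j)) = c ((n:ℤ) - 1, j) + c ((n:ℤ)-1, j-1) := by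
      intro j n
      induction n with
      | zero =>
        rw [c0 _ _ (by simp), c0 _ _ (by simp), hh0 _ (by simp)]; simp
      | succ n ih =>
        push_cast
        rw [add_sub_cancel_right, c1 n j (by omega), c1 n (j-1) (by omega)]
        have := grid_dg hz n j
        rw [ih] at this
        linear_combination this - z2self (c ((n:ℤ) - 1, j)) - z2self (c ((n:ℤ) - 1, j-1)) -
          z2self (z (gv (n,j))) - z2self (z (gv (n,j-1)))
    have hrow' : ∀ i j, -1 ≤ i → z (gh (i,j)) = c (i,j) + c (i,j-1) := by
      intro i j hi
      have := hrow j (i+1).toNat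
      rwa [Int.toNat_of_nonneg (by omega), add_sub_cancel_right] at this
    have hbelow : ∀ i j, j < 0 ∨ m ≤ j → c (i,j) = 0 := by
      intro i j hj
      exact sum_eq_zero fun k _ => hv0 _ (by simp; omega)
    have hcm : 0 ≤ m → ∀ n : ℕ, c (m, (n:ℤ) - 1) = 0 := by
      intro hm n
      induction n with
      | zero => exact hbelow _ _ (by simp)
      | succ n ih =>
        have := hrow' m n (by omega)
        rw [ih, add_zero, hh0 _ (by simp)] at this
        push_cast
        rw [add_sub_cancel_right, ← this]
    have hcm' : ∀ j, c (m, j) = 0 := by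
      intro j
      by_cases hm : 0 ≤ m
      · by_cases hj : 0 ≤ j
        · have := hcm hm (j+1).toNat
          rwa [Int.toNat_of_nonneg (by omega), add_sub_cancel_right] at this
        · exact hbelow _ _ (by omega)
      · exact c0 _ _ (by omega)
    refine ⟨fun p => c p.1, ?_⟩
    rw [Finset.sum_coe_sort s (fun p => c p • gf p)]
    ext e
    rw [Finset.sum_apply]
    simp only [Pi.smul_apply, smul_eq_mul]
    by_cases he : e ∈ grid m
    · rcases grid_cases he with ⟨⟨i, j⟩, rfl⟩ | ⟨⟨i, j⟩, rfl⟩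
      · simp only [gf_v, mul_add, mul_ite, mul_one, mul_zero, sum_add_distrib, sum_ite_eq]
        have := gv_mem.1 he
        simp only [hms] at this ⊢
        have e1 : (if 0 ≤ i ∧ i < m ∧ 0 ≤ j ∧ j < m then c (i,j) else 0) = c (i,j) := by
          split_ifs with h
          · rfl
          · have : i = m := by omega
            rw [this, hcm']
        have e2 : (if 0 ≤ i-1 ∧ i-1 < m ∧ 0 ≤ j ∧ j < m then c (i-1,j) else 0) = c (i-1,j) := by
          split_ifs with h
          · rfl
          · rw [c0 _ _ (by omega)]
        rw [e1, e2, c1 _ _ (by omega)]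
        linear_combination -z2self (c (i-1,j))
      · simp only [gf_h, mul_add, mul_ite, mul_one, mul_zero, sum_add_distrib, sum_ite_eq]
        have := gh_mem.1 he
        simp only [hms] at this ⊢
        have e1 : (if 0 ≤ i ∧ i < m ∧ 0 ≤ j ∧ j < m then c (i,j) else 0) = c (i,j) := by
          split_ifs with h
          · rfl
          · rw [hbelow _ _ (by omega)]
        have e2 : (if 0 ≤ i ∧ i < m ∧ 0 ≤ j-1 ∧ j-1 < m then c (i,j-1) else 0) = c (i,j-1) := by
          split_ifs with h
          · rfl
          · rw [hbelow _ _ (by omega)]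
        rw [e1, e2, hrow' _ _ (by omega)]
    · rw [hz.1 e he]
      symm
      apply sum_eq_zero
      intro p hp
      obtain ⟨h1, h2, h3, h4⟩ := (hms p).1 hp
      rw [(gf_mem h1 h2 h3 h4).1 e he, mul_zero]
  · intro e
    have aux : ∀ (a b : Zp), (∀ p, gf p e ≠ 0 → p = a ∨ p = b) →
        #{p : s | gf p.1 e ≠ 0} ≤ 2 := by
      intro a b h
      rw [← card_map (Function.Embedding.subtype _)]
      refine le_trans (card_le_card (t := {a, b}) ?_) card_le_two
      intro p hp
      obtain ⟨q, hq, rfl⟩ := mem_map.1 hp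
      simp only [mem_filter, mem_univ, true_and] at hq
      simpa using h _ hq
    by_cases he : e ∈ grid m
    · rcases grid_cases he with ⟨⟨i, j⟩, rfl⟩ | ⟨⟨i, j⟩, rfl⟩
      · apply aux (i,j) (i-1,j)
        intro p hp
        by_contra hcon
        push Not at hcon
        rw [gf_v, if_neg hcon.1.symm, if_neg hcon.2.symm] at hp
        simp at hp
      · apply aux (i,j) (i,j-1)
        intro p hp
        by_contra hcon
        push Not at hcon
        rw [gf_h, if_neg hcon.1.symm, if_neg hcon.2.symm] at hp
        simp at hp
    · have : #{p : s | gf p.1 e ≠ 0} = 0 := by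
        rw [card_eq_zero, filter_eq_empty_iff]
        rintro ⟨p, hp⟩ _
        obtain ⟨h1, h2, h3, h4⟩ := (hms p).1 hp
        simpa using (gf_mem h1 h2 h3 h4).1 e he
      simp only [this]; omega
end
end PB

namespace PB
section
open Classical Finset

variable {V : Type}

lemma next_edge {E : Finset (Sym2 V)} {h : Vec V} (hh : h ∈ Zc E) {e : Sym2 V} (he : h e ≠ 0)
    {v : V} (hv : v ∈ e) : ∃ e' ∈ E, e' ≠ e ∧ v ∈ e' ∧ h e' ≠ 0 := by
  by_contra hcon
  push Not at hcon
  have heE : e ∈ E := by by_contra h'; exact he (hh.1 e h')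
  have := hh.2 v
  unfold dg at this
  rw [sum_eq_single e] at this
  · simp [hv, he] at this
  · intro e' he' hne
    split_ifs with hv'
    · exact hcon e' he' hne hv'
    · rfl
  · intro h'; exact absurd heE h'

lemma euler_bound {E : Finset (Sym2 V)} (hP : Pl E) (g k : ℕ)
    (hg : ∀ h ∈ Zc E, h ≠ 0 → g ≤ #{e ∈ E | h e ≠ 0})
    (z : Fin (k+1) → Vec V) (hz : ∀ i, z i ∈ Zc E) (p : Fin (k+1) → Sym2 V)
    (hp : ∀ i j, z i (p j) = if i = j then 1 else 0) : (k+2) * g ≤ 2 * #E := by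
  obtain ⟨ι, _, f, h1, h2, h3, h4⟩ := Pl_norm hP
  set N : Finset ι := univ.filter (fun i => f i ≠ 0) with hN
  have hlin : LinearIndependent (ZMod 2) z := by
    rw [Fintype.linearIndependent_iff]
    intro c hc j
    have := congrFun hc (p j)
    simpa [Finset.sum_apply, hp] using this
  have hN1 : N.Nonempty := by
    by_contra hne
    rw [not_nonempty_iff_eq_empty, filter_eq_empty_iff] at hne
    obtain ⟨c, hc⟩ := h2 _ (hz 0)
    rw [sum_eq_zero] at hc
    · exact hlin.ne_zero 0 hc
    · intro i hi
      have := hne hi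
      push Not at this
      rw [this, smul_zero]
  obtain ⟨a, ha⟩ := hN1
  set S : Finset (Vec V) := (N.erase a).image f with hS
  have hspan0 : ∀ i, i ≠ a → f i ∈ Submodule.span (ZMod 2) (S : Set (Vec V)) := by
    intro i hi
    by_cases h0 : f i = 0
    · rw [h0]; exact zero_mem _
    · exact Submodule.subset_span (by simp only [hS, coe_image]; exact ⟨i, by simp [hi, hN, h0], rfl⟩)
  have hspan : ∀ i, f i ∈ Submodule.span (ZMod 2) (S : Set (Vec V)) := by
    intro i
    by_cases hi : i = a
    · rw [← add_sum_erase _ _ (mem_univ a)] at h4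
      rw [hi, eq_neg_of_add_eq_zero_left h4]
      exact neg_mem (sum_mem fun j hj => hspan0 j (ne_of_mem_erase hj))
    · exact hspan0 i hi
  have hle : Submodule.span (ZMod 2) (Set.range z) ≤ Submodule.span (ZMod 2) (S : Set (Vec V)) := by
    rw [Submodule.span_le]
    rintro _ ⟨j, rfl⟩
    obtain ⟨c, hc⟩ := h2 _ (hz j)
    rw [hc]
    exact sum_mem fun i _ => Submodule.smul_mem _ _ (hspan i)
  have hcard : k + 1 ≤ #(N.erase a) := by
    have e1 := finrank_span_eq_card hlin
    have e2 := Submodule.finrank_mono hle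
    have e3 := finrank_span_finset_le_card (R := ZMod 2) S
    have e4 : #S ≤ #(N.erase a) := card_image_le
    rw [Fintype.card_fin] at e1
    unfold Set.finrank at e3
    omega
  rw [card_erase_of_mem ha] at hcard
  have hNk : k + 2 ≤ #N := by omega
  have h5 : ∑ i ∈ N, #{e ∈ E | f i e ≠ 0} ≤ ∑ i, #{e ∈ E | f i e ≠ 0} :=
    sum_le_sum_of_subset (subset_univ _)
  have h6 : #N * g ≤ ∑ i ∈ N, #{e ∈ E | f i e ≠ 0} := by
    rw [← smul_eq_mul]
    exact card_nsmul_le_sum _ _ _ fun i hi => hg _ (h1 i) (mem_filter.1 hi).2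
  have h7 : ∑ i, #{e ∈ E | f i e ≠ 0} = ∑ e ∈ E, #{i | f i e ≠ 0} := by
    simp only [card_filter]
    rw [sum_comm]
  have h8 : ∑ e ∈ E, #{i | f i e ≠ 0} ≤ 2 * #E := by
    rw [mul_comm, ← smul_eq_mul]
    exact sum_le_card_nsmul _ _ _ fun e _ => h3 e
  have h9 : (k+2) * g ≤ #N * g := Nat.mul_le_mul_right _ hNk
  omega

def k5 : Finset (Sym2 (Fin 5)) := univ.filter (fun e => ¬ e.IsDiag)
abbrev U33 := Bool × Fin 3
noncomputable def ke (i j : Fin 3) : Sym2 U33 := s((false, i), (true, j))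
noncomputable def k33 : Finset (Sym2 U33) := univ.image (fun p : Fin 3 × Fin 3 => ke p.1 p.2)

lemma three_card {α : Type} {s : Finset α} {a b c : α} (ha : a ∈ s) (hb : b ∈ s) (hc : c ∈ s)
    (h1 : a ≠ b) (h2 : a ≠ c) (h3 : b ≠ c) : 3 ≤ #s := by
  have : #({a,b,c} : Finset α) = 3 := card_eq_three.2 ⟨a,b,c,h1,h2,h3,rfl⟩
  rw [← this]
  apply card_le_card
  intro x; simp only [mem_insert, mem_singleton]; rintro (rfl | rfl | rfl) <;> assumption

lemma girth3 {E : Finset (Sym2 V)} (hE : LL E) (h : Vec V) (hh : h ∈ Zc E) (h0 : h ≠ 0) :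
    3 ≤ #{e ∈ E | h e ≠ 0} := by
  obtain ⟨e, he⟩ := Function.ne_iff.1 h0
  have heE : e ∈ E := by by_contra h'; exact he (hh.1 e h')
  have hd := hE e heE
  induction e using Sym2.ind with
  | _ a b =>
    have hab : a ≠ b := by simpa using hd
    obtain ⟨e1, h1, h1n, h1v, h1h⟩ := next_edge hh he (v := a) (by simp)
    obtain ⟨e2, h2, h2n, h2v, h2h⟩ := next_edge hh he (v := b) (by simp)
    refine three_card (a := s(a,b)) (b := e1) (c := e2) (mem_filter.2 ⟨heE, he⟩)
      (mem_filter.2 ⟨h1, h1h⟩) (mem_filter.2 ⟨h2, h2h⟩) h1n.symm h2n.symm ?_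
    rintro rfl
    exact h1n ((Sym2.mem_and_mem_iff hab).1 ⟨h1v, h2v⟩)

lemma k5_LL : LL k5 := fun e he => (mem_filter.1 he).2
lemma k33_LL : LL k33 := by
  intro e he
  obtain ⟨p, _, rfl⟩ := mem_image.1 he
  simp [ke]
lemma ke_inj {i j i' j' : Fin 3} : ke i j = ke i' j' ↔ i = i' ∧ j = j' := by
  simp [ke, Sym2.eq_iff]
lemma ke_mem (i j : Fin 3) : ke i j ∈ k33 := mem_image.2 ⟨(i,j), mem_univ _, rfl⟩

lemma girth4 (h : Vec U33) (hh : h ∈ Zc k33) (h0 : h ≠ 0) : 4 ≤ #{e ∈ k33 | h e ≠ 0} := by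
  obtain ⟨e, he⟩ := Function.ne_iff.1 h0
  have heE : e ∈ k33 := by by_contra h'; exact he (hh.1 e h')
  obtain ⟨⟨i, j⟩, _, rfl⟩ := mem_image.1 heE
  obtain ⟨e1, h1, h1n, h1v, h1h⟩ := next_edge hh he (v := (false, i)) (by simp [ke])
  obtain ⟨e2, h2, h2n, h2v, h2h⟩ := next_edge hh he (v := (true, j)) (by simp [ke])
  obtain ⟨⟨i1, j1⟩, _, rfl⟩ := mem_image.1 h1
  obtain ⟨⟨i2, j2⟩, _, rfl⟩ := mem_image.1 h2
  obtain ⟨e3, h3, h3n, h3v, h3h⟩ := next_edge hh h1h (v := (true, j1)) (by simp [ke])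
  obtain ⟨⟨i3, j3⟩, _, rfl⟩ := mem_image.1 h3
  simp only [ke, Sym2.mem_iff, Prod.mk.injEq, true_and, false_and, or_false, false_or,
    Bool.false_eq_true, reduceCtorEq] at h1v h2v h3v
  simp only [ne_eq, ke_inj] at h1n h2n h3n
  subst h1v h2v h3v
  have hc : #({ke i j, ke i j1, ke i2 j, ke i3 j1} : Finset (Sym2 U33)) = 4 := by
    rw [card_insert_of_notMem, card_insert_of_notMem, card_insert_of_notMem, card_singleton]
    all_goals simp only [mem_insert, mem_singleton, ke_inj, not_or]
    all_goals tauto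
  rw [← hc]
  apply card_le_card
  intro x; simp only [mem_insert, mem_singleton]
  rintro (rfl | rfl | rfl | rfl) <;> simp only [mem_filter] <;> constructor <;> assumption

lemma not_Pl_k33 : ¬ Pl k33 := by
  intro hP
  have hc : ∀ i j : Fin 3, ind {ke 0 0} + ind {ke i 0} + (ind {ke 0 j} + ind {ke i j}) ∈ Zc k33 := by
    intro i j
    refine ⟨fun e he => ?_, fun v => ?_⟩
    · simp only [Pi.add_apply]
      rw [ind_spt (singleton_subset_iff.2 (ke_mem 0 0)) e he, ind_spt (singleton_subset_iff.2 (ke_mem i 0)) e he,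
        ind_spt (singleton_subset_iff.2 (ke_mem 0 j)) e he, ind_spt (singleton_subset_iff.2 (ke_mem i j)) e he]
      simp
    · simp only [dg_add]
      have := ke_mem
      simp only [ke] at this ⊢
      rw [dg_single (by simp) (this _ _), dg_single (by simp) (this _ _), dg_single (by simp) (this _ _),
        dg_single (by simp) (this _ _)]
      linear_combination z2self (dl (false,0) v) + z2self (dl (false,i) v) +
        z2self (dl (true,0) v) + z2self (dl (true,j) v)
  have := euler_bound hP 4 3 girth4
    (fun t => ind {ke 0 0} + ind {ke (![1,1,2,2] t) 0} + (ind {ke 0 (![1,2,1,2] t)} +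
      ind {ke (![1,1,2,2] t) (![1,2,1,2] t)}))
    (fun t => hc _ _) (fun t => ke (![1,1,2,2] t) (![1,2,1,2] t)) (by
      intro i j
      simp only [ind, Pi.add_apply, mem_singleton, ke_inj]
      revert i j; decide)
  have h9 : #k33 ≤ 9 := card_image_le
  omega

lemma not_Pl_k5 : ¬ Pl k5 := by
  intro hP
  have hm : ∀ i j : Fin 5, i ≠ j → s(i,j) ∈ k5 := by
    intro i j h; simpa [k5] using h
  have hc : ∀ i j : Fin 5, i ≠ 0 → j ≠ 0 → i ≠ j →
      ind {s(0,i)} + ind {s(0,j)} + ind {s(i,j)} ∈ Zc k5 := by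
    intro i j hi hj hij
    have m1 := hm 0 i hi.symm
    have m2 := hm 0 j hj.symm
    have m3 := hm i j hij
    refine ⟨fun e he => ?_, fun v => ?_⟩
    · simp only [Pi.add_apply]
      rw [ind_spt (singleton_subset_iff.2 m1) e he, ind_spt (singleton_subset_iff.2 m2) e he,
        ind_spt (singleton_subset_iff.2 m3) e he]
      simp
    · simp only [dg_add]
      rw [dg_single hi.symm m1, dg_single hj.symm m2, dg_single hij m3]
      linear_combination z2self (dl 0 v) + z2self (dl i v) + z2self (dl j v)
  have := euler_bound hP 3 5 (girth3 k5_LL)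
    (fun t => ind {s(0, ![1,1,1,2,2,3] t)} + ind {s(0, ![2,3,4,3,4,4] t)} +
      ind {s(![1,1,1,2,2,3] t, ![2,3,4,3,4,4] t)})
    (fun t => hc _ _ (by revert t; decide) (by revert t; decide) (by revert t; decide))
    (fun t => s(![1,1,1,2,2,3] t, ![2,3,4,3,4,4] t)) (by
      intro i j
      simp only [ind, Pi.add_apply, mem_singleton, Sym2.eq_iff]
      revert i j; decide)
  have h9 : #k5 = 10 := by
    have h8 := Sym2.card_subtype_not_diag (α := Fin 5)
    rw [Fintype.card_subtype] at h8
    rw [k5]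
    convert h8
    decide
  omega
end
end PB

namespace PB
section
open Classical Finset Filter Topology

abbrev P2 := ℝ × ℝ

def cell (ε : ℝ) (N : ℕ) (p : Zp) : Set P2 :=
  {x | ε * (p.1 - N) ≤ x.1 ∧ x.1 ≤ ε * (p.1 - N + 1) ∧ ε * (p.2 - N) ≤ x.2 ∧ x.2 ≤ ε * (p.2 - N + 1)}

def cells (ε : ℝ) (N : ℕ) (S : Set P2) : Set Zp := {p | ∃ x ∈ S, x ∈ cell ε N p}

def InBox (ε : ℝ) (N : ℕ) (S : Set P2) : Prop := ∀ x ∈ S, |x.1| < N * ε ∧ |x.2| < N * ε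

lemma cell_closed (ε : ℝ) (N : ℕ) (p : Zp) : IsClosed (cell ε N p) := by
  unfold cell
  simp only [Set.ofPred_and]
  refine IsClosed.inter (isClosed_le (by fun_prop) (by fun_prop)) (IsClosed.inter (isClosed_le (by fun_prop) (by fun_prop)) (IsClosed.inter (isClosed_le (by fun_prop) (by fun_prop)) (isClosed_le (by fun_prop) (by fun_prop))))

lemma exists_cell {ε : ℝ} (hε : 0 < ε) (N : ℕ) (x : P2) : ∃ p, x ∈ cell ε N p := by
  refine ⟨(⌊x.1 / ε⌋ + N, ⌊x.2 / ε⌋ + N), ?_⟩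
  have h : ∀ t : ℝ, ε * (⌊t/ε⌋ : ℝ) ≤ t ∧ t ≤ ε * ((⌊t/ε⌋ : ℝ) + 1) := by
    intro t
    have h1 := Int.floor_le (t/ε)
    have h2 := (Int.lt_floor_add_one (t/ε)).le
    constructor
    · calc ε * (⌊t/ε⌋ : ℝ) ≤ ε * (t/ε) := by gcongr
        _ = t := by field_simp
    · calc t = ε * (t/ε) := by field_simp
        _ ≤ _ := by gcongr
  simp only [cell, Set.mem_ofPred_eq]
  push_cast
  simp only [add_sub_cancel_right]
  exact ⟨(h _).1, (h _).2, (h _).1, (h _).2⟩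

lemma cells_box {ε : ℝ} (hε : 0 < ε) {N : ℕ} {S : Set P2} (hS : InBox ε N S) {p : Zp}
    (hp : p ∈ cells ε N S) : 0 ≤ p.1 ∧ p.1 < 2 * N ∧ 0 ≤ p.2 ∧ p.2 < 2 * N := by
  obtain ⟨x, hx, h1, h2, h3, h4⟩ := hp
  obtain ⟨b1, b2⟩ := hS x hx
  rw [abs_lt] at b1 b2
  have lo : ∀ (i : ℤ) (t : ℝ), t ≤ ε * (i - N + 1) → -(N * ε) < t → 0 ≤ i := by
    intro i t h1 h2
    have : ε * (-N) < ε * (i - N + 1) := by linarith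
    have := lt_of_mul_lt_mul_left this hε.le
    have : (-1 : ℝ) < i := by linarith
    have : (-1 : ℤ) < i := by exact_mod_cast this
    omega
  have hi : ∀ (i : ℤ) (t : ℝ), ε * (i - N) ≤ t → t < N * ε → i < 2 * N := by
    intro i t h1 h2
    have : ε * (i - N) < ε * N := by linarith
    have := lt_of_mul_lt_mul_left this hε.le
    have : (i : ℝ) < 2 * N := by linarith
    exact_mod_cast this
  exact ⟨lo _ _ h2 b1.1, hi _ _ h1 b1.2, lo _ _ h4 b2.1, hi _ _ h3 b2.2⟩

lemma cell_near {ε : ℝ} (hε : 0 < ε) {N : ℕ} {p q : Zp} {x : P2} (hp : x ∈ cell ε N p)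
    (hq : x ∈ cell ε N q) : p.1 ≤ q.1 + 1 ∧ p.2 ≤ q.2 + 1 := by
  obtain ⟨h1, h2, h3, h4⟩ := hp
  obtain ⟨k1, k2, k3, k4⟩ := hq
  have : ∀ i j : ℤ, ε * (i - N) ≤ ε * (j - N + 1) → i ≤ j + 1 := by
    intro i j h
    have := le_of_mul_le_mul_left h hε
    have : (i : ℝ) ≤ j + 1 := by linarith
    exact_mod_cast this
  exact ⟨this _ _ (h1.trans k2), this _ _ (h3.trans k4)⟩

lemma grid_step {m : ℤ} {S : Set Zp} {i j i' j' : ℤ}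
    (h : (i = i' ∧ j ≤ j' + 1 ∧ j' ≤ j + 1) ∨ (j = j' ∧ i ≤ i' + 1 ∧ i' ≤ i + 1))
    (hp : (i,j) ∈ S) (hq : (i',j') ∈ S)
    (hb : ∀ p ∈ S, 0 ≤ p.1 ∧ p.1 < m ∧ 0 ≤ p.2 ∧ p.2 < m) : Rch (grid m) S (i,j) (i',j') := by
  have b1 := hb _ hp
  have b2 := hb _ hq
  simp only at b1 b2
  have hv : ∀ i j, (i,j) ∈ S → (i,j+1) ∈ S → Rch (grid m) S (i,j) (i,j+1) := by
    intro i j h1 h2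
    have b1 := hb _ h1
    have : gv (i,j) ∈ grid m := gv_mem.2 ⟨b1.1, b1.2.1.le, b1.2.2.1, b1.2.2.2⟩
    exact .single ⟨this, h1, h2⟩
  have hh : ∀ i j, (i,j) ∈ S → (i+1,j) ∈ S → Rch (grid m) S (i,j) (i+1,j) := by
    intro i j h1 h2
    have b1 := hb _ h1
    have : gh (i,j) ∈ grid m := gh_mem.2 ⟨b1.1, b1.2.1, b1.2.2.1, b1.2.2.2.le⟩
    exact .single ⟨this, h1, h2⟩
  rcases h with ⟨rfl, h1, h2⟩ | ⟨rfl, h1, h2⟩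
  · have : j' = j ∨ j' = j + 1 ∨ j = j' + 1 := by omega
    rcases this with rfl | rfl | rfl
    · exact .refl
    · exact hv _ _ hp hq
    · exact (hv _ _ hq hp).symm
  · have : i' = i ∨ i' = i + 1 ∨ i = i' + 1 := by omega
    rcases this with rfl | rfl | rfl
    · exact .refl
    · exact hh _ _ hp hq
    · exact (hh _ _ hq hp).symm

lemma cells_conn {ε : ℝ} (hε : 0 < ε) {N : ℕ} {S : Set P2} (hS : InBox ε N S)
    (hc : IsPreconnected S) {a b : Zp} (ha : a ∈ cells ε N S) (hb : b ∈ cells ε N S) :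
    Rch (grid (2 * N)) (cells ε N S) a b := by
  have hfin : (cells ε N S).Finite := by
    refine (Set.Finite.prod (Set.finite_Icc (0:ℤ) (2*N)) (Set.finite_Icc (0:ℤ) (2*N))).subset ?_
    intro p hp
    have := cells_box hε hS hp
    simp only [Set.mem_prod, Set.mem_Icc]; omega
  by_contra hab
  set R : Set Zp := {p | p ∈ cells ε N S ∧ Rch (grid (2*N)) (cells ε N S) a p} with hR
  set R' : Set Zp := {p | p ∈ cells ε N S ∧ ¬ Rch (grid (2*N)) (cells ε N S) a p} with hR'
  have hcl : ∀ Q : Set Zp, Q ⊆ cells ε N S → IsClosed (⋃ p ∈ Q, cell ε N p) := fun Q hQ =>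
    (hfin.subset hQ).isClosed_biUnion fun p _ => cell_closed ε N p
  have := isPreconnected_closed_iff.1 hc _ _ (hcl R fun p h => h.1) (hcl R' fun p h => h.1) ?_ ?_ ?_
  · obtain ⟨x, hxS, hx1, hx2⟩ := this
    simp only [Set.mem_iUnion] at hx1 hx2
    obtain ⟨⟨i, j⟩, hp, hxp⟩ := hx1
    obtain ⟨⟨i', j'⟩, hq, hxq⟩ := hx2
    have n1 := cell_near hε hxp hxq
    have n2 := cell_near hε hxq hxp
    have hmid : (i, j') ∈ cells ε N S := ⟨x, hxS, hxp.1, hxp.2.1, hxq.2.2.1, hxq.2.2.2⟩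
    apply hq.2
    refine (hp.2.trans (grid_step (i := i) (j := j) (i' := i) (j' := j') ?_ hp.1 hmid ?_)).trans
      (grid_step ?_ hmid hq.1 ?_)
    · simp only at n1 n2; omega
    · intro p hp; exact cells_box hε hS hp
    · simp only at n1 n2; omega
    · intro p hp; exact cells_box hε hS hp
  · intro x hx
    obtain ⟨p, hp⟩ := exists_cell hε N x
    have hpS : p ∈ cells ε N S := ⟨x, hx, hp⟩
    by_cases h : Rch (grid (2*N)) (cells ε N S) a p
    · left; simp only [Set.mem_iUnion]; exact ⟨p, ⟨hpS, h⟩, hp⟩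
    · right; simp only [Set.mem_iUnion]; exact ⟨p, ⟨hpS, h⟩, hp⟩
  · obtain ⟨x, hx, hxa⟩ := ha
    refine ⟨x, hx, ?_⟩
    simp only [Set.mem_iUnion]; exact ⟨a, ⟨⟨x, hx, hxa⟩, .refl⟩, hxa⟩
  · obtain ⟨x, hx, hxa⟩ := hb
    refine ⟨x, hx, ?_⟩
    simp only [Set.mem_iUnion]; exact ⟨b, ⟨⟨x, hx, hxa⟩, hab⟩, hxa⟩

lemma cells_disj {ε : ℝ} {N : ℕ} {S S' : Set P2} (h : ∀ x ∈ S, ∀ y ∈ S', ε < dist x y)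
    {p : Zp} (hp : p ∈ cells ε N S) : p ∉ cells ε N S' := by
  rintro ⟨y, hy, k1, k2, k3, k4⟩
  obtain ⟨x, hx, h1, h2, h3, h4⟩ := hp
  have := h x hx y hy
  rw [Prod.dist_eq, lt_max_iff, Real.dist_eq, Real.dist_eq, lt_abs, lt_abs] at this
  rcases this with (h | h) | (h | h) <;> linarith

lemma ev_disj {S S' : Set P2} (hS : IsCompact S) (hS' : IsCompact S') (hd : Disjoint S S') :
    ∀ᶠ ε in 𝓝[>] (0:ℝ), ∀ x ∈ S, ∀ y ∈ S', ε < dist x y := by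
  obtain ⟨r, hr, h⟩ := Metric.exists_pos_forall_lt_edist hS hS'.isClosed hd
  have : ∀ᶠ ε in 𝓝[>] (0:ℝ), ε < (r:ℝ) := by
    filter_upwards [Ioo_mem_nhdsGT (show (0:ℝ) < r by exact_mod_cast hr)] with x hx using hx.2
  filter_upwards [this, self_mem_nhdsWithin] with ε hε h0 x hx y hy
  have := h x hx y hy
  rw [edist_nndist] at this
  have : r < nndist x y := by exact_mod_cast this
  have : (r:ℝ) < dist x y := by exact_mod_cast this
  linarith

lemma ev_box {S : Set P2} (hS : IsCompact S) {ε : ℝ} (hε : 0 < ε) : ∀ᶠ N in atTop, InBox ε N S := by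
  obtain ⟨r, hr⟩ := hS.isBounded.subset_closedBall 0
  obtain ⟨n, hn⟩ := exists_nat_gt (r / ε)
  filter_upwards [eventually_ge_atTop n] with N hN x hx
  have h1 := hr hx
  rw [mem_closedBall_zero_iff, Prod.norm_def, max_le_iff, Real.norm_eq_abs, Real.norm_eq_abs] at h1
  have h2 : r < N * ε := by
    rw [div_lt_iff₀ hε] at hn
    have : (n:ℝ) ≤ N := by exact_mod_cast hN
    nlinarith
  exact ⟨h1.1.trans_lt h2, h1.2.trans_lt h2⟩

lemma top_model {U : Type} [Finite U] {H : Finset (Sym2 U)} (hH : LL H)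
    (K : U → Set P2) (A : Sym2 U → Set P2)
    (hK : ∀ u, IsCompact (K u) ∧ IsPreconnected (K u))
    (hA : ∀ e ∈ H, IsCompact (A e) ∧ IsPreconnected (A e))
    (hKK : ∀ u v, u ≠ v → Disjoint (K u) (K v))
    (hKA : ∀ e ∈ H, ∀ u ∈ e, (K u ∩ A e).Nonempty)
    (hKA' : ∀ e ∈ H, ∀ u ∉ e, Disjoint (K u) (A e))
    (hAA : ∀ e ∈ H, ∀ e' ∈ H, e ≠ e' → Disjoint (A e) (A e')) : Pl H := by
  have h1 : ∀ᶠ ε in 𝓝[>] (0:ℝ), ∀ u v, u ≠ v → ∀ x ∈ K u, ∀ y ∈ K v, ε < dist x y := by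
    simp only [eventually_all]
    exact fun u v h => ev_disj (hK u).1 (hK v).1 (hKK u v h)
  have h2 : ∀ᶠ ε in 𝓝[>] (0:ℝ), ∀ e, e ∈ H → ∀ u, u ∉ e → ∀ x ∈ K u, ∀ y ∈ A e, ε < dist x y := by
    simp only [eventually_all]
    exact fun e he u h => ev_disj (hK u).1 (hA e he).1 (hKA' e he u h)
  have h3 : ∀ᶠ ε in 𝓝[>] (0:ℝ), ∀ e, e ∈ H → ∀ e', e' ∈ H → e ≠ e' →
      ∀ x ∈ A e, ∀ y ∈ A e', ε < dist x y := by
    simp only [eventually_all]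
    exact fun e he e' he' h => ev_disj (hA e he).1 (hA e' he').1 (hAA e he e' he' h)
  obtain ⟨ε, ⟨h1, h2, h3⟩, hε⟩ := ((h1.and (h2.and h3)).and self_mem_nhdsWithin).exists
  replace hε : 0 < ε := hε
  have h4 : ∀ᶠ N : ℕ in atTop, ∀ u, InBox ε N (K u) := by
    simp only [eventually_all]; exact fun u => ev_box (hK u).1 hε
  have h5 : ∀ᶠ N : ℕ in atTop, ∀ e, e ∈ H → InBox ε N (A e) := by
    simp only [eventually_all]; exact fun e he => ev_box (hA e he).1 hε
  obtain ⟨N, h4, h5⟩ := (h4.and h5).exists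
  refine minor_model (grid_LL (2*N)) hH (grid_Pl _) (fun u => cells ε N (K u))
    (fun e => cells ε N (A e)) ?_ ?_ ?_ ?_ ?_ ?_
  · exact fun u w h x hx => cells_disj (h1 u w h) hx
  · exact fun u a ha b hb => cells_conn hε (h4 u) (hK u).2 ha hb
  · exact fun e he a ha b hb => cells_conn hε (h5 e he) (hA e he).2 ha hb
  · intro e he u hu
    obtain ⟨x, hx1, hx2⟩ := hKA e he u hu
    obtain ⟨p, hp⟩ := exists_cell hε N x
    exact ⟨p, ⟨x, hx1, hp⟩, ⟨x, hx2, hp⟩⟩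
  · exact fun e he u hu x hx => cells_disj (h2 e he u hu) hx
  · exact fun e he e' he' h x hx => cells_disj (h3 e he e' he' h) hx
end
end PB

namespace PB
section
open Classical Finset Filter Topology

variable {W : Type}

def IsArc (A : Set P2) (p q : P2) : Prop :=
  ∃ γ : ℝ → P2, ContinuousOn γ (Set.Icc 0 1) ∧ Set.InjOn γ (Set.Icc 0 1) ∧ γ 0 = p ∧ γ 1 = q ∧
    γ '' Set.Icc 0 1 = A

structure Drw (E : Finset (Sym2 W)) (vert : W → P2) (arc : Sym2 W → Set P2) : Prop where
  inj : Set.InjOn vert (vs E)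
  ar : ∀ u v, s(u,v) ∈ E → IsArc (arc s(u,v)) (vert u) (vert v)
  av : ∀ e ∈ E, ∀ w ∈ vs E, vert w ∈ arc e → w ∈ e
  aa : ∀ e ∈ E, ∀ e' ∈ E, e ≠ e' → ∀ p ∈ arc e, p ∈ arc e' → ∃ w ∈ vs E, p = vert w

lemma conn_through {F : Set P2} (hF : IsOpen F) (hc : IsPreconnected F) {Q : Set P2}
    (hQ : Q.Finite) (hQF : Q ⊆ F) : ∃ K, IsCompact K ∧ IsPreconnected K ∧ Q ⊆ K ∧ K ⊆ F := by
  rcases Q.eq_empty_or_nonempty with rfl | ⟨q0, hq0⟩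
  · exact ⟨∅, isCompact_empty, isPreconnected_empty, le_rfl, Set.empty_subset _⟩
  have hp : IsPathConnected F := hF.isConnected_iff_isPathConnected.1 ⟨⟨q0, hQF hq0⟩, hc⟩
  have hj : ∀ q ∈ Q, ∃ R : Set P2, IsCompact R ∧ IsPreconnected R ∧ q0 ∈ R ∧ q ∈ R ∧ R ⊆ F := by
    intro q hq
    have h := hp.joinedIn q0 (hQF hq0) q (hQF hq)
    refine ⟨Set.range h.somePath, isCompact_range h.somePath.continuous,
      isPreconnected_range h.somePath.continuous, ⟨0, by simp⟩, ⟨1, by simp⟩, ?_⟩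
    rintro _ ⟨t, rfl⟩
    exact h.somePath_mem t
  choose! R h1 h2 h3 h4 h5 using hj
  refine ⟨⋃ q ∈ Q, R q, hQ.isCompact_biUnion h1, ?_, ?_, ?_⟩
  · rw [← Set.sUnion_image]
    apply isPreconnected_sUnion q0
    · rintro _ ⟨q, hq, rfl⟩; exact h3 q hq
    · rintro _ ⟨q, hq, rfl⟩; exact h2 q hq
  · intro q hq; simp only [Set.mem_iUnion]; exact ⟨q, hq, h4 q hq⟩
  · simp only [Set.iUnion_subset_iff]; exact h5

noncomputable def plusE (E : Finset (Sym2 W)) (S : Finset W) : Finset (Sym2 (Option W)) :=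
  E.image (Sym2.map some) ∪ S.image (fun w => s(none, some w))

lemma plusE_cases {E : Finset (Sym2 W)} {S : Finset W} {g : Sym2 (Option W)} (h : g ∈ plusE E S) :
    (∃ e ∈ E, g = e.map some) ∨ ∃ w ∈ S, g = s(none, some w) := by
  simp only [plusE, mem_union, mem_image] at h
  rcases h with ⟨e, he, h⟩ | ⟨w, hw, h⟩
  · exact Or.inl ⟨e, he, h.symm⟩
  · exact Or.inr ⟨w, hw, h.symm⟩

lemma map_some_ne (e : Sym2 W) (w : W) : e.map some ≠ s(none, some w) := by
  intro h
  have : (none : Option W) ∈ e.map some := by rw [h]; simp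
  simp at this

lemma plusE_LL {E : Finset (Sym2 W)} (hE : LL E) (S : Finset W) : LL (plusE E S) := by
  intro g hg
  rcases plusE_cases hg with ⟨e, he, rfl⟩ | ⟨w, hw, rfl⟩
  · have := hE e he
    induction e using Sym2.ind with
    | _ a b => simpa using this
  · simp

lemma arcs_param {E : Finset (Sym2 W)} {vert : W → P2} {arc : Sym2 W → Set P2}
    (D : Drw E vert arc) : ∃ (γ : Sym2 W → ℝ → P2) (hd tl : Sym2 W → W), ∀ e ∈ E,
      e = s(hd e, tl e) ∧ ContinuousOn (γ e) (Set.Icc 0 1) ∧ Set.InjOn (γ e) (Set.Icc 0 1) ∧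
      γ e 0 = vert (hd e) ∧ γ e 1 = vert (tl e) ∧ γ e '' Set.Icc 0 1 = arc e := by
  have : ∀ e : Sym2 W, ∃ (γ : ℝ → P2) (h t : W), e ∈ E → e = s(h, t) ∧ ContinuousOn γ (Set.Icc 0 1) ∧
      Set.InjOn γ (Set.Icc 0 1) ∧ γ 0 = vert h ∧ γ 1 = vert t ∧ γ '' Set.Icc 0 1 = arc e := by
    intro e
    induction e using Sym2.ind with
    | _ a b =>
      by_cases he : s(a,b) ∈ E
      · obtain ⟨γ, h⟩ := D.ar a b he
        exact ⟨γ, a, b, fun _ => ⟨rfl, h⟩⟩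
      · exact ⟨fun _ => 0, a, b, fun h => absurd h he⟩
  choose γ h t H using this
  exact ⟨γ, h, t, H⟩

lemma Pl_plus [Finite W] {E : Finset (Sym2 W)} (hE : LL E) {vert : W → P2} {arc : Sym2 W → Set P2}
    (D : Drw E vert arc) {F : Set P2} (hF : IsOpen F) (hFc : IsPreconnected F)
    (hFE : ∀ e ∈ E, Disjoint F (arc e)) (S : Finset W) (hS : ∀ w ∈ S, w ∈ vs E)
    (hSF : ∀ w ∈ S, vert w ∈ closure F) : Pl (plusE E S) := by
  obtain ⟨γ, hd, tl, H⟩ := arcs_param D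
  have hht : ∀ e ∈ E, hd e ≠ tl e := by
    intro e he h
    have := hE e he
    rw [(H e he).1, h] at this; simp at this
  have i0 : (0:ℝ) ∈ Set.Icc (0:ℝ) 1 := by simp
  have i1 : (1:ℝ) ∈ Set.Icc (0:ℝ) 1 := by simp
  have hme : ∀ e ∈ E, ∀ w, w ∈ e ↔ w = hd e ∨ w = tl e := by
    intro e he w
    conv_lhs => rw [(H e he).1]
    exact Sym2.mem_iff
  have hpt : ∀ e ∈ E, ∀ t ∈ Set.Icc (0:ℝ) 1, ∀ x ∈ vs E, γ e t = vert x →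
      (x = hd e ∧ t = 0) ∨ (x = tl e ∧ t = 1) := by
    intro e he t ht x hx h
    obtain ⟨-, h2, h3, h4, h5, h6⟩ := H e he
    have hxe := D.av e he x hx (by rw [← h6, ← h]; exact ⟨t, ht, rfl⟩)
    rcases (hme e he x).1 hxe with rfl | rfl
    · left; exact ⟨rfl, h3 ht i0 (by rw [h, h4])⟩
    · right; exact ⟨rfl, h3 ht i1 (by rw [h, h5])⟩
  let J : Sym2 W → W → Set ℝ := fun e w => if w = hd e then Set.Icc 0 (1/3) else Set.Icc (2/3) 1
  have hJ01 : ∀ e w, J e w ⊆ Set.Icc 0 1 := by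
    intro e w
    simp only [J]; split_ifs <;> intro t ht <;> simp only [Set.mem_Icc] at ht ⊢ <;>
      constructor <;> linarith [ht.1, ht.2]
  have hM01 : Set.Icc (1/3:ℝ) (2/3) ⊆ Set.Icc 0 1 := by
    intro t ht; simp only [Set.mem_Icc] at ht ⊢; constructor <;> linarith [ht.1, ht.2]
  have hJc : ∀ e w, IsCompact (J e w) ∧ IsPreconnected (J e w) := by
    intro e w
    simp only [J]; split_ifs <;> exact ⟨isCompact_Icc, isPreconnected_Icc⟩
  let K0 : W → Set P2 := fun w => ⋃ e ∈ E.filter (fun e => w ∈ e), γ e '' J e w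
  have memK0 : ∀ w p, p ∈ K0 w ↔ ∃ e ∈ E, w ∈ e ∧ ∃ t ∈ J e w, γ e t = p := by
    intro w p
    simp only [K0, Set.mem_iUnion, mem_filter, Set.mem_image, exists_prop, and_assoc]
  have hvK : ∀ e ∈ E, ∀ w ∈ e, vert w ∈ γ e '' J e w := by
    intro e he w hw
    obtain ⟨-, h2, h3, h4, h5, h6⟩ := H e he
    rcases (hme e he w).1 hw with h | h
    · exact ⟨0, by simp [J, h], by rw [h4, h]⟩
    · refine ⟨1, ?_, by rw [h5, h]⟩
      have : w ≠ hd e := by rw [h]; exact (hht e he).symm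
      simp only [J, this, if_false, Set.mem_Icc]; norm_num
  have K0c : ∀ w, IsCompact (K0 w) := by
    intro w
    refine (E.filter (fun e => w ∈ e)).finite_toSet.isCompact_biUnion fun e he => ?_
    have he' : e ∈ E := (mem_filter.1 he).1
    exact (hJc e w).1.image_of_continuousOn ((H e he').2.1.mono (hJ01 e w))
  have K0p : ∀ w, IsPreconnected (K0 w) := by
    intro w
    have : K0 w = ⋃₀ ((fun e => γ e '' J e w) '' {e | e ∈ E ∧ w ∈ e}) := by
      rw [Set.sUnion_image]; ext p
      rw [memK0]
      simp only [Set.mem_iUnion, Set.mem_ofPred_eq, Set.mem_image, exists_prop, and_assoc]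
    rw [this]
    apply isPreconnected_sUnion (vert w)
    · rintro _ ⟨e, ⟨he, hw⟩, rfl⟩; exact hvK e he w hw
    · rintro _ ⟨e, ⟨he, hw⟩, rfl⟩
      exact (hJc e w).2.image _ ((H e he).2.1.mono (hJ01 e w))
  have hJend : ∀ e ∈ E, ∀ w ∈ e, ∀ t ∈ J e w, ∀ x ∈ vs E, γ e t = vert x → x = w := by
    intro e he w hw t ht x hx h
    rcases (hme e he w).1 hw with h' | h'
    · rcases hpt e he t (hJ01 _ _ ht) x hx h with ⟨h1, h2⟩ | ⟨h1, h2⟩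
      · rw [h1, h']
      · simp only [J, h', if_true, h2, Set.mem_Icc] at ht; norm_num at ht
    · have hne : w ≠ hd e := by rw [h']; exact (hht e he).symm
      rcases hpt e he t (hJ01 _ _ ht) x hx h with ⟨h1, h2⟩ | ⟨h1, h2⟩
      · simp only [J, hne, if_false, h2, Set.mem_Icc] at ht; norm_num at ht
      · rw [h1, h']
  have hvs : ∀ e ∈ E, ∀ w ∈ e, w ∈ vs E := fun e he w hw => ⟨e, he, hw⟩
  have arcmem : ∀ e ∈ E, ∀ t ∈ Set.Icc (0:ℝ) 1, γ e t ∈ arc e := by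
    intro e he t ht; rw [← (H e he).2.2.2.2.2]; exact ⟨t, ht, rfl⟩
  have hKK : ∀ w w', w ≠ w' → Disjoint (K0 w) (K0 w') := by
    intro w w' hne
    rw [Set.disjoint_left]
    intro p hp hp'
    obtain ⟨e, he, hw, t, ht, hpt1⟩ := (memK0 w p).1 hp
    obtain ⟨e', he', hw', t', ht', hpt2⟩ := (memK0 w' p).1 hp'
    by_cases hee : e = e'
    · subst hee
      have htt : t = t' := (H e he).2.2.1 (hJ01 _ _ ht) (hJ01 _ _ ht') (hpt1.trans hpt2.symm)
      subst htt
      have h1 := (hme e he w).1 hw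
      have h2 := (hme e he w').1 hw'
      have h3 := hht e he
      have hx : ¬ (t ∈ Set.Icc (0:ℝ) (1/3) ∧ t ∈ Set.Icc (2/3:ℝ) 1) := by
        rintro ⟨a, b⟩; have := a.2; have := b.1; linarith
      simp only [J] at ht ht'
      by_cases c1 : w = hd e
      · have c2 : w' ≠ hd e := fun h => hne (c1.trans h.symm)
        rw [if_pos c1] at ht; rw [if_neg c2] at ht'; exact hx ⟨ht, ht'⟩
      · have c2 : w' = hd e := by
          rcases h2 with h2 | h2
          · exact h2
          · exact absurd ((h1.resolve_left c1).trans h2.symm) hne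
        rw [if_neg c1] at ht; rw [if_pos c2] at ht'; exact hx ⟨ht', ht⟩
    · obtain ⟨x, hx, hpx⟩ := D.aa e he e' he' hee p (hpt1 ▸ arcmem e he t (hJ01 _ _ ht))
        (hpt2 ▸ arcmem e' he' t' (hJ01 _ _ ht'))
      have e1 := hJend e he w hw t ht x hx (hpt1.trans hpx)
      have e2 := hJend e' he' w' hw' t' ht' x hx (hpt2.trans hpx)
      exact hne (e1.symm.trans e2)
  have hMv : ∀ e ∈ E, ∀ t ∈ Set.Icc (1/3:ℝ) (2/3), ∀ x ∈ vs E, γ e t ≠ vert x := by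
    intro e he t ht x hx h
    rcases hpt e he t (hM01 ht) x hx h with ⟨_, h2⟩ | ⟨_, h2⟩ <;>
      (rw [h2] at ht; simp only [Set.mem_Icc] at ht; norm_num at ht)
  let A0 : Sym2 W → Set P2 := fun e => γ e '' Set.Icc (1/3) (2/3)
  have A0c : ∀ e ∈ E, IsCompact (A0 e) ∧ IsPreconnected (A0 e) := fun e he =>
    ⟨isCompact_Icc.image_of_continuousOn ((H e he).2.1.mono hM01),
      isPreconnected_Icc.image _ ((H e he).2.1.mono hM01)⟩
  have hAA : ∀ e ∈ E, ∀ e' ∈ E, e ≠ e' → Disjoint (A0 e) (A0 e') := by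
    intro e he e' he' hne
    rw [Set.disjoint_left]
    rintro p ⟨t, ht, h1⟩ ⟨t', ht', h2⟩
    obtain ⟨x, hx, hpx⟩ := D.aa e he e' he' hne p (h1 ▸ arcmem e he t (hM01 ht))
        (h2 ▸ arcmem e' he' t' (hM01 ht'))
    exact hMv e he t ht x hx (h1.trans hpx)
  have hKA' : ∀ e ∈ E, ∀ w ∉ e, Disjoint (K0 w) (A0 e) := by
    intro e he w hwe
    rw [Set.disjoint_left]
    rintro p hp ⟨t', ht', h2⟩
    obtain ⟨e', he', hw', t, ht, h1⟩ := (memK0 w p).1 hp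
    have hne : e' ≠ e := by rintro rfl; exact hwe hw'
    obtain ⟨x, hx, hpx⟩ := D.aa e' he' e he hne p (h1 ▸ arcmem e' he' t (hJ01 _ _ ht))
        (h2 ▸ arcmem e he t' (hM01 ht'))
    exact hMv e he t' ht' x hx (h2.trans hpx)
  have hKA : ∀ e ∈ E, ∀ w ∈ e, (K0 w ∩ A0 e).Nonempty := by
    intro e he w hw
    by_cases h' : w = hd e
    · refine ⟨γ e (1/3), (memK0 _ _).2 ⟨e, he, hw, 1/3, ?_, rfl⟩, 1/3, ?_, rfl⟩
      · simp only [J, h', if_true, Set.mem_Icc]; norm_num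
      · simp only [Set.mem_Icc]; norm_num
    · refine ⟨γ e (2/3), (memK0 _ _).2 ⟨e, he, hw, 2/3, ?_, rfl⟩, 2/3, ?_, rfl⟩
      · simp only [J, h', if_false, Set.mem_Icc]; norm_num
      · simp only [Set.mem_Icc]; norm_num
  have K0F : ∀ w, Disjoint F (K0 w) := by
    intro w
    rw [Set.disjoint_left]
    intro p hp hp'
    obtain ⟨e, he, hw, t, ht, h1⟩ := (memK0 w p).1 hp'
    exact Set.disjoint_left.1 (hFE e he) hp (h1 ▸ arcmem e he t (hJ01 _ _ ht))
  have A0F : ∀ e ∈ E, Disjoint F (A0 e) := by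
    intro e he
    rw [Set.disjoint_left]
    rintro p hp ⟨t, ht, h1⟩
    exact Set.disjoint_left.1 (hFE e he) hp (h1 ▸ arcmem e he t (hM01 ht))
  have vertK : ∀ w ∈ vs E, vert w ∈ K0 w := by
    rintro w ⟨e, he, hw⟩
    obtain ⟨t, ht, h⟩ := hvK e he w hw
    exact (memK0 _ _).2 ⟨e, he, hw, t, ht, h⟩
  -- choose the radius
  have ev1 : ∀ᶠ ε in 𝓝[>] (0:ℝ), ∀ w, w ∈ S → ∀ w', w' ≠ w → ∀ x ∈ ({vert w} : Set P2), ∀ y ∈ K0 w',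
      ε < dist x y := by
    simp only [eventually_all]
    intro w hw w' hne
    refine ev_disj isCompact_singleton (K0c w') ?_
    rw [Set.disjoint_singleton_left]
    exact fun h => Set.disjoint_left.1 (hKK w' w hne) h (vertK w (hS w hw))
  have ev2 : ∀ᶠ ε in 𝓝[>] (0:ℝ), ∀ w, w ∈ S → ∀ e, e ∈ E → ∀ x ∈ ({vert w} : Set P2), ∀ y ∈ A0 e,
      ε < dist x y := by
    simp only [eventually_all]
    intro w hw e he
    refine ev_disj isCompact_singleton (A0c e he).1 ?_
    rw [Set.disjoint_singleton_left]
    rintro ⟨t, ht, h⟩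
    exact hMv e he t ht w (hS w hw) h
  obtain ⟨ε, ⟨ev1, ev2⟩, hε⟩ := ((ev1.and ev2).and self_mem_nhdsWithin).exists
  replace hε : 0 < ε := hε
  have hq : ∀ w ∈ S, ∃ q ∈ F, dist (vert w) q < ε / 2 := fun w hw =>
    Metric.mem_closure_iff.1 (hSF w hw) (ε/2) (by linarith)
  choose! q hqF hqd using hq
  obtain ⟨K1, K1c, K1p, K1q, K1F⟩ := conn_through hF hFc (Q := q '' (S : Set W))
    (S.finite_toSet.image _) (by rintro _ ⟨w, hw, rfl⟩; exact hqF w hw)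
  have hsegball : ∀ w ∈ S, ∀ p ∈ segment ℝ (vert w) (q w), dist (vert w) p < ε / 2 := by
    intro w hw p hp
    have : segment ℝ (vert w) (q w) ⊆ Metric.ball (vert w) (ε/2) :=
      (convex_ball _ _).segment_subset (Metric.mem_ball_self (by linarith))
        (by rw [Metric.mem_ball']; exact hqd w hw)
    have := this hp
    rwa [Metric.mem_ball'] at this
  obtain ⟨A, hA1, hA2⟩ : ∃ A : Sym2 (Option W) → Set P2,
      (∀ e, A (e.map some) = A0 e) ∧ ∀ w, A s(none, some w) = segment ℝ (vert w) (q w) := by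
    refine ⟨fun g => if h : ∃ e : Sym2 W, g = e.map some then A0 h.choose else
      if h : ∃ w, g = s(none, some w) then segment ℝ (vert h.choose) (q h.choose) else ∅, ?_, ?_⟩
    · intro e
      have h : ∃ e' : Sym2 W, e.map some = e'.map some := ⟨e, rfl⟩
      simp only [h, dite_true]
      rw [Sym2.map.injective (Option.some_injective W) h.choose_spec.symm]
    · intro w
      have h : ¬ ∃ e' : Sym2 W, s(none, some w) = e'.map some := by
        rintro ⟨e, h⟩; exact map_some_ne e w h.symm
      have h' : ∃ w', s((none : Option W), some w) = s(none, some w') := ⟨w, rfl⟩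
      simp only [h, dite_false, h', dite_true]
      have h3 := h'.choose_spec
      generalize h'.choose = w' at *
      have : w = w' := by simpa using h3
      rw [this]
  refine top_model (plusE_LL hE S) (fun o => o.elim K1 K0) A ?_ ?_ ?_ ?_ ?_ ?_
  · rintro (_ | w)
    · exact ⟨K1c, K1p⟩
    · exact ⟨K0c w, K0p w⟩
  · intro g hg
    rcases plusE_cases hg with ⟨e, he, rfl⟩ | ⟨w, hw, rfl⟩
    · rw [hA1]; exact A0c e he
    · rw [hA2]
      refine ⟨?_, (convex_segment _ _).isPreconnected⟩
      rw [segment_eq_image_lineMap]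
      exact isCompact_Icc.image (by fun_prop)
  · rintro (_ | w) (_ | w') hne
    · exact absurd rfl hne
    · exact (K0F w').mono_left K1F
    · exact ((K0F w).mono_left K1F).symm
    · exact hKK w w' (fun h => hne (by rw [h]))
  · intro g hg u hu
    rcases plusE_cases hg with ⟨e, he, rfl⟩ | ⟨w, hw, rfl⟩
    · obtain ⟨x, hx, rfl⟩ := Sym2.mem_map.1 hu
      rw [hA1]; exact hKA e he x hx
    · rw [hA2]
      rcases Sym2.mem_iff.1 hu with rfl | rfl
      · exact ⟨q w, K1q ⟨w, hw, rfl⟩, right_mem_segment _ _ _⟩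
      · exact ⟨vert w, vertK w (hS w hw), left_mem_segment _ _ _⟩
  · intro g hg u hu
    rcases plusE_cases hg with ⟨e, he, rfl⟩ | ⟨w, hw, rfl⟩
    · rw [hA1]
      rcases u with _ | x
      · exact (A0F e he).mono_left K1F
      · refine hKA' e he x fun h => hu ?_
        exact Sym2.mem_map.2 ⟨x, h, rfl⟩
    · rw [hA2]
      rcases u with _ | x
      · simp at hu
      · have hxw : x ≠ w := by rintro rfl; simp at hu
        rw [Set.disjoint_left]
        intro p hp hp'
        have h1 := ev1 w hw x hxw (vert w) rfl p hp
        have h2 := hsegball w hw p hp'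
        linarith
  · have case2 : ∀ e ∈ E, ∀ w ∈ S, Disjoint (A0 e) (segment ℝ (vert w) (q w)) := by
      intro e he w hw
      rw [Set.disjoint_left]
      intro p hp hp'
      have h1 := ev2 w hw e he (vert w) rfl p hp
      have h2 := hsegball w hw p hp'
      linarith
    intro g hg g' hg' hne
    rcases plusE_cases hg with ⟨e, he, rfl⟩ | ⟨w, hw, rfl⟩ <;>
      rcases plusE_cases hg' with ⟨e', he', rfl⟩ | ⟨w', hw', rfl⟩
    · rw [hA1, hA1]; exact hAA e he e' he' (fun h => hne (by rw [h]))
    · rw [hA1, hA2]; exact case2 e he w' hw'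
    · rw [hA1, hA2]; exact (case2 e' he' w hw).symm
    · rw [hA2, hA2]
      have hww : w' ≠ w := by rintro rfl; exact hne rfl
      rw [Set.disjoint_left]
      intro p hp hp'
      have h1 := hsegball w hw p hp
      have h2 := hsegball w' hw' p hp'
      have h3 := ev1 w hw w' hww (vert w) rfl _ (vertK w' (hS w' hw'))
      have h4 := dist_triangle_right (vert w) (vert w') p
      linarith
end
end PB

namespace PB
section
open Classical Finset

variable {V : Type}

inductive Pth : V → V → Finset (Sym2 V) → Prop
  | single {x y : V} : x ≠ y → Pth x y {s(x,y)}
  | cons {x y z : V} {P : Finset (Sym2 V)} : Pth y z P → x ∉ vs P → Pth x z (insert s(x,y) P)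

lemma mem_vs {E : Finset (Sym2 V)} {v : V} : v ∈ vs E ↔ ∃ e ∈ E, v ∈ e := Iff.rfl

lemma vs_mono {E E' : Finset (Sym2 V)} (h : E ⊆ E') : vs E ⊆ vs E' := by
  rintro v ⟨e, he, hv⟩; exact ⟨e, h he, hv⟩

lemma vs_union {E E' : Finset (Sym2 V)} : vs (E ∪ E') = vs E ∪ vs E' := by
  ext v; simp only [mem_vs, mem_union, Set.mem_union, or_and_right, exists_or]

lemma vs_insert {E : Finset (Sym2 V)} {x y v : V} :
    v ∈ vs (insert s(x,y) E) ↔ v = x ∨ v = y ∨ v ∈ vs E := by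
  simp only [mem_vs, mem_insert, or_and_right, exists_or, exists_eq_left, Sym2.mem_iff, or_assoc]

lemma vs_single {x y v : V} : v ∈ vs ({s(x,y)} : Finset (Sym2 V)) ↔ v = x ∨ v = y := by
  simp [mem_vs]

lemma vs_finite (E : Finset (Sym2 V)) : (vs E).Finite := by
  have : vs E = ((E.biUnion fun e => e.toFinset : Finset V) : Set V) := by
    ext v; simp [mem_vs]
  rw [this]; exact Finset.finite_toSet _

namespace Pth
variable {x y z a : V} {P Q E : Finset (Sym2 V)}

lemma left_mem (h : Pth x y P) : x ∈ vs P := by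
  cases h with
  | single h => exact vs_single.2 (Or.inl rfl)
  | cons h h' => exact vs_insert.2 (Or.inl rfl)

lemma right_mem (h : Pth x y P) : y ∈ vs P := by
  induction h with
  | single h => exact vs_single.2 (Or.inr rfl)
  | cons h h' ih => exact vs_insert.2 (Or.inr (Or.inr ih))

lemma ne (h : Pth x y P) : x ≠ y := by
  cases h with
  | single h => exact h
  | cons h h' => rintro rfl; exact h' h.right_mem

lemma nonempty (h : Pth x y P) : P.Nonempty := by
  cases h <;> simp

lemma isLL (h : Pth x y P) : LL P := by
  induction h with
  | single h => intro e he; rw [mem_singleton.1 he]; simpa using h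
  | @cons x y z P h h' ih =>
    intro e he
    rcases mem_insert.1 he with rfl | he
    · have : x ≠ y := by rintro rfl; exact h' h.left_mem
      simpa using this
    · exact ih e he

lemma append (hP : Pth x y P) (hQ : Pth y z Q) (h : ∀ v ∈ vs P, v ∈ vs Q → v = y) :
    Pth x z (P ∪ Q) := by
  induction hP with
  | single hne =>
    rw [← insert_eq]
    refine cons hQ fun hx => hne ?_
    exact h _ (vs_single.2 (Or.inl rfl)) hx
  | @cons x w y P hP hx ih =>
    rw [insert_union]
    refine cons (ih hQ fun v hv hv' => h v (vs_insert.2 (Or.inr (Or.inr hv))) hv') ?_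
    rw [vs_union]
    rintro (hx' | hx')
    · exact hx hx'
    · have := h x (vs_insert.2 (Or.inl rfl)) hx'
      subst this; exact hx hP.right_mem

lemma symm (hP : Pth x y P) : Pth y x P := by
  induction hP with
  | single h => rw [Sym2.eq_swap]; exact single h.symm
  | @cons x w y P hP hx ih =>
    have hne : w ≠ x := by rintro rfl; exact hx hP.left_mem
    have := ih.append (single hne) (by
      intro v hv hv'
      rcases vs_single.1 hv' with h | h
      · exact h
      · subst h; exact absurd hv hx)
    rwa [Sym2.eq_swap, union_comm, ← insert_eq] at this

lemma split (hP : Pth x y P) (ha : a ∈ vs P) (hax : a ≠ x) (hay : a ≠ y) :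
    ∃ P1 P2, Pth x a P1 ∧ Pth a y P2 ∧ P = P1 ∪ P2 ∧ Disjoint P1 P2 ∧
      ∀ v ∈ vs P1, v ∈ vs P2 → v = a := by
  induction hP with
  | single h => rcases vs_single.1 ha with h | h <;> contradiction
  | @cons x w y P hP hx ih =>
    have hne : x ≠ w := by rintro rfl; exact hx hP.left_mem
    by_cases haw : a = w
    · subst haw
      refine ⟨{s(x,a)}, P, single hne, hP, insert_eq _ _, ?_, ?_⟩
      · rw [disjoint_singleton_left]; exact fun h => hx ⟨_, h, by simp⟩
      · intro v hv hv'
        rcases vs_single.1 hv with rfl | rfl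
        · exact absurd hv' hx
        · rfl
    · have haP : a ∈ vs P := by
        rcases vs_insert.1 ha with h | h | h
        · exact absurd h hax
        · exact absurd h haw
        · exact h
      obtain ⟨P1, P2, h1, h2, rfl, h4, h5⟩ := ih haP haw hay
      rw [vs_union] at hx
      refine ⟨insert s(x,w) P1, P2, cons h1 fun h => hx (Or.inl h), h2, by rw [insert_union], ?_, ?_⟩
      · rw [disjoint_insert_left]
        exact ⟨fun h => hx (Or.inr ⟨_, h, by simp⟩), h4⟩
      · intro v hv hv'
        rcases vs_insert.1 hv with rfl | rfl | h
        · exact absurd (Or.inr hv') hx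
        · exact h5 _ h1.left_mem hv'
        · exact h5 v h hv'

/-- the subpath between two vertices avoids the ends -/
lemma sub (hP : Pth x y P) {u w : V} (hu : u ∈ vs P) (hw : w ∈ vs P) (huw : u ≠ w) :
    ∃ Q, Q ⊆ P ∧ Pth u w Q ∧ ∀ v ∈ vs Q, v = x ∨ v = y → v = u ∨ v = w := by
  -- first from `x`
  have step : ∀ {x y : V} {P : Finset (Sym2 V)}, Pth x y P → ∀ w ∈ vs P, w ≠ x →
      ∃ Q, Q ⊆ P ∧ Pth x w Q ∧ ∀ v ∈ vs Q, v = y → v = w := by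
    intro x y P hP w hw hwx
    by_cases hwy : w = y
    · subst hwy; exact ⟨P, subset_refl _, hP, fun v _ h => h⟩
    · obtain ⟨P1, P2, h1, h2, rfl, -, h5⟩ := hP.split hw hwx hwy
      refine ⟨P1, subset_union_left, h1, ?_⟩
      rintro v hv rfl
      exact h5 _ hv h2.right_mem
  by_cases hux : u = x
  · subst hux
    obtain ⟨Q, h1, h2, h3⟩ := step hP w hw huw.symm
    exact ⟨Q, h1, h2, fun v hv h => h.imp id (h3 v hv)⟩
  by_cases huy : u = y
  · subst huy
    obtain ⟨Q, h1, h2, h3⟩ := step hP.symm w hw huw.symm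
    exact ⟨Q, h1, h2, fun v hv h => h.symm.imp id (h3 v hv)⟩
  obtain ⟨P1, P2, h1, h2, rfl, -, h5⟩ := hP.split hu hux huy
  rw [vs_union] at hw
  rcases hw with hw | hw
  · obtain ⟨Q, k1, k2, k3⟩ := step h1.symm w hw huw.symm
    refine ⟨Q, k1.trans subset_union_left, k2, fun v hv h => ?_⟩
    rcases h with h | h
    · exact Or.inr (k3 v hv h)
    · subst h
      exact absurd (h5 v (vs_mono k1 hv) h2.right_mem) (Ne.symm huy)
  · obtain ⟨Q, k1, k2, k3⟩ := step h2 w hw huw.symm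
    refine ⟨Q, k1.trans subset_union_right, k2, fun v hv h => ?_⟩
    rcases h with h | h
    · subst h
      exact absurd (h5 v h1.left_mem (vs_mono k1 hv)) (Ne.symm hux)
    · exact Or.inr (k3 v hv h)

lemma rch (hP : Pth x y P) : Rch P (vs P) x y := by
  induction hP with
  | single h => exact .single ⟨by simp, vs_single.2 (Or.inl rfl), vs_single.2 (Or.inr rfl)⟩
  | @cons x w y P hP hx ih =>
    refine .head ⟨by simp, vs_insert.2 (Or.inl rfl), vs_insert.2 (Or.inr (Or.inl rfl))⟩ ?_
    exact ih.mono (subset_insert _ _) fun v hv => vs_insert.2 (Or.inr (Or.inr hv))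

lemma rch_int (hP : Pth x y P) {u w : V} (hu : u ∈ vs P) (hw : w ∈ vs P)
    (S : Set V) (hS : ∀ v ∈ vs P, v ≠ x → v ≠ y → v ∈ S) (huS : u ∈ S) (hwS : w ∈ S) :
    Rch P S u w := by
  by_cases huw : u = w
  · subst huw; exact .refl
  obtain ⟨Q, h1, h2, h3⟩ := hP.sub hu hw huw
  refine h2.rch.mono h1 fun v hv => ?_
  by_cases h : v = x ∨ v = y
  · rcases h3 v hv h with rfl | rfl <;> assumption
  · push Not at h
    exact hS v (vs_mono h1 hv) h.1 h.2

lemma first (hP : Pth x y P) (hi : ∃ v ∈ vs P, v ≠ x ∧ v ≠ y) :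
    ∃ w ∈ vs P, w ≠ x ∧ w ≠ y ∧ s(x,w) ∈ P := by
  cases hP with
  | single h =>
    obtain ⟨v, hv, h1, h2⟩ := hi
    rcases vs_single.1 hv with h | h <;> contradiction
  | @cons _ w _ P h h' =>
    exact ⟨w, vs_insert.2 (Or.inr (Or.inl rfl)), by rintro rfl; exact h' h.left_mem, h.ne, by simp⟩

lemma exists_of_rch {S : Set V} (h : Rch E S x y) (hxy : x ≠ y) :
    ∃ P, P ⊆ E ∧ Pth x y P ∧ vs P ⊆ S := by
  induction h using Relation.ReflTransGen.head_induction_on with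
  | refl => exact absurd rfl hxy
  | @head x w hxw _ ih =>
    by_cases hwx : w = x
    · subst hwx; exact ih hxy
    by_cases hwy : w = y
    · subst hwy
      refine ⟨{s(x,w)}, by simpa using hxw.1, single hxy, ?_⟩
      intro v hv
      rcases vs_single.1 hv with rfl | rfl
      · exact hxw.2.1
      · exact hxw.2.2
    · obtain ⟨P, h1, h2, h3⟩ := ih hwy
      by_cases hx : x ∈ vs P
      · obtain ⟨P1, P2, k1, k2, rfl, -, -⟩ := h2.split hx (Ne.symm hwx) hxy
        exact ⟨P2, subset_union_right.trans h1, k2, (vs_mono subset_union_right).trans h3⟩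
      · refine ⟨insert s(x,w) P, insert_subset hxw.1 h1, cons h2 hx, ?_⟩
        intro v hv
        rcases vs_insert.1 hv with rfl | rfl | h
        · exact hxw.2.1
        · exact hxw.2.2
        · exact h3 h

end Pth

lemma dg_not_mem {E : Finset (Sym2 V)} {h : Vec V} {v : V} (hv : v ∉ vs E) : dg E h v = 0 := by
  apply sum_eq_zero
  intro e he
  rw [if_neg fun h => hv ⟨e, he, h⟩]

lemma dg_insert {E : Finset (Sym2 V)} {h : Vec V} {v : V} {e : Sym2 V} (he : e ∉ E) :
    dg (insert e E) h v = (if v ∈ e then h e else 0) + dg E h v := by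
  unfold dg; rw [sum_insert he]

lemma ind_insert {P : Finset (Sym2 V)} {e : Sym2 V} (he : e ∉ P) :
    ind (insert e P) = ind {e} + ind P := by
  ext e'
  simp only [ind, mem_insert, mem_singleton, Pi.add_apply]
  by_cases h : e' = e
  · subst h; simp [he]
  · simp [h]

lemma dg_congr {E : Finset (Sym2 V)} {h k : Vec V} {v : V} (hk : ∀ e ∈ E, v ∈ e → h e = k e) :
    dg E h v = dg E k v := by
  refine sum_congr rfl fun e he => ?_
  split_ifs with hv
  · exact hk e he hv
  · rfl

namespace Pth
variable {x y z a : V} {P Q E : Finset (Sym2 V)}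

lemma dg_ind (hP : Pth x y P) (v : V) : dg P (ind P) v = dl x v + dl y v := by
  induction hP with
  | single h => exact dg_single h (by simp) v
  | @cons x w y P hP hx ih =>
    have hne : x ≠ w := by rintro rfl; exact hx hP.left_mem
    have hn : s(x,w) ∉ P := fun h => hx ⟨_, h, by simp⟩
    rw [ind_insert hn, dg_add, dg_single hne (by simp),
      dg_mono (subset_insert _ _) (ind_spt (subset_refl P)), ih]
    linear_combination z2self (dl w v)

lemma const (hP : Pth x y P) {h : Vec V} (hh : ∀ v, v ≠ x → v ≠ y → dg P h v = 0) :
    ∃ c : ZMod 2, ∀ e ∈ P, h e = c := by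
  induction hP with
  | @single x y _ => exact ⟨h s(x,y), by simp⟩
  | @cons x w y P hP hx ih =>
    have hn : s(x,w) ∉ P := fun h => hx ⟨_, h, by simp⟩
    have hne : x ≠ w := by rintro rfl; exact hx hP.left_mem
    obtain ⟨c, hc⟩ := ih (by
      intro v hvw hvy
      by_cases hvx : v = x
      · subst hvx; exact dg_not_mem hx
      · have := hh v hvx hvy
        rw [dg_insert hn, if_neg (by simp [hvx, hvw]), zero_add] at this
        exact this)
    refine ⟨c, fun e he => ?_⟩
    rcases mem_insert.1 he with rfl | he
    · have h1 := hh w hne.symm hP.ne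
      rw [dg_insert hn, if_pos (by simp)] at h1
      have h2 : dg P h w = c * dg P (ind P) w := by
        rw [← dg_smul]
        refine dg_congr fun e he _ => ?_
        simp [ind, he, hc e he]
      rw [h2, hP.dg_ind] at h1
      simp only [dl, if_true, if_neg hP.ne, add_zero, mul_one] at h1
      linear_combination h1 - z2self c
    · exact hc e he

lemma Zc_zero (hP : Pth x y P) {h : Vec V} (hh : h ∈ Zc P) : h = 0 := by
  obtain ⟨c, hc⟩ := hP.const (fun v _ _ => hh.2 v)
  have h2 : dg P h x = c * dg P (ind P) x := by
    rw [← dg_smul]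
    refine dg_congr fun e he _ => ?_
    simp [ind, he, hc e he]
  rw [hh.2, hP.dg_ind] at h2
  simp only [dl, if_true, if_neg hP.ne, add_zero, mul_one] at h2
  ext e
  by_cases he : e ∈ P
  · rw [hc e he, ← h2]; rfl
  · rw [hh.1 e he]; rfl

end Pth

structure Spl (C : Finset (Sym2 V)) (x y : V) (P1 P2 : Finset (Sym2 V)) : Prop where
  p1 : Pth x y P1
  p2 : Pth x y P2
  un : C = P1 ∪ P2
  dj : Disjoint P1 P2
  vx : ∀ v ∈ vs P1, v ∈ vs P2 → v = x ∨ v = y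

def Circ (C : Finset (Sym2 V)) : Prop := ∃ x y P1 P2, Spl C x y P1 P2

namespace Spl
variable {x y z a : V} {C P1 P2 : Finset (Sym2 V)}

lemma swap (h : Spl C x y P1 P2) : Spl C x y P2 P1 :=
  ⟨h.p2, h.p1, by rw [h.un, union_comm], h.dj.symm, fun v a b => h.vx v b a⟩

lemma symm (h : Spl C x y P1 P2) : Spl C y x P1 P2 :=
  ⟨h.p1.symm, h.p2.symm, h.un, h.dj, fun v a b => (h.vx v a b).symm⟩

lemma sub1 (h : Spl C x y P1 P2) : P1 ⊆ C := by rw [h.un]; exact subset_union_left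
lemma sub2 (h : Spl C x y P1 P2) : P2 ⊆ C := by rw [h.un]; exact subset_union_right
lemma vsu (h : Spl C x y P1 P2) : vs C = vs P1 ∪ vs P2 := by rw [h.un, vs_union]

/-- shrink the second path -/
lemma shrink (h : Spl C x y P1 P2) (ha : a ∈ vs P2) (hax : a ≠ x) (hay : a ≠ y) :
    ∃ Q1 Q2, Pth x a Q1 ∧ Pth a y Q2 ∧ P2 = Q1 ∪ Q2 ∧ Spl C x a (P1 ∪ Q2) Q1 ∧
      Spl C a y (P1 ∪ Q1) Q2 := by
  obtain ⟨Q1, Q2, h1, h2, rfl, h4, h5⟩ := h.p2.split ha hax hay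
  have hvx := h.vx
  have hdj := h.dj
  rw [vs_union] at hvx
  rw [disjoint_union_right] at hdj
  have ha1 : a ∉ vs P1 := fun h' => by
    rcases hvx a h' (Or.inl h1.right_mem) with h | h <;> contradiction
  have hxQ2 : x ∉ vs Q2 := fun h' => hax (h5 x h1.left_mem h').symm
  have hyQ1 : y ∉ vs Q1 := fun h' => hay (h5 y h' h2.right_mem).symm
  refine ⟨Q1, Q2, h1, h2, rfl, ⟨?_, h1, ?_, ?_, ?_⟩, ⟨?_, h2, ?_, ?_, ?_⟩⟩
  · refine h.p1.append h2.symm fun v hv hv' => ?_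
    rcases hvx v hv (Or.inr hv') with rfl | rfl
    · exact absurd hv' hxQ2
    · rfl
  · rw [h.un, union_assoc, union_comm Q1]
  · rw [disjoint_union_left]; exact ⟨hdj.1, h4.symm⟩
  · rw [vs_union]
    rintro v (hv | hv) hv'
    · rcases hvx v hv (Or.inl hv') with rfl | rfl
      · exact Or.inl rfl
      · exact absurd hv' hyQ1
    · exact Or.inr (h5 v hv' hv)
  · rw [union_comm]
    refine h1.symm.append h.p1 fun v hv hv' => ?_
    rcases hvx v hv' (Or.inl hv) with rfl | rfl
    · rfl
    · exact absurd hv hyQ1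
  · rw [h.un, union_assoc]
  · rw [disjoint_union_left]; exact ⟨hdj.2, h4⟩
  · rw [vs_union]
    rintro v (hv | hv) hv'
    · rcases hvx v hv (Or.inr hv') with rfl | rfl
      · exact absurd hv' hxQ2
      · exact Or.inr rfl
    · exact Or.inl (h5 v hv hv')

lemma from_left (h : Spl C x y P1 P2) (ha : a ∈ vs C) (hax : a ≠ x) :
    ∃ Q1 Q2, Spl C x a Q1 Q2 := by
  by_cases hay : a = y
  · subst hay; exact ⟨_, _, h⟩
  rw [h.vsu] at ha
  rcases ha with ha | ha
  · obtain ⟨Q1, Q2, -, -, -, h', -⟩ := h.swap.shrink ha hax hay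
    exact ⟨_, _, h'⟩
  · obtain ⟨Q1, Q2, -, -, -, h', -⟩ := h.shrink ha hax hay
    exact ⟨_, _, h'⟩

end Spl

namespace Circ
variable {x y z a : V} {C P1 P2 : Finset (Sym2 V)}

lemma spl (h : Circ C) (hx : x ∈ vs C) (hy : y ∈ vs C) (hxy : x ≠ y) :
    ∃ P1 P2, Spl C x y P1 P2 := by
  obtain ⟨a, b, P1, P2, h⟩ := h
  by_cases hxa : x = a
  · subst hxa; exact h.from_left hy hxy.symm
  · obtain ⟨Q1, Q2, h'⟩ := h.from_left hx hxa
    exact h'.symm.from_left hy hxy.symm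

lemma nonempty (h : Circ C) : C.Nonempty := by
  obtain ⟨a, b, P1, P2, h⟩ := h
  exact h.p1.nonempty.mono h.sub1

lemma isLL (h : Circ C) : LL C := by
  obtain ⟨a, b, P1, P2, h⟩ := h
  rw [h.un]
  intro e he
  rcases mem_union.1 he with he | he
  · exact h.p1.isLL e he
  · exact h.p2.isLL e he

lemma other (h : Circ C) (x : V) : ∃ y ∈ vs C, y ≠ x := by
  obtain ⟨a, b, P1, P2, h⟩ := h
  by_cases ha : a = x
  · exact ⟨b, vs_mono h.sub1 h.p1.right_mem, fun hb => h.p1.ne (ha.trans hb.symm)⟩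
  · exact ⟨a, vs_mono h.sub1 h.p1.left_mem, ha⟩

/-- split along an edge at a vertex -/
lemma spl_edge (h : Circ C) {p q : V} (he : s(p,q) ∈ C) :
    ∃ P2, Spl C p q {s(p,q)} P2 := by
  have hpq : p ≠ q := by simpa using h.isLL _ he
  obtain ⟨P1, P2, h⟩ := h.spl (x := p) (y := q) ⟨_, he, by simp⟩ ⟨_, he, by simp⟩ hpq
  have key : ∀ {P}, Pth p q P → s(p,q) ∈ P → P = {s(p,q)} := by
    intro P hP hm
    cases hP with
    | single _ => rfl
    | @cons _ w _ P hP hx =>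
      rcases mem_insert.1 hm with h' | h'
      · rw [Sym2.eq_iff] at h'
        rcases h' with ⟨-, rfl⟩ | ⟨h1, h2⟩
        · exact absurd rfl hP.ne
        · exact absurd h2.symm hpq
      · exact absurd ⟨_, h', by simp⟩ hx
  rw [h.un] at he
  rcases mem_union.1 he with he | he
  · have := key h.p1 he; subst this; exact ⟨_, h⟩
  · have := key h.p2 he; subst this; exact ⟨_, h.swap⟩

lemma spl_vertex (h : Circ C) {p : V} (hp : p ∈ vs C) :
    ∃ q P2, s(p,q) ∈ C ∧ Spl C p q {s(p,q)} P2 := by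
  obtain ⟨e, he, hpe⟩ := hp
  obtain ⟨q, rfl⟩ := hpe
  obtain ⟨P2, h2⟩ := h.spl_edge he
  exact ⟨q, P2, he, h2⟩

lemma ind_mem (h : Circ C) : ind C ∈ Zc C := by
  obtain ⟨a, b, P1, P2, h⟩ := h
  refine ⟨ind_spt (subset_refl _), fun v => ?_⟩
  have : ind C = ind P1 + ind P2 := by
    ext e
    simp only [ind, h.un, mem_union, Pi.add_apply]
    by_cases h1 : e ∈ P1
    · simp [h1, disjoint_left.1 h.dj h1]
    · simp [h1]
  rw [this, dg_add, dg_mono h.sub1 (ind_spt (subset_refl _)),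
    dg_mono h.sub2 (ind_spt (subset_refl _)), h.p1.dg_ind, h.p2.dg_ind]
  exact z2self _

lemma Zc_cases (h : Circ C) {k : Vec V} (hk : k ∈ Zc C) : k = 0 ∨ k = ind C := by
  obtain ⟨a, b, P1, P2, h⟩ := h
  have aux : ∀ {P1 P2}, Spl C a b P1 P2 → ∃ c, ∀ e ∈ P1, k e = c := by
    intro P1 P2 h
    apply h.p1.const
    intro v hva hvb
    by_cases hv : v ∈ vs P1
    · rw [← hk.2 v]
      unfold dg
      apply sum_subset h.sub1
      intro e he he1
      rw [if_neg]
      intro hve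
      have he2 : e ∈ P2 := by
        rw [h.un] at he; exact (mem_union.1 he).resolve_left he1
      rcases h.vx v hv ⟨e, he2, hve⟩ with h' | h' <;> contradiction
    · exact dg_not_mem hv
  obtain ⟨c1, hc1⟩ := aux h
  obtain ⟨c2, hc2⟩ := aux h.swap
  have hc : c1 = c2 := by
    have hd := hk.2 a
    have : dg C k a = c1 * dg P1 (ind P1) a + c2 * dg P2 (ind P2) a := by
      rw [← dg_smul, ← dg_smul]
      unfold dg
      rw [h.un, sum_union h.dj]
      congr 1 <;> refine sum_congr rfl fun e he => ?_
      · simp [ind, he, hc1 e he]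
      · simp [ind, he, hc2 e he]
    rw [this, h.p1.dg_ind, h.p2.dg_ind] at hd
    simp only [dl, if_true, if_neg h.p1.ne, add_zero, mul_one] at hd
    linear_combination hd - z2self c2
  subst hc
  have hall : ∀ e ∈ C, k e = c1 := by
    intro e he
    rw [h.un] at he
    rcases mem_union.1 he with he | he
    · exact hc1 e he
    · exact hc2 e he
  rcases z2 c1 with h0 | h0
  · left; ext e
    by_cases he : e ∈ C
    · rw [hall e he, h0]; rfl
    · rw [hk.1 e he]; rfl
  · right; ext e
    by_cases he : e ∈ C
    · rw [hall e he, h0]; simp [ind, he]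
    · rw [hk.1 e he]; simp [ind, he]

/-- a circuit minus a vertex is connected -/
lemma rch_avoid (h : Circ C) {z r r' : V} (hr : r ∈ vs C) (hr' : r' ∈ vs C) (hz : r ≠ z)
    (hz' : r' ≠ z) : Rch C {v | v ≠ z} r r' := by
  by_cases hrr : r = r'
  · subst hrr; exact .refl
  obtain ⟨P1, P2, h⟩ := h.spl hr hr' hrr
  by_cases hz1 : z ∈ vs P1
  · refine h.p2.rch.mono h.sub2 ?_
    rintro v hv rfl
    rcases h.vx v hz1 hv with h | h
    · exact hz h.symm
    · exact hz' h.symm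
  · refine h.p1.rch.mono h.sub1 ?_
    rintro v hv rfl
    exact hz1 hv

end Circ
end
end PB

namespace PB
section
open Classical Finset

variable {V : Type}

def Br (E C : Finset (Sym2 V)) : Sym2 V → Sym2 V → Prop :=
  Relation.ReflTransGen (fun e e' => e ∈ E \ C ∧ e' ∈ E \ C ∧ ∃ v, v ∉ vs C ∧ v ∈ e ∧ v ∈ e')

def Inn (E C : Finset (Sym2 V)) (e : Sym2 V) : Set V :=
  {v | v ∉ vs C ∧ ∃ e', Br E C e e' ∧ v ∈ e'}

def att (E C : Finset (Sym2 V)) (e : Sym2 V) : Set V :=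
  {v | v ∈ vs C ∧ ∃ e', Br E C e e' ∧ v ∈ e'}

section
variable {E C : Finset (Sym2 V)} {e e' e'' : Sym2 V}

lemma Br.refl : Br E C e e := Relation.ReflTransGen.refl

lemma Br.trans (h : Br E C e e') (h' : Br E C e' e'') : Br E C e e'' :=
  Relation.ReflTransGen.trans h h'

lemma Br.symm (h : Br E C e e') : Br E C e' e := by
  induction h with
  | refl => exact .refl
  | tail _ hs ih =>
    obtain ⟨h1, h2, v, hv, h3, h4⟩ := hs
    exact .head ⟨h2, h1, v, hv, h4, h3⟩ ih

lemma Br.step (h1 : e ∈ E \ C) (h2 : e' ∈ E \ C) {v : V} (hv : v ∉ vs C) (h3 : v ∈ e) (h4 : v ∈ e') :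
    Br E C e e' := .single ⟨h1, h2, v, hv, h3, h4⟩

lemma Br.mem (h : Br E C e e') (he : e ∈ E \ C) : e' ∈ E \ C := by
  cases h with
  | refl => exact he
  | tail _ hs => exact hs.2.1

lemma Br.mono {E' : Finset (Sym2 V)} (hE : E ⊆ E') (h : Br E C e e') : Br E' C e e' := by
  refine Relation.ReflTransGen.mono ?_ _ _ h
  rintro a b ⟨h1, h2, h3⟩
  rw [mem_sdiff] at h1 h2
  exact ⟨mem_sdiff.2 ⟨hE h1.1, h1.2⟩, mem_sdiff.2 ⟨hE h2.1, h2.2⟩, h3⟩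

/-- if all ends of `e` lie on `C`, its class is trivial -/
lemma Br.eq_of_ends (h : Br E C e e') (hv : ∀ v ∈ e', v ∈ vs C) : e = e' := by
  cases h with
  | refl => rfl
  | tail _ hs =>
    obtain ⟨-, -, v, h1, -, h2⟩ := hs
    exact absurd (hv v h2) h1

lemma Inn_congr (h : Br E C e e') : Inn E C e = Inn E C e' := by
  ext v
  constructor
  · rintro ⟨h1, f, h2, h3⟩; exact ⟨h1, f, h.symm.trans h2, h3⟩
  · rintro ⟨h1, f, h2, h3⟩; exact ⟨h1, f, h.trans h2, h3⟩

lemma att_congr (h : Br E C e e') : att E C e = att E C e' := by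
  ext v
  constructor
  · rintro ⟨h1, f, h2, h3⟩; exact ⟨h1, f, h.symm.trans h2, h3⟩
  · rintro ⟨h1, f, h2, h3⟩; exact ⟨h1, f, h.trans h2, h3⟩

lemma att_adj (he : e ∈ E \ C) {a : V} (ha : a ∈ att E C e) :
    (a ∈ e ∧ (∀ v ∈ e, v ∈ vs C) ∧ ∀ f, Br E C e f → e = f) ∨
      ∃ w ∈ Inn E C e, s(a,w) ∈ E \ C := by
  obtain ⟨haC, f, hf, haf⟩ := ha
  obtain ⟨w, rfl⟩ := haf
  by_cases hw : w ∈ vs C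
  · left
    have hall : ∀ v ∈ s(a,w), v ∈ vs C := by
      intro v hv
      rcases Sym2.mem_iff.1 hv with rfl | rfl <;> assumption
    have := hf.eq_of_ends hall
    subst this
    exact ⟨by simp, hall, fun f hf => (hf.symm.eq_of_ends hall).symm⟩
  · right
    exact ⟨w, ⟨hw, _, hf, by simp⟩, hf.mem he⟩

lemma Inn_conn (he : e ∈ E \ C) {u v : V} (hu : u ∈ Inn E C e) (hv : v ∈ Inn E C e) :
    Rch (E \ C) (Inn E C e) u v := by
  obtain ⟨hu1, f, hf, huf⟩ := hu
  have hcg := Inn_congr hf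
  rw [hcg] at hv ⊢
  have hfE := hf.mem he
  clear hf hcg he
  obtain ⟨hv1, g, hg, hvg⟩ := hv
  induction hg generalizing v with
  | refl =>
    obtain ⟨w, rfl⟩ := huf
    rcases Sym2.mem_iff.1 hvg with rfl | rfl
    · exact .refl
    · exact .single ⟨hfE, ⟨hu1, _, Br.refl, by simp⟩, ⟨hv1, _, Br.refl, by simp⟩⟩
  | @tail g g' hfg hs ih =>
    obtain ⟨h1, h2, w, hw, h3, h4⟩ := hs
    have hr := ih hw h3
    obtain ⟨w', rfl⟩ := h4
    rcases Sym2.mem_iff.1 hvg with rfl | rfl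
    · exact hr
    · refine .tail hr ⟨h2, ⟨hw, g, hfg, h3⟩, ⟨hv1, s(w,v), ?_, by simp⟩⟩
      exact Br.trans hfg (.step h1 h2 hw h3 (by simp))

lemma Inn_conn' (he : e ∈ E \ C) {a : V} (ha : a ∈ att E C e) {u v : V}
    (hu : u ∈ insert a (Inn E C e)) (hv : v ∈ insert a (Inn E C e)) :
    Rch E (insert a (Inn E C e)) u v := by
  have key : ∀ u ∈ Inn E C e, Rch E (insert a (Inn E C e)) u a := by
    intro u hu
    rcases att_adj he ha with ⟨-, h1, h2⟩ | ⟨w, hw, haw⟩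
    · obtain ⟨hu, f, hf, huf⟩ := hu
      have := h2 f hf
      subst this
      exact absurd (h1 u huf) hu
    · refine .tail ((Inn_conn he hu hw).mono sdiff_subset (Set.subset_insert _ _)) ⟨?_, Or.inr hw, Or.inl rfl⟩
      rw [Sym2.eq_swap]; exact (mem_sdiff.1 haw).1
  rcases hu with rfl | hu <;> rcases hv with rfl | hv
  · exact .refl
  · exact (key v hv).symm
  · exact key u hu
  · exact (Inn_conn he hu hv).mono sdiff_subset (Set.subset_insert _ _)

lemma att_link (he : e ∈ E \ C) {a c : V} (ha : a ∈ att E C e) (hc : c ∈ att E C e) (hac : a ≠ c) :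
    ∃ u ∈ insert a (Inn E C e), s(u,c) ∈ E := by
  rcases att_adj he hc with ⟨h0, -, h2⟩ | ⟨w, hw, haw⟩
  · obtain ⟨-, f, hf, haf⟩ := ha
    have := h2 f hf
    subst this
    refine ⟨a, Or.inl rfl, ?_⟩
    rw [← (Sym2.mem_and_mem_iff hac).1 ⟨haf, h0⟩]
    exact (mem_sdiff.1 he).1
  · refine ⟨w, Or.inr hw, ?_⟩
    rw [Sym2.eq_swap]; exact (mem_sdiff.1 haw).1

lemma Inn_disj (he : e ∈ E \ C) (he' : e' ∈ E \ C) (h : ¬ Br E C e e') {v : V}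
    (hv : v ∈ Inn E C e) (hv' : v ∈ Inn E C e') : False := by
  obtain ⟨h1, f, hf, h2⟩ := hv
  obtain ⟨-, f', hf', h3⟩ := hv'
  exact h (hf.trans ((Br.step (hf.mem he) (hf'.mem he') h1 h2 h3).trans hf'.symm))

end

/-- the cyclic trichotomy -/
lemma cyc3 {C : Finset (Sym2 V)} (hC : Circ C) (M N : Set V) (hM : M ⊆ vs C) (hN : N ⊆ vs C) :
    (∃ x y P1 P2, Spl C x y P1 P2 ∧ N ⊆ vs P1 ∧ M ⊆ vs P2) ∨
    (∃ a c P1 P2 b d, Spl C a c P1 P2 ∧ a ∈ N ∧ c ∈ N ∧ b ∈ M ∧ d ∈ M ∧ b ∈ vs P1 ∧ d ∈ vs P2 ∧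
      b ≠ a ∧ b ≠ c ∧ d ≠ a ∧ d ≠ c) ∨
    (∃ a c P1 P2 b d, Spl C a c P1 P2 ∧ a ∈ M ∧ c ∈ M ∧ b ∈ N ∧ d ∈ N ∧ b ∈ vs P1 ∧ d ∈ vs P2 ∧
      b ≠ a ∧ b ≠ c ∧ d ≠ a ∧ d ≠ c) ∨
    (∃ a b c, a ≠ b ∧ a ≠ c ∧ b ≠ c ∧ a ∈ M ∧ b ∈ M ∧ c ∈ M ∧ a ∈ N ∧ b ∈ N ∧ c ∈ N) := by
  -- everything is on the long side of an edge
  have big : ∀ {p q : V} {P2}, Spl C p q {s(p,q)} P2 → vs C ⊆ vs P2 := by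
    intro p q P2 h v hv
    rw [h.vsu] at hv
    rcases hv with hv | hv
    · rcases vs_single.1 hv with rfl | rfl
      · exact h.p2.left_mem
      · exact h.p2.right_mem
    · exact hv
  have small : ∀ N : Set V, N ⊆ vs C → (∀ x ∈ N, ∀ y ∈ N, x = y) →
      ∃ x y P1 P2, Spl C x y P1 P2 ∧ N ⊆ vs P1 ∧ vs C ⊆ vs P2 := by
    intro N hN h1
    have : ∃ p ∈ vs C, ∀ x ∈ N, x = p := by
      rcases N.eq_empty_or_nonempty with rfl | ⟨p, hp⟩
      · obtain ⟨a, b, P1, P2, h⟩ := hC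
        exact ⟨a, vs_mono h.sub1 h.p1.left_mem, by simp⟩
      · exact ⟨p, hN hp, fun x hx => h1 x hx p hp⟩
    obtain ⟨p, hp, h2⟩ := this
    obtain ⟨q, P2, h3, h4⟩ := hC.spl_vertex hp
    exact ⟨p, q, _, P2, h4, fun v hv => (h2 v hv) ▸ h4.p1.left_mem, big h4⟩
  by_cases hN1 : ∀ x ∈ N, ∀ y ∈ N, x = y
  · obtain ⟨x, y, P1, P2, h1, h2, h3⟩ := small N hN hN1
    exact Or.inl ⟨x, y, P1, P2, h1, h2, hM.trans h3⟩
  by_cases hM1 : ∀ x ∈ M, ∀ y ∈ M, x = y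
  · obtain ⟨x, y, P1, P2, h1, h2, h3⟩ := small M hM hM1
    exact Or.inl ⟨x, y, P2, P1, h1.swap, hN.trans h3, h2⟩
  push Not at hN1 hM1
  -- main step
  have main : ∀ M N : Set V, M ⊆ vs C → N ⊆ vs C → (∃ x ∈ N, ∃ y ∈ N, x ≠ y) → (∃ b ∈ M, b ∉ N) →
      (∃ x y P1 P2, Spl C x y P1 P2 ∧ N ⊆ vs P1 ∧ M ⊆ vs P2) ∨
      (∃ a c P1 P2 b d, Spl C a c P1 P2 ∧ a ∈ N ∧ c ∈ N ∧ b ∈ M ∧ d ∈ M ∧ b ∈ vs P1 ∧ d ∈ vs P2 ∧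
        b ≠ a ∧ b ≠ c ∧ d ≠ a ∧ d ≠ c) := by
    intro M N hM hN hN2 ⟨b, hbM, hbN⟩
    have hex : ∃ n, ∃ x y P1 P2, Spl C x y P1 P2 ∧ x ∈ N ∧ y ∈ N ∧ b ∈ vs P2 ∧ #P2 = n := by
      obtain ⟨x, hx, y, hy, hxy⟩ := hN2
      obtain ⟨P1, P2, h⟩ := hC.spl (hN hx) (hN hy) hxy
      have hb := hM hbM
      rw [h.vsu] at hb
      rcases hb with hb | hb
      · exact ⟨_, x, y, P2, P1, h.swap, hx, hy, hb, rfl⟩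
      · exact ⟨_, x, y, P1, P2, h, hx, hy, hb, rfl⟩
    obtain ⟨x, y, P1, P2, h, hx, hy, hb, hn⟩ := Nat.find_spec hex
    have hmin := fun m (hm : m < Nat.find hex) => Nat.find_min hex hm
    rw [← hn] at hmin
    have hNP : N ⊆ vs P1 := by
      intro v hv
      by_contra hv1
      have hv2 : v ∈ vs P2 := by
        have := hN hv
        rw [h.vsu] at this
        exact this.resolve_left hv1
      have hvx : v ≠ x := by rintro rfl; exact hv1 h.p1.left_mem
      have hvy : v ≠ y := by rintro rfl; exact hv1 h.p1.right_mem
      obtain ⟨Q1, Q2, k1, k2, rfl, k4, k5⟩ := h.shrink hv2 hvx hvy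
      have d12 : Disjoint Q1 Q2 := by
        have := k4.dj
        rw [disjoint_union_left] at this
        exact this.2.symm
      have hcard := card_union_of_disjoint d12
      have c1 := k1.nonempty.card_pos
      have c2 := k2.nonempty.card_pos
      rw [vs_union] at hb
      rcases hb with hb | hb
      · exact hmin #Q1 (by omega) ⟨x, v, _, _, k4, hx, hv, hb, rfl⟩
      · exact hmin #Q2 (by omega) ⟨v, y, _, _, k5, hv, hy, hb, rfl⟩
    by_cases hMP : M ⊆ vs P2
    · exact Or.inl ⟨x, y, P1, P2, h, hNP, hMP⟩
    · right
      rw [Set.not_subset] at hMP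
      obtain ⟨d, hdM, hd2⟩ := hMP
      have hd1 : d ∈ vs P1 := by
        have := hM hdM
        rw [h.vsu] at this
        exact this.resolve_right hd2
      refine ⟨x, y, P1, P2, d, b, h, hx, hy, hdM, hbM, hd1, hb, ?_, ?_, ?_, ?_⟩
      · rintro rfl; exact hd2 h.p2.left_mem
      · rintro rfl; exact hd2 h.p2.right_mem
      · rintro rfl; exact hbN hx
      · rintro rfl; exact hbN hy
  by_cases hMN : ∃ b ∈ M, b ∉ N
  · rcases main M N hM hN hN1 hMN with h | h
    · exact Or.inl h
    · exact Or.inr (Or.inl h)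
  by_cases hNM : ∃ b ∈ N, b ∉ M
  · rcases main N M hN hM hM1 hNM with ⟨x, y, P1, P2, h1, h2, h3⟩ | h
    · exact Or.inl ⟨x, y, P2, P1, h1.swap, h3, h2⟩
    · exact Or.inr (Or.inr (Or.inl h))
  push Not at hMN hNM
  obtain ⟨x, hx, y, hy, hxy⟩ := hN1
  by_cases h3 : ∃ z ∈ N, z ≠ x ∧ z ≠ y
  · obtain ⟨z, hz, hzx, hzy⟩ := h3
    exact Or.inr (Or.inr (Or.inr ⟨x, y, z, hxy, hzx.symm, hzy.symm, hNM x hx, hNM y hy, hNM z hz,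
      hx, hy, hz⟩))
  · push Not at h3
    obtain ⟨P1, P2, h⟩ := hC.spl (hN hx) (hN hy) hxy
    have key : ∀ v ∈ N, v = x ∨ v = y := fun v hv => by
      by_cases hvx : v = x
      · exact Or.inl hvx
      · exact Or.inr (h3 v hv hvx)
    left
    refine ⟨x, y, P1, P2, h, ?_, ?_⟩
    · intro v hv
      rcases key v hv with rfl | rfl
      · exact h.p1.left_mem
      · exact h.p1.right_mem
    · intro v hv
      rcases key v (hMN v hv) with rfl | rfl
      · exact h.p2.left_mem
      · exact h.p2.right_mem

def NO (E C : Finset (Sym2 V)) : Prop :=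
  ∀ e ∈ E \ C, ∀ e' ∈ E \ C, ¬ Br E C e e' →
    ∃ x y P1 P2, Spl C x y P1 P2 ∧ att E C e ⊆ vs P1 ∧ att E C e' ⊆ vs P2

end
end PB

namespace PB
section
open Classical Finset

variable {V : Type}

lemma Rch_some {E : Finset (Sym2 V)} {S : Finset V} {T : Set V} {a b : V} (h : Rch E T a b) :
    Rch (plusE E S) (some '' T) (some a) (some b) := by
  induction h with
  | refl => exact .refl
  | @tail b c _ hs ih =>
    refine .tail ih ⟨?_, ⟨b, hs.2.1, rfl⟩, ⟨c, hs.2.2, rfl⟩⟩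
    exact mem_union_left _ (mem_image.2 ⟨_, hs.1, rfl⟩)

/-- crossing bridges give a `K5` -/
lemma no_cross {E C : Finset (Sym2 V)} (hE : LL E) (hCE : C ⊆ E) (S : Finset V)
    (hS : ∀ v ∈ vs C, v ∈ S) (hP : Pl (plusE E S)) {e e' : Sym2 V} (he : e ∈ E \ C)
    (he' : e' ∈ E \ C) (hee : ¬ Br E C e e') {a c b d : V} {P1 P2 : Finset (Sym2 V)}
    (h : Spl C a c P1 P2) (ha : a ∈ att E C e) (hc : c ∈ att E C e) (hb : b ∈ att E C e')
    (hd : d ∈ att E C e') (hb1 : b ∈ vs P1) (hd2 : d ∈ vs P2) (hba : b ≠ a) (hbc : b ≠ c)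
    (hda : d ≠ a) (hdc : d ≠ c) : False := by
  let I1 : Set V := {v | v ∈ vs P1 ∧ v ≠ a ∧ v ≠ c}
  let I2 : Set V := {v | v ∈ vs P2 ∧ v ≠ a ∧ v ≠ c}
  let A : Fin 4 → Set V := ![insert a (Inn E C e), {c}, I1 ∪ insert b (Inn E C e'), I2]
  have hP1C := vs_mono h.sub1
  have hP2C := vs_mono h.sub2
  have haC := hP1C h.p1.left_mem
  have hcC := hP1C h.p1.right_mem
  have hbd : b ≠ d := by
    rintro rfl
    rcases h.vx b hb1 hd2 with h | h <;> contradiction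
  have hInC : ∀ v, v ∈ vs C → v ∉ Inn E C e := fun v hv hv' => hv'.1 hv
  have hInC' : ∀ v, v ∈ vs C → v ∉ Inn E C e' := fun v hv hv' => hv'.1 hv
  have edisj : ∀ i j, i < j → ∀ x, x ∈ A i → x ∉ A j := by
    have d01 : ∀ x, x ∈ A 0 → x ∉ A 1 := by
      rintro x (rfl | hx) h1
      · exact h.p1.ne h1
      · exact hInC c hcC (h1 ▸ hx)
    have d02 : ∀ x, x ∈ A 0 → x ∉ A 2 := by
      rintro x (rfl | hx) (h1 | rfl | h1)
      · exact h1.2.1 rfl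
      · exact hba rfl
      · exact hInC' x haC h1
      · exact hInC x (hP1C h1.1) hx
      · exact hInC x (hP1C hb1) hx
      · exact Inn_disj he he' hee hx h1
    have d03 : ∀ x, x ∈ A 0 → x ∉ A 3 := by
      rintro x (rfl | hx) h1
      · exact h1.2.1 rfl
      · exact hInC x (hP2C h1.1) hx
    have d12 : ∀ x, x ∈ A 1 → x ∉ A 2 := by
      rintro x (rfl : x = c) (h1 | rfl | h1)
      · exact h1.2.2 rfl
      · exact hbc rfl
      · exact hInC' x hcC h1
    have d13 : ∀ x, x ∈ A 1 → x ∉ A 3 := by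
      rintro x (rfl : x = c) h1
      exact h1.2.2 rfl
    have d23 : ∀ x, x ∈ A 2 → x ∉ A 3 := by
      rintro x (h1 | rfl | h1) h2
      · rcases h.vx x h1.1 h2.1 with h | h
        · exact h1.2.1 h
        · exact h1.2.2 h
      · rcases h.vx x hb1 h2.1 with h | h <;> contradiction
      · exact hInC' x (hP2C h2.1) h1
    intro i j hij
    fin_cases i <;> fin_cases j <;> first | exact absurd hij (by decide) | assumption
  have econn : ∀ i, ∀ x ∈ A i, ∀ y ∈ A i, Rch E (A i) x y := by
    intro i
    fin_cases i
    · intro x hx y hy; exact Inn_conn' he ha hx hy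
    · rintro x (rfl : x = c) y (rfl : y = x); exact .refl
    · have key : ∀ x ∈ A 2, Rch E (A 2) x b := by
        rintro x (h1 | h1)
        · exact (h.p1.rch_int h1.1 hb1 (A 2) (fun v hv h3 h4 => Or.inl ⟨hv, h3, h4⟩) (Or.inl h1)
            (Or.inl ⟨hb1, hba, hbc⟩)).mono (h.sub1.trans hCE) subset_rfl
        · exact (Inn_conn' he' hb h1 (Or.inl rfl)).mono subset_rfl Set.subset_union_right
      intro x hx y hy
      exact (key x hx).trans (key y hy).symm
    · intro x hx y hy
      exact (h.p2.rch_int hx.1 hy.1 I2 (fun v hv h3 h4 => ⟨hv, h3, h4⟩) hx hy).mono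
        (h.sub2.trans hCE) subset_rfl
  have eadj : ∀ i j, i < j → ∃ x ∈ A i, ∃ y ∈ A j, s(x,y) ∈ E := by
    have a01 : ∃ x ∈ A 0, ∃ y ∈ A 1, s(x,y) ∈ E := by
      obtain ⟨u, hu, hu'⟩ := att_link he ha hc h.p1.ne
      exact ⟨u, hu, c, rfl, hu'⟩
    have a02 : ∃ x ∈ A 0, ∃ y ∈ A 2, s(x,y) ∈ E := by
      obtain ⟨w, h1, h2, h3, h4⟩ := h.p1.first ⟨b, hb1, hba, hbc⟩
      exact ⟨a, Or.inl rfl, w, Or.inl ⟨h1, h2, h3⟩, hCE (h.sub1 h4)⟩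
    have a03 : ∃ x ∈ A 0, ∃ y ∈ A 3, s(x,y) ∈ E := by
      obtain ⟨w, h1, h2, h3, h4⟩ := h.p2.first ⟨d, hd2, hda, hdc⟩
      exact ⟨a, Or.inl rfl, w, ⟨h1, h2, h3⟩, hCE (h.sub2 h4)⟩
    have a12 : ∃ x ∈ A 1, ∃ y ∈ A 2, s(x,y) ∈ E := by
      obtain ⟨w, h1, h2, h3, h4⟩ := h.p1.symm.first ⟨b, hb1, hbc, hba⟩
      exact ⟨c, rfl, w, Or.inl ⟨h1, h3, h2⟩, hCE (h.sub1 h4)⟩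
    have a13 : ∃ x ∈ A 1, ∃ y ∈ A 3, s(x,y) ∈ E := by
      obtain ⟨w, h1, h2, h3, h4⟩ := h.p2.symm.first ⟨d, hd2, hdc, hda⟩
      exact ⟨c, rfl, w, ⟨h1, h3, h2⟩, hCE (h.sub2 h4)⟩
    have a23 : ∃ x ∈ A 2, ∃ y ∈ A 3, s(x,y) ∈ E := by
      obtain ⟨u, hu, hu'⟩ := att_link he' hb hd hbd
      exact ⟨u, Or.inr hu, d, ⟨hd2, hda, hdc⟩, hu'⟩
    intro i j hij
    fin_cases i <;> fin_cases j <;> first | exact absurd hij (by decide) | assumption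
  have eC : ∀ i, ∃ x ∈ A i, x ∈ vs C := by
    intro i
    fin_cases i
    · exact ⟨a, Or.inl rfl, haC⟩
    · exact ⟨c, rfl, hcC⟩
    · exact ⟨b, Or.inr (Or.inl rfl), hP1C hb1⟩
    · exact ⟨d, ⟨hd2, hda, hdc⟩, hP2C hd2⟩
  let T : Fin 5 → Set (Option V) := fun i => if hi : i.val < 4 then some '' A ⟨i.val, hi⟩ else {none}
  refine not_Pl_k5 (minor_sets (plusE_LL hE S) k5_LL hP T ?_ ?_ ?_)
  · have hlt : ∀ u w : Fin 5, u < w → ∀ x, x ∈ T u → x ∉ T w := by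
      intro u w huw x hx hx'
      have hu4 : u.val < 4 := by have := w.isLt; have : u.val < w.val := huw; omega
      simp only [T, dif_pos hu4] at hx
      obtain ⟨v, hv, rfl⟩ := hx
      by_cases hw4 : w.val < 4
      · simp only [T, dif_pos hw4] at hx'
        obtain ⟨v', hv', hvv⟩ := hx'
        rw [Option.some.injEq] at hvv
        subst hvv
        exact edisj ⟨u.val, hu4⟩ ⟨w.val, hw4⟩ huw _ hv hv'
      · simp [T, dif_neg hw4] at hx'
    intro u w huw x hx hx'
    rcases lt_or_gt_of_ne huw with h | h
    · exact hlt u w h x hx hx'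
    · exact hlt w u h x hx' hx
  · intro u x hx y hy
    by_cases hu4 : u.val < 4
    · simp only [T, dif_pos hu4] at hx hy ⊢
      obtain ⟨x, hx, rfl⟩ := hx
      obtain ⟨y, hy, rfl⟩ := hy
      exact Rch_some (econn _ x hx y hy)
    · simp only [T, dif_neg hu4] at hx hy ⊢
      rw [Set.mem_singleton_iff] at hx hy
      subst hx hy; exact .refl
  · have hlt : ∀ u w : Fin 5, u < w → ∃ x ∈ T u, ∃ y ∈ T w, s(x,y) ∈ plusE E S := by
      intro u w huw
      have hu4 : u.val < 4 := by have := w.isLt; have : u.val < w.val := huw; omega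
      by_cases hw4 : w.val < 4
      · obtain ⟨x, hx, y, hy, hxy⟩ := eadj ⟨u.val, hu4⟩ ⟨w.val, hw4⟩ huw
        refine ⟨some x, ?_, some y, ?_, mem_union_left _ (mem_image.2 ⟨_, hxy, rfl⟩)⟩
        · simp only [T, dif_pos hu4]; exact ⟨x, hx, rfl⟩
        · simp only [T, dif_pos hw4]; exact ⟨y, hy, rfl⟩
      · obtain ⟨x, hx, hxC⟩ := eC ⟨u.val, hu4⟩
        refine ⟨some x, ?_, none, ?_, ?_⟩
        · simp only [T, dif_pos hu4]; exact ⟨x, hx, rfl⟩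
        · simp [T, dif_neg hw4]
        · rw [Sym2.eq_swap]; exact mem_union_right _ (mem_image.2 ⟨x, hS x hxC, rfl⟩)
    intro u w huw
    have hne : u ≠ w := by simpa using k5_LL _ huw
    rcases lt_or_gt_of_ne hne with h | h
    · exact hlt u w h
    · obtain ⟨x, hx, y, hy, hxy⟩ := hlt w u h
      exact ⟨y, hy, x, hx, by rwa [Sym2.eq_swap]⟩

/-- three common attachments give a `K33` -/
lemma no_three {E C : Finset (Sym2 V)} (hE : LL E) (S : Finset V)
    (hS : ∀ v ∈ vs C, v ∈ S) (hP : Pl (plusE E S)) {e e' : Sym2 V} (he : e ∈ E \ C)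
    (he' : e' ∈ E \ C) (hee : ¬ Br E C e e') (a : Fin 3 → V) (hai : Function.Injective a)
    (ha : ∀ i, a i ∈ att E C e) (ha' : ∀ i, a i ∈ att E C e') : False := by
  have adj : ∀ e ∈ E \ C, (∀ i, a i ∈ att E C e) → ∀ i, ∃ w ∈ Inn E C e, s(w, a i) ∈ E := by
    intro e he ha i
    rcases att_adj he (ha i) with ⟨-, -, h2⟩ | ⟨w, hw, haw⟩
    · exfalso
      have hin : ∀ j, a j ∈ e := fun j => by
        obtain ⟨-, f, hf, hj⟩ := ha j
        have := h2 f hf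
        subst this; exact hj
      have h01 := (Sym2.mem_and_mem_iff (hai.ne (show (0:Fin 3) ≠ 1 by decide))).1 ⟨hin 0, hin 1⟩
      have h2 := hin 2
      rw [h01, Sym2.mem_iff] at h2
      rcases h2 with h | h
      · exact absurd (hai h) (by decide)
      · exact absurd (hai h) (by decide)
    · exact ⟨w, hw, by rw [Sym2.eq_swap]; exact (mem_sdiff.1 haw).1⟩
  let A : Fin 3 → Set (Option V) := ![some '' Inn E C e, some '' Inn E C e', {none}]
  let T : U33 → Set (Option V) := fun p => if p.1 then {some (a p.2)} else A p.2
  have hAa : ∀ i j, some (a j) ∉ A i := by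
    intro i j
    fin_cases i
    · rintro ⟨v, hv, hva⟩
      rw [Option.some.injEq] at hva
      subst hva
      exact hv.1 (ha j).1
    · rintro ⟨v, hv, hva⟩
      rw [Option.some.injEq] at hva
      subst hva
      exact hv.1 (ha j).1
    · intro h; cases h
  have hAlt : ∀ i j, i < j → ∀ x, x ∈ A i → x ∉ A j := by
    have d01 : ∀ x, x ∈ A 0 → x ∉ A 1 := by
      rintro x ⟨v, hv, rfl⟩ ⟨v', hv', h⟩
      rw [Option.some.injEq] at h
      subst h
      exact Inn_disj he he' hee hv hv'
    have d02 : ∀ x, x ∈ A 0 → x ∉ A 2 := by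
      rintro x ⟨v, hv, rfl⟩ h; cases h
    have d12 : ∀ x, x ∈ A 1 → x ∉ A 2 := by
      rintro x ⟨v, hv, rfl⟩ h; cases h
    intro i j hij
    fin_cases i <;> fin_cases j <;> first | exact absurd hij (by decide) | assumption
  refine not_Pl_k33 (minor_sets (plusE_LL hE S) k33_LL hP T ?_ ?_ ?_)
  · rintro ⟨b, i⟩ ⟨b', j⟩ hne x hx hx'
    cases b <;> cases b' <;> simp only [T, if_true, Bool.false_eq_true, if_false] at hx hx'
    · have hij : i ≠ j := by rintro rfl; exact hne rfl
      rcases lt_or_gt_of_ne hij with h | h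
      · exact hAlt i j h x hx hx'
      · exact hAlt j i h x hx' hx
    · rw [Set.mem_singleton_iff] at hx'; subst hx'; exact hAa _ _ hx
    · rw [Set.mem_singleton_iff] at hx; subst hx; exact hAa _ _ hx'
    · rw [Set.mem_singleton_iff] at hx hx'
      rw [hx, Option.some.injEq] at hx'
      exact hne (by rw [hai hx'])
  · rintro ⟨b, i⟩ x hx y hy
    cases b <;> simp only [T, if_true, Bool.false_eq_true, if_false] at hx hy ⊢
    · fin_cases i
      · obtain ⟨x, hx, rfl⟩ := hx
        obtain ⟨y, hy, rfl⟩ := hy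
        exact Rch_some ((Inn_conn he hx hy).mono sdiff_subset subset_rfl)
      · obtain ⟨x, hx, rfl⟩ := hx
        obtain ⟨y, hy, rfl⟩ := hy
        exact Rch_some ((Inn_conn he' hx hy).mono sdiff_subset subset_rfl)
      · cases hx; cases hy; exact .refl
    · rw [Set.mem_singleton_iff] at hx hy; subst hx hy; exact .refl
  · have key : ∀ i j, ∃ x ∈ A i, s(x, some (a j)) ∈ plusE E S := by
      intro i j
      fin_cases i
      · obtain ⟨w, hw, h⟩ := adj e he ha j
        exact ⟨some w, ⟨w, hw, rfl⟩, mem_union_left _ (mem_image.2 ⟨_, h, rfl⟩)⟩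
      · obtain ⟨w, hw, h⟩ := adj e' he' ha' j
        exact ⟨some w, ⟨w, hw, rfl⟩, mem_union_left _ (mem_image.2 ⟨_, h, rfl⟩)⟩
      · exact ⟨none, rfl, mem_union_right _ (mem_image.2 ⟨a j, hS _ (ha j).1, rfl⟩)⟩
    rintro ⟨b, i⟩ ⟨b', j⟩ huv
    obtain ⟨⟨i', j'⟩, -, h⟩ := mem_image.1 huv
    simp only [ke] at h
    rw [Sym2.eq_iff] at h
    simp only [Prod.mk.injEq] at h
    rcases h with ⟨⟨rfl, rfl⟩, rfl, rfl⟩ | ⟨⟨rfl, rfl⟩, rfl, rfl⟩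
    · obtain ⟨x, hx, h⟩ := key i' j'
      exact ⟨x, by simpa [T] using hx, some (a j'), by simp [T], h⟩
    · obtain ⟨x, hx, h⟩ := key i' j'
      exact ⟨some (a j'), by simp [T], x, by simpa [T] using hx, by rwa [Sym2.eq_swap]⟩

lemma NO_of_Pl {E C : Finset (Sym2 V)} (hE : LL E) (hCE : C ⊆ E) (hC : Circ C) (S : Finset V)
    (hS : ∀ v ∈ vs C, v ∈ S) (hP : Pl (plusE E S)) : NO E C := by
  intro e he e' he' hee
  rcases cyc3 hC (att E C e') (att E C e) (fun v h => h.1) (fun v h => h.1) with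
    h | ⟨a, c, P1, P2, b, d, h, ha, hc, hb, hd, h1, h2, h3, h4, h5, h6⟩ |
    ⟨a, c, P1, P2, b, d, h, ha, hc, hb, hd, h1, h2, h3, h4, h5, h6⟩ |
    ⟨a, b, c, h1, h2, h3, ha, hb, hc, ha', hb', hc'⟩
  · exact h
  · exact (no_cross hE hCE S hS hP he he' hee h ha hc hb hd h1 h2 h3 h4 h5 h6).elim
  · exact (no_cross hE hCE S hS hP he' he (fun h => hee h.symm) h ha hc hb hd h1 h2 h3 h4 h5 h6).elim
  · refine (no_three hE S hS hP he he' hee ![a,b,c] ?_ ?_ ?_).elim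
    · intro i j hij
      fin_cases i <;> fin_cases j <;> simp_all
    · intro i; fin_cases i <;> assumption
    · intro i; fin_cases i <;> assumption

end
end PB

namespace PB
section
open Classical Finset

variable {V : Type}

lemma NO_map {E E' C : Finset (Sym2 V)} (hC : Circ C) (hNO : NO E C)
    (hm : ∀ f ∈ E' \ C, ∀ f' ∈ E' \ C, ¬ Br E' C f f' →
      (∃ p q, s(p,q) ∈ C ∧ ∀ v ∈ att E' C f, v = p ∨ v = q) ∨
      (∃ p q, s(p,q) ∈ C ∧ ∀ v ∈ att E' C f', v = p ∨ v = q) ∨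
      ∃ e ∈ E \ C, ∃ e' ∈ E \ C, ¬ Br E C e e' ∧ att E' C f ⊆ att E C e ∧
        att E' C f' ⊆ att E C e') : NO E' C := by
  have triv : ∀ p q, s(p,q) ∈ C → ∃ P2, Spl C p q {s(p,q)} P2 ∧ vs C ⊆ vs P2 := by
    intro p q hpq
    obtain ⟨P2, h⟩ := hC.spl_edge hpq
    refine ⟨P2, h, fun v hv => ?_⟩
    rw [h.vsu] at hv
    rcases hv with hv | hv
    · rcases vs_single.1 hv with rfl | rfl
      · exact h.p2.left_mem
      · exact h.p2.right_mem
    · exact hv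
  intro f hf f' hf' hb
  rcases hm f hf f' hf' hb with ⟨p, q, hpq, h⟩ | ⟨p, q, hpq, h⟩ | ⟨e, he, e', he', h1, h2, h3⟩
  · obtain ⟨P2, k1, k2⟩ := triv p q hpq
    exact ⟨p, q, _, P2, k1, fun v hv => vs_single.2 (h v hv), fun v hv => k2 hv.1⟩
  · obtain ⟨P2, k1, k2⟩ := triv p q hpq
    exact ⟨p, q, P2, _, k1.swap, fun v hv => k2 hv.1, fun v hv => vs_single.2 (h v hv)⟩
  · obtain ⟨x, y, P1, P2, k1, k2, k3⟩ := hNO e he e' he' h1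
    exact ⟨x, y, P1, P2, k1, h2.trans k2, h3.trans k3⟩

lemma NO_add {E C : Finset (Sym2 V)} {g : Sym2 V} (hC : Circ C) (hNO : NO E C) {p q : V}
    (hpq : s(p,q) ∈ C) (h : ∀ v ∈ att (insert g E) C g, v = p ∨ v = q) : NO (insert g E) C := by
  refine NO_map hC hNO fun f hf f' hf' hb => ?_
  by_cases h1 : Br (insert g E) C f g
  · left; exact ⟨p, q, hpq, by rw [att_congr h1]; exact h⟩
  by_cases h2 : Br (insert g E) C f' g
  · right; left; exact ⟨p, q, hpq, by rw [att_congr h2]; exact h⟩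
  right; right
  have key : ∀ f ∈ insert g E \ C, ¬ Br (insert g E) C f g → f ∈ E \ C ∧
      ∀ h, Br (insert g E) C f h → Br E C f h := by
    intro f hf hn
    have hfE : f ∈ E \ C := by
      rw [mem_sdiff, mem_insert] at hf
      refine mem_sdiff.2 ⟨hf.1.resolve_left ?_, hf.2⟩
      rintro rfl; exact hn .refl
    refine ⟨hfE, fun h hb => ?_⟩
    induction hb with
    | refl => exact .refl
    | @tail b c hb hs ih =>
      obtain ⟨k1, k2, v, k3, k4, k5⟩ := hs
      refine ih.trans (.step (ih.mem hfE) ?_ k3 k4 k5)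
      rw [mem_sdiff, mem_insert] at k2
      refine mem_sdiff.2 ⟨k2.1.resolve_left ?_, k2.2⟩
      rintro rfl
      exact hn (hb.tail ⟨k1, mem_sdiff.2 ⟨mem_insert_self _ _, k2.2⟩, v, k3, k4, k5⟩)
  obtain ⟨a1, a2⟩ := key f hf h1
  obtain ⟨b1, b2⟩ := key f' hf' h2
  refine ⟨f, a1, f', b1, fun h => hb (h.mono (subset_insert _ _)), ?_, ?_⟩
  · rintro v ⟨hv, h, hh, hvh⟩; exact ⟨hv, h, a2 h hh, hvh⟩
  · rintro v ⟨hv, h, hh, hvh⟩; exact ⟨hv, h, b2 h hh, hvh⟩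

lemma Circ.br_all {B C D : Finset (Sym2 V)} (hD : Circ D) (hDB : D ⊆ B)
    (hdj : ∀ v ∈ vs D, v ∉ vs C) {g g' : Sym2 V} (hg : g ∈ D) (hg' : g' ∈ D) : Br B C g g' := by
  have hsub : ∀ e ∈ D, e ∈ B \ C := fun e he => mem_sdiff.2 ⟨hDB he, fun hC => by
    induction e with | _ a b =>
    exact hdj a ⟨_, he, by simp⟩ ⟨_, hC, by simp⟩⟩
  have key : ∀ r r', Rch D (vs D) r r' → ∀ g ∈ D, ∀ g' ∈ D, r ∈ g → r' ∈ g' → Br B C g g' := by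
    intro r r' h
    induction h with
    | refl =>
      intro g hg g' hg' h1 h2
      exact .step (hsub g hg) (hsub g' hg') (hdj r ⟨_, hg, h1⟩) h1 h2
    | @tail b c _ hs ih =>
      intro g hg g' hg' h1 h2
      exact (ih g hg _ hs.1 h1 (by simp)).trans
        (.step (v := c) (hsub _ hs.1) (hsub g' hg') (hdj _ hs.2.2) (by simp) h2)
  induction g with | _ r s =>
  induction g' with | _ r' s' =>
  by_cases hrr : r = r'
  · subst hrr; exact key r r .refl _ hg _ hg' (by simp) (by simp)
  obtain ⟨P1, P2, h⟩ := hD.spl (x := r) (y := r') ⟨_, hg, by simp⟩ ⟨_, hg', by simp⟩ hrr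
  exact key r r' (h.p1.rch.mono h.sub1 (vs_mono h.sub1)) _ hg _ hg' (by simp) (by simp)

lemma NO_union {B I C D : Finset (Sym2 V)} (hC : Circ C) (hD : Circ D) (hDB : D ⊆ B)
    (hdj : ∀ v ∈ vs D, v ∉ vs C) (hBI : ∀ v ∈ vs B, v ∈ vs I → v ∈ vs D)
    (hIC : ∀ v ∈ vs I, v ∉ vs C) (hNO : NO B C) : NO (B ∪ I) C := by
  have hsub : ∀ e ∈ D, e ∈ B \ C := fun e he => mem_sdiff.2 ⟨hDB he, fun hC => by
    induction e with | _ a b =>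
    exact hdj a ⟨_, he, by simp⟩ ⟨_, hC, by simp⟩⟩
  have inv : ∀ f g, f ∈ B \ C → Br (B ∪ I) C f g →
      (g ∈ B ∧ Br B C f g) ∨ (g ∉ B ∧ ∃ g2 ∈ D, Br B C f g2) := by
    intro f g hf h
    induction h with
    | refl => exact Or.inl ⟨(mem_sdiff.1 hf).1, .refl⟩
    | @tail b c _ hs ih =>
      obtain ⟨k1, k2, v, k3, k4, k5⟩ := hs
      rw [mem_sdiff, mem_union] at k1 k2
      rcases ih with ⟨hb, h1⟩ | ⟨hb, g2, hg2, h1⟩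
      · by_cases hc : c ∈ B
        · exact Or.inl ⟨hc, h1.trans (.step (mem_sdiff.2 ⟨hb, k1.2⟩) (mem_sdiff.2 ⟨hc, k2.2⟩) k3 k4 k5)⟩
        · right
          obtain ⟨g2, hg2, hv⟩ := hBI v ⟨b, hb, k4⟩ ⟨c, k2.1.resolve_left hc, k5⟩
          exact ⟨hc, g2, hg2, h1.trans (.step (mem_sdiff.2 ⟨hb, k1.2⟩) (hsub _ hg2) k3 k4 hv)⟩
      · by_cases hc : c ∈ B
        · left
          obtain ⟨g3, hg3, hv⟩ := hBI v ⟨c, hc, k5⟩ ⟨b, k1.1.resolve_left hb, k4⟩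
          exact ⟨hc, h1.trans ((hD.br_all hDB hdj hg2 hg3).trans
            (.step (hsub _ hg3) (mem_sdiff.2 ⟨hc, k2.2⟩) k3 hv k5))⟩
        · exact Or.inr ⟨hc, g2, hg2, h1⟩
  have hat : ∀ f ∈ (B ∪ I) \ C, (∀ v, v ∉ att (B ∪ I) C f) ∨
      ∃ g ∈ B \ C, Br (B ∪ I) C f g ∧ att (B ∪ I) C f ⊆ att B C g := by
    intro f hf
    by_cases h : ∃ v, v ∈ att (B ∪ I) C f
    · right
      have inB : ∀ v ∈ vs C, ∀ g ∈ (B ∪ I) \ C, v ∈ g → g ∈ B \ C := by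
        intro v hv g hg hvg
        rw [mem_sdiff, mem_union] at hg
        refine mem_sdiff.2 ⟨hg.1.resolve_right fun h => hIC v ⟨g, h, hvg⟩ hv, hg.2⟩
      obtain ⟨v, hv, g, hg, hvg⟩ := h
      have hgB := inB v hv g (hg.mem hf) hvg
      refine ⟨g, hgB, hg, ?_⟩
      rw [att_congr hg]
      rintro w ⟨hw, k, hk, hwk⟩
      have hkB := inB w hw k (hk.mem (hg.mem hf)) hwk
      rcases inv g k hgB hk with h | h
      · exact ⟨hw, k, h.2, hwk⟩
      · exact absurd (mem_sdiff.1 hkB).1 h.1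
    · left; push Not at h; exact h
  refine NO_map hC hNO fun f hf f' hf' hb => ?_
  obtain ⟨c, hc⟩ := hC.nonempty
  induction c with | _ p q =>
  rcases hat f hf with h | ⟨g, hg, hg1, hg2⟩
  · left; exact ⟨p, q, hc, fun v hv => absurd hv (h v)⟩
  rcases hat f' hf' with h | ⟨g', hg', hg1', hg2'⟩
  · right; left; exact ⟨p, q, hc, fun v hv => absurd hv (h v)⟩
  right; right
  exact ⟨g, hg, g', hg', fun h => hb (hg1.trans ((h.mono subset_union_left).trans hg1'.symm)),
    hg2, hg2'⟩

end
end PB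

namespace PB
section
open Classical Finset

variable {V : Type}

def nz (a : ZMod 2) : ℕ := if a = 0 then 0 else 1

@[simp] lemma nz_zero : nz 0 = 0 := rfl
@[simp] lemma nz_one : nz 1 = 1 := rfl

lemma card_nz {ι : Type} [Fintype ι] (f : ι → Vec V) (e : Sym2 V) :
    #{i | f i e ≠ 0} = ∑ i, nz (f i e) := by
  rw [card_filter]
  refine sum_congr rfl fun i _ => ?_
  unfold nz
  split_ifs <;> simp_all

lemma span_iff {E : Finset (Sym2 V)} {ι : Type} [Fintype ι] {f : ι → Vec V} :
    (∀ z ∈ Zc E, ∃ c : ι → ZMod 2, z = ∑ i, c i • f i) ↔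
      ∀ z ∈ Zc E, z ∈ Submodule.span (ZMod 2) (Set.range f) := by
  refine forall₂_congr fun z hz => ?_
  rw [Submodule.mem_span_range_iff_exists_fun]
  exact exists_congr fun c => eq_comm

/-- pendant edge or edge joining two components -/
lemma Pl_pendant {E : Finset (Sym2 V)} (hE : LL E) (hP : Pl E) (U : Finset V) {u c : V}
    (hu : u ∈ U) (hc : c ∉ U) (hx : ∀ e ∈ E, (∃ v ∈ e, v ∈ U) → ∀ v ∈ e, v ∈ U) :
    Pl (insert s(u,c) E) := by
  obtain ⟨ι, _, f, h1, h2, h3⟩ := hP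
  refine ⟨ι, inferInstance, f, fun i => Zc_mono (subset_insert _ _) (h1 i), fun z hz => h2 z ?_, h3⟩
  have hLL : LL (insert s(u,c) E) := by
    intro e he
    rcases mem_insert.1 he with rfl | he
    · have : u ≠ c := by rintro rfl; exact hc hu
      simpa using this
    · exact hE e he
  have hs := handshake hLL z U
  rw [sum_eq_zero (fun v _ => hz.2 v)] at hs
  rw [sum_eq_single_of_mem s(u,c) (mem_insert_self _ _), if_pos ⟨⟨u, by simp, hu⟩, ⟨c, by simp, hc⟩⟩] at hs
  · refine Zc_of_spt (subset_insert _ _) hz fun e he => ?_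
    by_cases h : e = s(u,c)
    · rw [h, hs]
    · exact hz.1 e (by simp [h, he])
  · intro e he hne
    rw [if_neg]
    rintro ⟨h4, v, h5, h6⟩
    exact h6 (hx e ((mem_insert.1 he).resolve_left hne) h4 v h5)

lemma Pl_pick {X : Finset (Sym2 V)} (hP : Pl X) (e0 : Sym2 V) :
    ∃ (ι : Type) (_ : Fintype ι) (f : ι → Vec V) (k : Vec V), (∀ i, f i ∈ Zc X) ∧ k ∈ Zc X ∧
    (∀ z ∈ Zc X, z ∈ Submodule.span (ZMod 2) (Set.range f)) ∧
    (∀ e, ∑ i, nz (f i e) + nz (k e) ≤ 2) ∧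
    (k e0 = 0 → ∀ i, f i e0 = 0) := by
  obtain ⟨ι, _, f, h1, h2, h3, h4⟩ := Pl_norm hP
  rw [span_iff] at h2
  by_cases h : ∀ i, f i e0 = 0
  · refine ⟨ι, inferInstance, f, 0, h1, Submodule.zero_mem _, h2, fun e => ?_, fun _ => h⟩
    rw [← card_nz]
    simpa using h3 e
  · push Not at h
    obtain ⟨a, ha⟩ := h
    refine ⟨ι, inferInstance, Function.update f a 0, f a, ?_, h1 a, ?_, ?_, fun h => absurd h ha⟩
    · intro i
      by_cases hi : i = a
      · subst hi; simp
      · simpa [hi] using h1 i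
    · intro z hz
      refine Submodule.span_le.2 ?_ (h2 z hz)
      have hmem : ∀ i ≠ a, f i ∈ Submodule.span (ZMod 2) (Set.range (Function.update f a 0)) :=
        fun i hi => Submodule.subset_span ⟨i, by simp [hi]⟩
      rintro _ ⟨i, rfl⟩
      by_cases hi : i = a
      · subst hi
        rw [← add_sum_erase _ _ (mem_univ i)] at h4
        have : f i = ∑ j ∈ univ.erase i, f j := by
          have h5 := vself (∑ j ∈ univ.erase i, f j)
          calc f i = f i + (∑ j ∈ univ.erase i, f j + ∑ j ∈ univ.erase i, f j) := by rw [h5, add_zero]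
            _ = _ := by rw [← add_assoc, h4, zero_add]
        simp only [SetLike.mem_coe]
        rw [this]
        exact Submodule.sum_mem _ fun j hj => hmem j (ne_of_mem_erase hj)
      · exact hmem i hi
    · intro e
      have h3 := h3 e
      rw [card_nz, ← add_sum_erase _ _ (mem_univ a)] at h3
      rw [← add_sum_erase _ _ (mem_univ a)]
      rw [sum_congr rfl (fun i hi => by rw [Function.update_of_ne (ne_of_mem_erase hi)])]
      simp only [Function.update_self]
      rw [show (0 : Vec V) e = 0 from rfl, nz_zero]
      omega

/-- joining at a cut vertex -/
lemma Pl_join {X Y : Finset (Sym2 V)} (hX : LL X) (hPX : Pl X) (hPY : Pl Y)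
    (hdj : Disjoint X Y) {z a b : V} (hz : ∀ v ∈ vs X, v ∈ vs Y → v = z) (ha : s(z,a) ∈ Y)
    (hb : s(z,b) ∈ X) (hza : z ≠ a) (hzb : z ≠ b) (hab : a ≠ b) (hgX : s(a,b) ∉ X) (hgY : s(a,b) ∉ Y) :
    Pl (insert s(a,b) (X ∪ Y)) := by
  set E := X ∪ Y with hE
  have hsp : ∀ h ∈ Zc E, ∃ h1 ∈ Zc X, ∃ h2 ∈ Zc Y, h = h1 + h2 := by
    intro h hh
    let h1 : Vec V := fun e => if e ∈ X then h e else 0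
    have hs1 : Spt X h1 := fun e he => by simp [h1, he]
    have hne : ∀ v, v ≠ z → dg X h1 v = 0 := by
      intro v hv
      by_cases hvX : v ∈ vs X
      · rw [← hh.2 v]
        unfold dg
        rw [hE, sum_union hdj, sum_congr rfl (g := fun e => if v ∈ e then h e else 0)
          (fun e he => by simp [h1, he])]
        rw [sum_eq_zero (s := Y), add_zero]
        intro e he
        rw [if_neg]
        exact fun hve => hv (hz v hvX ⟨e, he, hve⟩)
      · exact dg_not_mem hvX
    have hzz : dg X h1 z = 0 := by
      have hs := handshake hX h1 (vs_finite X).toFinset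
      rw [sum_eq_single_of_mem z (by rw [Set.Finite.mem_toFinset]; exact ⟨_, hb, by simp⟩)
        (fun v _ hv => hne v hv)] at hs
      rw [hs]
      apply sum_eq_zero
      intro e he
      rw [if_neg]
      rintro ⟨-, v, hv, hv'⟩
      exact hv' ((Set.Finite.mem_toFinset _).2 ⟨e, he, hv⟩)
    have hZ1 : h1 ∈ Zc X := ⟨hs1, fun v => by
      by_cases hv : v = z
      · rw [hv, hzz]
      · exact hne v hv⟩
    refine ⟨h1, hZ1, h + h1, ?_, ?_⟩
    · refine Zc_of_spt (hE ▸ subset_union_right)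
        (Submodule.add_mem _ hh (Zc_mono (hE ▸ subset_union_left) hZ1)) fun e he => ?_
      by_cases heX : e ∈ X
      · simp [h1, heX, z2self]
      · simp [h1, heX, hh.1 e (by simp [hE, heX, he])]
    · rw [add_comm, add_assoc, vself, add_zero]
  have hne1 : s(z,a) ≠ s(z,b) := fun h => disjoint_left.1 hdj hb (h ▸ ha)
  have hne2 : s(z,a) ≠ s(a,b) := fun h => hgY (h ▸ ha)
  have hne3 : s(z,b) ≠ s(a,b) := fun h => hgX (h ▸ hb)
  have haX : s(z,a) ∉ X := fun h => disjoint_left.1 hdj h ha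
  have hbY : s(z,b) ∉ Y := fun h => disjoint_left.1 hdj hb h
  let t : Vec V := ind {s(z,a)} + ind {s(z,b)} + ind {s(a,b)}
  have htv : ∀ e, t e = if e = s(z,a) ∨ e = s(z,b) ∨ e = s(a,b) then 1 else 0 := by
    intro e
    simp only [t, Pi.add_apply, ind, mem_singleton]
    by_cases h1 : e = s(z,a)
    · subst h1; simp [hne1, hne2]
    · by_cases h2 : e = s(z,b)
      · subst h2; simp [hne1.symm, hne3]
      · simp [h1, h2]
  set E' := insert s(a,b) E with hE'
  have hEE : E ⊆ E' := subset_insert _ _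
  have hXE : X ⊆ E' := fun e he => hEE (mem_union_left _ he)
  have hYE : Y ⊆ E' := fun e he => hEE (mem_union_right _ he)
  have htZ : t ∈ Zc E' := by
    refine ⟨fun e he => ?_, fun v => ?_⟩
    · rw [htv, if_neg]
      rintro (rfl | rfl | rfl)
      · exact he (hYE ha)
      · exact he (hXE hb)
      · exact he (mem_insert_self _ _)
    · rw [dg_add, dg_add, dg_single hza (hYE ha), dg_single hzb (hXE hb),
        dg_single hab (mem_insert_self _ _)]
      linear_combination z2self (dl z v) + z2self (dl a v) + z2self (dl b v)
  obtain ⟨ι, _, f, k, hf, hk, hsf, hcf, hkf⟩ := Pl_pick hPX s(z,b)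
  obtain ⟨κ, _, f', k', hf', hk', hsf', hcf', hkf'⟩ := Pl_pick hPY s(z,a)
  let F : (ι ⊕ κ) ⊕ Bool → Vec V := Sum.elim (Sum.elim f f') (fun b => if b then t else t + k + k')
  refine ⟨(ι ⊕ κ) ⊕ Bool, inferInstance, F, ?_, ?_, ?_⟩
  · rintro ((i | i) | b)
    · exact Zc_mono hXE (hf i)
    · exact Zc_mono hYE (hf' i)
    · cases b
      · exact Submodule.add_mem _ (Submodule.add_mem _ htZ (Zc_mono hXE hk)) (Zc_mono hYE hk')
      · exact htZ
  · rw [span_iff]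
    have htF : t ∈ Submodule.span (ZMod 2) (Set.range F) :=
      Submodule.subset_span ⟨Sum.inr true, by simp [F]⟩
    have main : ∀ h ∈ Zc E, h ∈ Submodule.span (ZMod 2) (Set.range F) := by
      intro h hh
      obtain ⟨h1, hh1, h2, hh2, rfl⟩ := hsp h hh
      refine Submodule.add_mem _ ?_ ?_
      · refine Submodule.span_mono ?_ (hsf h1 hh1)
        rintro _ ⟨i, rfl⟩; exact ⟨Sum.inl (Sum.inl i), rfl⟩
      · refine Submodule.span_mono ?_ (hsf' h2 hh2)
        rintro _ ⟨i, rfl⟩; exact ⟨Sum.inl (Sum.inr i), rfl⟩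
    intro h hh
    rcases z2 (h s(a,b)) with h0 | h1
    · apply main
      refine Zc_of_spt hEE hh fun e he => ?_
      by_cases heg : e = s(a,b)
      · rw [heg, h0]
      · exact hh.1 e (by simp [hE', heg, he])
    · have : h + t ∈ Submodule.span (ZMod 2) (Set.range F) := by
        apply main
        refine Zc_of_spt hEE (Submodule.add_mem _ hh htZ) fun e he => ?_
        by_cases heg : e = s(a,b)
        · rw [Pi.add_apply, htv, heg, h1, if_pos (by simp)]; exact z2self 1
        · exact (Submodule.add_mem _ hh htZ).1 e (by simp [hE', heg, he])
      have h2 := Submodule.add_mem _ this htF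
      rwa [add_assoc, vself, add_zero] at h2
  · intro e
    rw [card_nz, Fintype.sum_sum_type, Fintype.sum_sum_type]
    simp only [F, Sum.elim_inl, Sum.elim_inr, Fintype.sum_bool, if_true, Bool.false_eq_true, if_false]
    have c1 := hcf e
    have c2 := hcf' e
    have zX : e ∉ X → ∑ i, nz (f i e) = 0 ∧ k e = 0 := by
      intro he
      refine ⟨sum_eq_zero fun i _ => ?_, hk.1 e he⟩
      rw [(hf i).1 e he]; simp
    have zY : e ∉ Y → ∑ i, nz (f' i e) = 0 ∧ k' e = 0 := by
      intro he
      refine ⟨sum_eq_zero fun i _ => ?_, hk'.1 e he⟩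
      rw [(hf' i).1 e he]; simp
    simp only [Pi.add_apply]
    by_cases h1 : e = s(z,b)
    · obtain ⟨y1, y2⟩ := zY (h1 ▸ hbY)
      have ht1 : t e = 1 := by rw [htv, if_pos (by simp [h1])]
      rw [y1, y2, ht1]
      rcases z2 (k e) with hk0 | hk1
      · have : ∑ i, nz (f i e) = 0 := by
          refine sum_eq_zero fun i _ => ?_
          rw [h1, hkf (h1 ▸ hk0) i]; simp
        rw [this, hk0]; simp
      · rw [hk1] at c1 ⊢
        have e1 : (1 : ZMod 2) + 1 = 0 := rfl
        simp only [e1, add_zero, nz_one, nz_zero] at c1 ⊢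
        omega
    by_cases h2 : e = s(z,a)
    · obtain ⟨y1, y2⟩ := zX (h2 ▸ haX)
      have ht1 : t e = 1 := by rw [htv, if_pos (by simp [h2])]
      rw [y1, y2, ht1]
      rcases z2 (k' e) with hk0 | hk1
      · have : ∑ i, nz (f' i e) = 0 := by
          refine sum_eq_zero fun i _ => ?_
          rw [h2, hkf' (h2 ▸ hk0) i]; simp
        rw [this, hk0]; simp
      · rw [hk1] at c2 ⊢
        have e1 : (1 : ZMod 2) + 1 = 0 := rfl
        simp only [e1, add_zero, nz_one, nz_zero] at c2 ⊢
        omega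
    by_cases h3 : e = s(a,b)
    · obtain ⟨y1, y2⟩ := zX (h3 ▸ hgX)
      obtain ⟨y3, y4⟩ := zY (h3 ▸ hgY)
      rw [y1, y2, y3, y4]
      simp only [nz, add_zero, zero_add]
      split_ifs <;> simp
    · have ht0 : t e = 0 := by rw [htv, if_neg (by simp [h1, h2, h3])]
      rw [ht0]
      by_cases heX : e ∈ X
      · obtain ⟨y3, y4⟩ := zY (fun h => disjoint_left.1 hdj heX h)
        rw [y3, y4]
        simp only [zero_add, add_zero, nz_zero] at c1 ⊢
        exact c1
      · obtain ⟨y3, y4⟩ := zX heX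
        rw [y3, y4]
        simp only [zero_add, add_zero, nz_zero] at c2 ⊢
        exact c2

end
end PB

namespace PB
section
open Classical Finset

variable {V : Type}

def T2 (E C : Finset (Sym2 V)) : Prop :=
  ∀ X ⊆ E \ C, X.Nonempty →
    ∃ v w, v ≠ w ∧ v ∈ vs X ∧ v ∈ vs (E \ X) ∧ w ∈ vs X ∧ w ∈ vs (E \ X)

def Good (E C : Finset (Sym2 V)) : Prop := LL E ∧ Pl E ∧ NO E C

lemma LL_insert {E : Finset (Sym2 V)} (hE : LL E) {a b : V} (hab : a ≠ b) : LL (insert s(a,b) E) := by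
  intro e he
  rcases mem_insert.1 he with rfl | he
  · simpa using hab
  · exact hE e he

lemma good_pendant {E C : Finset (Sym2 V)} (hC : Circ C) (hG : Good E C)
    (U : Finset V) {u c : V} (hu : u ∈ U) (hc : c ∈ vs C) (hUC : ∀ v ∈ U, v ∉ vs C)
    (hx : ∀ e ∈ E, (∃ v ∈ e, v ∈ U) → ∀ v ∈ e, v ∈ U) :
    s(u,c) ∉ E ∧ Good (insert s(u,c) E) C := by
  have hcU : c ∉ U := fun h => hUC c h hc
  have huc : u ≠ c := by rintro rfl; exact hcU hu
  refine ⟨fun h => hcU (hx _ h ⟨u, by simp, hu⟩ c (by simp)), LL_insert hG.1 huc,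
    Pl_pendant hG.1 hG.2.1 U hu hcU hx, ?_⟩
  obtain ⟨q, hq⟩ : ∃ q, s(c,q) ∈ C := by
    obtain ⟨e, he, hce⟩ := hc
    obtain ⟨q, rfl⟩ := hce
    exact ⟨q, he⟩
  refine NO_add hC hG.2.2 hq ?_
  have key : ∀ h, Br (insert s(u,c) E) C s(u,c) h → h = s(u,c) ∨ ∀ v ∈ h, v ∈ U := by
    intro h hb
    induction hb with
    | refl => exact Or.inl rfl
    | @tail b d _ hs ih =>
      obtain ⟨k1, k2, v, k3, k4, k5⟩ := hs
      by_cases hd : d = s(u,c)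
      · exact Or.inl hd
      right
      have hdE : d ∈ E := (mem_insert.1 (mem_sdiff.1 k2).1).resolve_left hd
      refine hx d hdE ⟨v, k5, ?_⟩
      rcases ih with rfl | ih
      · rcases Sym2.mem_iff.1 k4 with rfl | rfl
        · exact hu
        · exact absurd hc k3
      · exact ih v k4
  rintro v ⟨hv, h, hb, hvh⟩
  rcases key h hb with rfl | h
  · rcases Sym2.mem_iff.1 hvh with rfl | rfl
    · exact absurd hv (hUC _ hu)
    · exact Or.inl rfl
  · exact absurd hv (hUC v (h v hvh))

lemma good_join {E C X : Finset (Sym2 V)} (hC : Circ C) (hCE : C ⊆ E) (hG : Good E C)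
    (hX : X ⊆ E \ C) {z : V} (hzX : z ∈ vs X) (hzY : z ∈ vs (E \ X))
    (hz : ∀ v ∈ vs X, v ∈ vs (E \ X) → v = z) :
    ∃ a b, s(a,b) ∉ E ∧ Good (insert s(a,b) E) C := by
  have hXE : X ⊆ E := hX.trans sdiff_subset
  have hCY : C ⊆ E \ X := fun e he => mem_sdiff.2 ⟨hCE he, fun h => (mem_sdiff.1 (hX h)).2 he⟩
  have hEXY : E = X ∪ (E \ X) := by rw [union_sdiff_of_subset hXE]
  obtain ⟨a, haY, haC⟩ : ∃ a, s(z,a) ∈ E \ X ∧ (z ∈ vs C → s(z,a) ∈ C) := by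
    by_cases hzC : z ∈ vs C
    · obtain ⟨e, he, hze⟩ := hzC
      obtain ⟨a, rfl⟩ := hze
      exact ⟨a, hCY he, fun _ => he⟩
    · obtain ⟨e, he, hze⟩ := hzY
      obtain ⟨a, rfl⟩ := hze
      exact ⟨a, he, fun h => absurd h hzC⟩
  obtain ⟨b, hbX⟩ : ∃ b, s(z,b) ∈ X := by
    obtain ⟨e, he, hze⟩ := hzX
    obtain ⟨b, rfl⟩ := hze
    exact ⟨b, he⟩
  have hza : z ≠ a := by simpa using hG.1 _ (mem_sdiff.1 haY).1
  have hzb : z ≠ b := by simpa using hG.1 _ (hXE hbX)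
  have haX : a ∉ vs X := fun h => hza (hz a h ⟨_, haY, by simp⟩).symm
  have hbY : b ∉ vs (E \ X) := fun h => hzb (hz b ⟨_, hbX, by simp⟩ h).symm
  have hbC : b ∉ vs C := fun h => hbY (vs_mono hCY h)
  have hab : a ≠ b := by rintro rfl; exact haX ⟨_, hbX, by simp⟩
  have hgX : s(a,b) ∉ X := fun h => haX ⟨_, h, by simp⟩
  have hgY : s(a,b) ∉ E \ X := fun h => hbY ⟨_, h, by simp⟩
  have hgE : s(a,b) ∉ E := by rw [hEXY, mem_union]; tauto
  have hgC : s(a,b) ∉ C := fun h => hgE (hCE h)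
  have hXC : ∀ v ∈ vs X, v ∈ vs C → v = z := fun v h1 h2 => hz v h1 (vs_mono hCY h2)
  refine ⟨a, b, hgE, LL_insert hG.1 hab, ?_, ?_⟩
  · rw [hEXY]
    exact Pl_join (fun e he => hG.1 e (hXE he)) (Pl_mono hXE hG.2.1)
      (Pl_mono sdiff_subset hG.2.1) disjoint_sdiff hz haY hbX hza hzb hab hgX hgY
  by_cases hzC : z ∈ vs C
  · refine NO_add hC hG.2.2 (haC hzC) ?_
    have haC' : a ∈ vs C := ⟨_, haC hzC, by simp⟩
    have key : ∀ h, Br (insert s(a,b) E) C s(a,b) h → h = s(a,b) ∨ h ∈ X := by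
      intro h hb
      induction hb with
      | refl => exact Or.inl rfl
      | @tail p d _ hs ih =>
        obtain ⟨k1, k2, v, k3, k4, k5⟩ := hs
        by_cases hd : d = s(a,b)
        · exact Or.inl hd
        right
        have hdE : d ∈ E := (mem_insert.1 (mem_sdiff.1 k2).1).resolve_left hd
        by_contra hdX
        have hvY : v ∈ vs (E \ X) := ⟨d, mem_sdiff.2 ⟨hdE, hdX⟩, k5⟩
        rcases ih with rfl | ih
        · rcases Sym2.mem_iff.1 k4 with rfl | rfl
          · exact k3 haC'
          · exact hbY hvY
        · have := hz v ⟨_, ih, k4⟩ hvY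
          subst this
          exact k3 hzC
    rintro v ⟨hv, h, hb, hvh⟩
    rcases key h hb with rfl | h
    · rcases Sym2.mem_iff.1 hvh with rfl | rfl
      · exact Or.inr rfl
      · exact absurd hv hbC
    · exact Or.inl (hXC v ⟨_, h, hvh⟩ hv)
  · have hzbE : s(z,b) ∈ E \ C := hX hbX
    have hzaE : s(z,a) ∈ E \ C := mem_sdiff.2 ⟨(mem_sdiff.1 haY).1, fun h => hzC ⟨_, h, by simp⟩⟩
    have hzab : Br E C s(z,b) s(z,a) := .step hzbE hzaE hzC (by simp) (by simp)
    let φ : Sym2 V → Sym2 V := fun h => if h = s(a,b) then s(z,b) else h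
    have hφg : φ s(a,b) = s(z,b) := if_pos rfl
    have hφ : ∀ h, h ≠ s(a,b) → φ h = h := fun h hh => if_neg hh
    have hφE : ∀ h ∈ insert s(a,b) E \ C, φ h ∈ E \ C := by
      intro h hh
      by_cases hg : h = s(a,b)
      · rw [hg, hφg]; exact hzbE
      · rw [hφ h hg]
        rw [mem_sdiff, mem_insert] at hh
        exact mem_sdiff.2 ⟨hh.1.resolve_left hg, hh.2⟩
    -- every non-circuit vertex of `h` is on an edge related to `φ h`
    have hφv : ∀ h ∈ insert s(a,b) E \ C, ∀ v ∈ h, v = b ∨ ∃ h' ∈ E \ C, Br E C (φ h) h' ∧ v ∈ h' := by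
      intro h hh v hv
      by_cases hg : h = s(a,b)
      · subst hg
        rcases Sym2.mem_iff.1 hv with rfl | rfl
        · right; exact ⟨_, hzaE, by rw [hφg]; exact hzab, by simp⟩
        · exact Or.inl rfl
      · right
        exact ⟨h, by rw [← hφ h hg]; exact hφE h hh, by rw [hφ h hg]; exact .refl, hv⟩
    have hφv' : ∀ h ∈ insert s(a,b) E \ C, ∀ v ∈ h, ∃ h' ∈ E \ C, (v ∉ vs C → Br E C (φ h) h') ∧ v ∈ h' ∧
        (v ∈ vs C → Br E C (φ h) h') := by
      intro h hh v hv
      rcases hφv h hh v hv with rfl | ⟨h', h1, h2, h3⟩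
      · refine ⟨s(z,v), hzbE, fun _ => ?_, by simp, fun h => absurd h hbC⟩
        by_cases hg : h = s(a,v)
        · rw [hg, hφg]; exact .refl
        · rw [hφ h hg]
          exact .step (by rw [← hφ h hg]; exact hφE h hh) hzbE hbC hv (by simp)
      · exact ⟨h', h1, fun _ => h2, h3, fun _ => h2⟩
    have hbr : ∀ h h', Br (insert s(a,b) E) C h h' → Br E C (φ h) (φ h') := by
      intro h h' hb
      induction hb with
      | refl => exact .refl
      | @tail p d _ hs ih =>
        obtain ⟨k1, k2, v, k3, k4, k5⟩ := hs
        obtain ⟨p', l1, l2, l3, -⟩ := hφv' p k1 v k4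
        obtain ⟨d', m1, m2, m3, -⟩ := hφv' d k2 v k5
        exact ih.trans ((l2 k3).trans ((Br.step l1 m1 k3 l3 m3).trans (m2 k3).symm))
    refine NO_map hC hG.2.2 fun f hf f' hf' hb => Or.inr (Or.inr ?_)
    have hat : ∀ f ∈ insert s(a,b) E \ C, att (insert s(a,b) E) C f ⊆ att E C (φ f) := by
      rintro f hf v ⟨hv, h, hh, hvh⟩
      obtain ⟨h', l1, l2, l3, l4⟩ := hφv' h (hh.mem hf) v hvh
      exact ⟨hv, h', (hbr f h hh).trans (l4 hv), l3⟩
    have hback : ∀ f ∈ insert s(a,b) E \ C, Br (insert s(a,b) E) C f (φ f) := by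
      intro f hf
      by_cases hg : f = s(a,b)
      · subst hg
        rw [hφg]
        refine .step hf ?_ hbC (by simp) (by simp)
        rw [mem_sdiff] at hzbE ⊢
        exact ⟨mem_insert_of_mem hzbE.1, hzbE.2⟩
      · rw [hφ f hg]; exact .refl
    exact ⟨φ f, hφE f hf, φ f', hφE f' hf', fun h => hb ((hback f hf).trans
      ((h.mono (subset_insert _ _)).trans (hback f' hf').symm)), hat f hf, hat f' hf'⟩

lemma augment [Fintype V] {R C : Finset (Sym2 V)} (hC : Circ C) (hCR : C ⊆ R) (hG : Good R C) :
    ∃ E, R ⊆ E ∧ Good E C ∧ T2 E C ∧ ∀ v, v ∈ vs E := by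
  have hne : (univ.filter fun E : Finset (Sym2 V) => R ⊆ E ∧ Good E C).Nonempty :=
    ⟨R, by simp [hG]⟩
  obtain ⟨E, hE, hmax⟩ := exists_max_image _ card hne
  simp only [mem_filter, mem_univ, true_and] at hE hmax
  obtain ⟨hRE, hGE⟩ := hE
  have hCE := hCR.trans hRE
  have hcon : ∀ g, g ∉ E → Good (insert g E) C → False := by
    intro g hg hG
    have := hmax (insert g E) ⟨hRE.trans (subset_insert _ _), hG⟩
    rw [card_insert_of_notMem hg] at this
    omega
  obtain ⟨c, hc⟩ : ∃ c, c ∈ vs C := by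
    obtain ⟨a, b, P1, P2, h⟩ := hC
    exact ⟨a, vs_mono h.sub1 h.p1.left_mem⟩
  refine ⟨E, hRE, hGE, ?_, ?_⟩
  · intro X hX hXne
    by_contra hcontra
    push Not at hcontra
    have hCY : C ⊆ E \ X := fun e he => mem_sdiff.2 ⟨hCE he, fun h => (mem_sdiff.1 (hX h)).2 he⟩
    by_cases hsh : ∃ z ∈ vs X, z ∈ vs (E \ X)
    · obtain ⟨z, hz1, hz2⟩ := hsh
      obtain ⟨a, b, h1, h2⟩ := good_join hC hCE hGE hX hz1 hz2 (fun v hv hv' => by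
        by_contra hne
        exact hcontra v z hne hv hv' hz1 hz2)
      exact hcon _ h1 h2
    · push Not at hsh
      obtain ⟨e, he⟩ := hXne
      induction e with | _ u w =>
      obtain ⟨h1, h2⟩ := good_pendant hC hGE (vs_finite X).toFinset (u := u) (c := c)
        (by rw [Set.Finite.mem_toFinset]; exact ⟨_, he, by simp⟩) hc
        (fun v hv hv' => by
          rw [Set.Finite.mem_toFinset] at hv
          exact hsh v hv (vs_mono hCY hv'))
        (fun e he ⟨v, hv, hvX⟩ w hw => by
          rw [Set.Finite.mem_toFinset] at hvX ⊢
          by_cases heX : e ∈ X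
          · exact ⟨e, heX, hw⟩
          · exact absurd ⟨e, mem_sdiff.2 ⟨he, heX⟩, hv⟩ (hsh v hvX))
      exact hcon _ h1 h2
  · intro u
    by_contra hu
    obtain ⟨h1, h2⟩ := good_pendant hC hGE {u} (u := u) (c := c) (by simp) hc
        (fun v hv hv' => by
          rw [mem_singleton] at hv
          subst hv
          exact hu (vs_mono hCE hv'))
        (fun e he ⟨v, hv, hvX⟩ w hw => by
          rw [mem_singleton] at hvX
          subst hvX
          exact absurd ⟨e, he, hv⟩ hu)
    exact hcon _ h1 h2

end
end PB

namespace PB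
section
open Classical Finset

variable {V : Type}

lemma T2.reach {E C : Finset (Sym2 V)} (hT : T2 E C) {z u : V} (hu : u ∈ vs E) (huz : u ≠ z) :
    ∃ r ∈ vs C, r ≠ z ∧ Rch E {v | v ≠ z} u r := by
  by_contra hcon
  push Not at hcon
  have hKz : ∀ v, Rch E {v | v ≠ z} u v → v ≠ z := by
    intro v hv
    cases hv with
    | refl => exact huz
    | tail _ hs => exact hs.2.2
  let X := E.filter fun e => ∃ v ∈ e, Rch E {v | v ≠ z} u v
  have key : ∀ v, v ≠ z → v ∈ vs X → v ∈ vs (E \ X) → False := by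
    intro v hvz ⟨e, he, hve⟩ ⟨e', he', hve'⟩
    rw [mem_filter] at he
    obtain ⟨heE, k, hk, hr⟩ := he
    have hv : Rch E {v | v ≠ z} u v := by
      by_cases hkv : k = v
      · rw [← hkv]; exact hr
      · rw [(Sym2.mem_and_mem_iff hkv).1 ⟨hk, hve⟩] at heE
        exact hr.tail ⟨heE, hKz k hr, hvz⟩
    rw [mem_sdiff] at he'
    exact he'.2 (mem_filter.2 ⟨he'.1, v, hve', hv⟩)
  obtain ⟨v, w, hvw, h1, h2, h3, h4⟩ := hT X (by
      intro e he
      rw [mem_filter] at he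
      obtain ⟨h1, v, h2, h3⟩ := he
      exact mem_sdiff.2 ⟨h1, fun h => hcon v ⟨e, h, h2⟩ (hKz v h3) h3⟩) (by
      obtain ⟨e, he, hue⟩ := hu
      exact ⟨e, mem_filter.2 ⟨he, u, hue, .refl⟩⟩)
  by_cases hvz : v = z
  · exact key w (by rintro rfl; exact hvw hvz) h3 h4
  · exact key v hvz h1 h2

lemma T2.cyc {E C : Finset (Sym2 V)} (hT : T2 E C) (hE : LL E) (hC : Circ C) (hCE : C ⊆ E) {z : V}
    {p q : Sym2 V} (hp : p ∈ E) (hq : q ∈ E) (hpq : p ≠ q) (hzp : z ∈ p) (hzq : z ∈ q) :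
    ∃ h ∈ Zc E, h p ≠ 0 ∧ h q ≠ 0 ∧ ∀ e, z ∈ e → h e ≠ 0 → e = p ∨ e = q := by
  obtain ⟨u, rfl⟩ := hzp
  obtain ⟨w, rfl⟩ := hzq
  have hzu : z ≠ u := by simpa using hE _ hp
  have hzw : z ≠ w := by simpa using hE _ hq
  have huw : u ≠ w := by rintro rfl; exact hpq rfl
  obtain ⟨r, hr, hrz, h1⟩ := hT.reach (z := z) (u := u) ⟨_, hp, by simp⟩ hzu.symm
  obtain ⟨r', hr', hrz', h2⟩ := hT.reach (z := z) (u := w) ⟨_, hq, by simp⟩ hzw.symm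
  have h3 : Rch E {v | v ≠ z} u w :=
    h1.trans (((hC.rch_avoid hr hr' hrz hrz').mono hCE subset_rfl).trans h2.symm)
  obtain ⟨P, hPE, hP, hPz⟩ := Pth.exists_of_rch h3 huw
  have hzP : ∀ e ∈ P, z ∉ e := fun e he hz => hPz ⟨e, he, hz⟩ rfl
  refine ⟨ind P + ind {s(z,u)} + ind {s(z,w)}, ⟨?_, ?_⟩, ?_, ?_, ?_⟩
  · intro e he
    have e1 : e ∉ P := fun h => he (hPE h)
    have e2 : e ≠ s(z,u) := by rintro rfl; exact he hp
    have e3 : e ≠ s(z,w) := by rintro rfl; exact he hq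
    simp [ind, e1, e2, e3]
  · intro v
    rw [dg_add, dg_add, dg_mono hPE (ind_spt subset_rfl), hP.dg_ind, dg_single hzu hp,
      dg_single hzw hq]
    linear_combination z2self (dl z v) + z2self (dl u v) + z2self (dl w v)
  · have : s(z,u) ∉ P := fun h => hzP _ h (by simp)
    simp only [ind, Pi.add_apply, mem_singleton, this, hpq, if_true, if_false]
    decide
  · have : s(z,w) ∉ P := fun h => hzP _ h (by simp)
    simp only [ind, Pi.add_apply, mem_singleton, this, hpq.symm, if_true, if_false]
    decide
  · intro e hze hne
    by_contra hcon
    push Not at hcon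
    have : e ∉ P := fun h => hzP _ h hze
    simp [ind, this, hcon.1, hcon.2] at hne

lemma T2.cov {E C : Finset (Sym2 V)} (hT : T2 E C) (hE : LL E) (hC : Circ C) (hCE : C ⊆ E)
    {e : Sym2 V} (he : e ∈ E) : ∃ h ∈ Zc E, h e ≠ 0 := by
  by_cases heC : e ∈ C
  · exact ⟨ind C, Zc_mono hCE hC.ind_mem, by simp [ind, heC]⟩
  · obtain ⟨v, -, -, ⟨e1, h1, h2⟩, ⟨e2, h3, h4⟩, -⟩ := hT {e} (by simp [he, heC]) (by simp)
    rw [mem_singleton] at h1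
    subst h1
    simp only [mem_sdiff, mem_singleton] at h3
    obtain ⟨h, k1, k2, -⟩ := hT.cyc hE hC hCE he h3.1 (Ne.symm h3.2) h2 h4
    exact ⟨h, k1, k2⟩

section fam
variable {E C : Finset (Sym2 V)} {ι : Type} [Fintype ι] {f : ι → Vec V}

lemma nz_cast (a : ZMod 2) : ((nz a : ℕ) : ZMod 2) = a := by revert a; decide

lemma nz_sum (S : Finset ι) (e : Sym2 V) :
    ((∑ i ∈ S, nz (f i e) : ℕ) : ZMod 2) = (∑ i ∈ S, f i) e := by
  rw [Nat.cast_sum, Finset.sum_apply]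
  exact sum_congr rfl fun i _ => nz_cast _

lemma nz_pos {S : Finset ι} {e : Sym2 V} {i : ι} (hi : i ∈ S) (h : f i e ≠ 0) :
    1 ≤ ∑ i ∈ S, nz (f i e) := by
  refine le_trans ?_ (single_le_sum (f := fun i => nz (f i e)) (fun _ _ => Nat.zero_le _) hi)
  simp [nz, h]

lemma nz_sum_zero {S : Finset ι} {e : Sym2 V} (h : ∑ i ∈ S, nz (f i e) = 0) :
    ∀ i ∈ S, f i e = 0 := by
  intro i hi
  by_contra hne
  have := nz_pos hi hne
  omega

lemma sum_zero_of {S : Finset ι} {e : Sym2 V} (h : ∀ i ∈ S, f i e = 0) :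
    (∑ i ∈ S, f i) e = 0 := by
  rw [Finset.sum_apply]; exact sum_eq_zero h

lemma nz_split (S : Finset ι) (e : Sym2 V) :
    ∑ i, nz (f i e) = ∑ i ∈ S, nz (f i e) + ∑ i ∈ Sᶜ, nz (f i e) := (sum_add_sum_compl _ _).symm

lemma side (hT : T2 E C) (hE : LL E) (hC : Circ C) (hCE : C ⊆ E) (hf : ∀ i, f i ∈ Zc E)
    (hs : ∀ z ∈ Zc E, z ∈ Submodule.span (ZMod 2) (Set.range f)) (S : Finset ι) {z : V}
    (hz : ∀ e ∈ E, z ∈ e → (∀ i ∈ S, f i e = 0) ∨ (∀ i ∈ Sᶜ, f i e = 0)) {p q : Sym2 V}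
    (hzp : z ∈ p) (hzq : z ∈ q) {i j : ι} (hi : i ∈ S) (hj : j ∈ Sᶜ)
    (hip : f i p ≠ 0) (hjq : f j q ≠ 0) : False := by
  have hp : p ∈ E := by by_contra h; exact hip ((hf i).1 p h)
  have hq : q ∈ E := by by_contra h; exact hjq ((hf j).1 q h)
  have hp' := (hz p hp hzp).resolve_left fun h => hip (h i hi)
  have hq' := (hz q hq hzq).resolve_right fun h => hjq (h j hj)
  have hpq : p ≠ q := by rintro rfl; exact hip (hq' i hi)
  obtain ⟨h, h1, h2, h3, h4⟩ := hT.cyc hE hC hCE hp hq hpq hzp hzq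
  obtain ⟨c, hc⟩ := (Submodule.mem_span_range_iff_exists_fun _).1 (hs h h1)
  let hS : Vec V := ∑ i ∈ S, c i • f i
  have hsplit : ∀ e, h e = hS e + (∑ i ∈ Sᶜ, c i • f i) e := by
    intro e
    rw [← hc, ← sum_add_sum_compl S]; rfl
  have e1 : ∀ e, (∀ i ∈ S, f i e = 0) → hS e = 0 := by
    intro e he
    apply sum_zero_of (f := fun i => c i • f i)
    intro i hi; simp [he i hi]
  have e2 : ∀ e, (∀ i ∈ Sᶜ, f i e = 0) → hS e = h e := by
    intro e he
    rw [hsplit, sum_zero_of (f := fun i => c i • f i), add_zero]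
    intro i hi; simp [he i hi]
  have hSZ : hS ∈ Zc E := Submodule.sum_mem _ fun i _ => Submodule.smul_mem _ _ (hf i)
  obtain ⟨e, k1, k2, k3, k4⟩ := next_edge hSZ (by rw [e2 p hp']; exact h2) hzp
  rcases hz e k1 k3 with h5 | h5
  · exact k4 (e1 e h5)
  · rw [e2 e h5] at k4
    rcases h4 e k3 k4 with rfl | rfl
    · exact k2 rfl
    · exact hjq (h5 j hj)

end fam

def Fac (E C : Finset (Sym2 V)) : Prop :=
  ∃ (ι : Type) (_ : Fintype ι) (f : ι → Vec V), (∀ i, f i ∈ Zc E) ∧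
    (∀ z ∈ Zc E, z ∈ Submodule.span (ZMod 2) (Set.range f)) ∧
    (∀ e, ∑ i, nz (f i e) + nz (ind C e) ≤ 2) ∧ ∑ i, f i = ind C

lemma ind_pos {C : Finset (Sym2 V)} {e : Sym2 V} (h : e ∈ C) : ind C e = 1 := by simp [ind, h]
lemma ind_neg {C : Finset (Sym2 V)} {e : Sym2 V} (h : e ∉ C) : ind C e = 0 := by simp [ind, h]

lemma nat_cast_z2 {n : ℕ} (h : ((n : ℕ) : ZMod 2) = 0) : n % 2 = 0 := by
  rw [ZMod.natCast_eq_zero_iff] at h; omega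
lemma nat_cast_z2' {n : ℕ} (h : ((n : ℕ) : ZMod 2) = 1) : n % 2 = 1 := by
  have : ((n + 1 : ℕ) : ZMod 2) = 0 := by rw [Nat.cast_add, h]; rfl
  have := nat_cast_z2 this
  omega

lemma Fac_single {E C : Finset (Sym2 V)} (hE : LL E) (hP : Pl E) (hT : T2 E C) (hC : Circ C)
    (hCE : C ⊆ E) (hone : ∀ e ∈ E \ C, ∀ e' ∈ E \ C, Br E C e e') : Fac E C := by
  obtain ⟨ι, _, f, hf, hs, hcnt, hsum⟩ := Pl_norm hP
  simp only [card_nz] at hcnt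
  rw [span_iff] at hs
  obtain ⟨c, hc⟩ := (Submodule.mem_span_range_iff_exists_fun _).1 (hs _ (Zc_mono hCE hC.ind_mem))
  have hS : ∃ S : Finset ι, ∑ i ∈ S, f i = ind C := by
    refine ⟨univ.filter fun i => c i = 1, ?_⟩
    rw [← hc, sum_filter]
    refine sum_congr rfl fun i _ => ?_
    rcases z2 (c i) with h | h <;> simp [h]
  have hcomp : ∀ S : Finset ι, ∑ i ∈ S, f i = ind C → ∑ i ∈ Sᶜ, f i = ind C := by
    intro S h
    rw [← sum_add_sum_compl S, h] at hsum
    calc ∑ i ∈ Sᶜ, f i = (ind C + ind C) + ∑ i ∈ Sᶜ, f i := by rw [vself, zero_add]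
      _ = ind C := by rw [add_assoc, hsum, add_zero]
  have hcov : ∀ e ∈ E, ∃ i, f i e ≠ 0 := by
    intro e he
    obtain ⟨h, h1, h2⟩ := hT.cov hE hC hCE he
    by_contra hcon
    push Not at hcon
    obtain ⟨d, hd⟩ := (Submodule.mem_span_range_iff_exists_fun _).1 (hs h h1)
    apply h2
    rw [← hd]
    apply sum_zero_of (f := fun i => d i • f i)
    intro i _; simp [hcon i]
  -- dichotomy off `C`
  have hdich : ∀ S : Finset ι, ∑ i ∈ S, f i = ind C → ∀ e, e ∉ C →
      (∀ i ∈ S, f i e = 0) ∨ (∀ i ∈ Sᶜ, f i e = 0) := by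
    intro S h e he
    have a1 := nz_sum (f := f) S e
    have a2 := nz_sum (f := f) Sᶜ e
    rw [h, ind_neg he] at a1
    rw [hcomp S h, ind_neg he] at a2
    have a3 := nz_split (f := f) S e
    have a4 := hcnt e
    have := nat_cast_z2 a1
    have := nat_cast_z2 a2
    by_cases h0 : ∑ i ∈ S, nz (f i e) = 0
    · exact Or.inl (nz_sum_zero h0)
    · exact Or.inr (nz_sum_zero (by omega))
  -- main
  have main : ∀ S : Finset ι, ∑ i ∈ S, f i = ind C → (∀ e ∈ E \ C, ∀ i ∈ Sᶜ, f i e = 0) → Fac E C := by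
    intro S h hall
    refine ⟨ι, inferInstance, fun i => if i ∈ S then f i else 0, ?_, ?_, ?_, ?_⟩
    · intro i
      by_cases hi : i ∈ S
      · simpa [hi] using hf i
      · simp [hi]
    · intro z hz
      refine Submodule.span_le.2 ?_ (hs z hz)
      have hmem : ∀ i ∈ S, f i ∈ Submodule.span (ZMod 2) (Set.range fun i => if i ∈ S then f i else 0) :=
        fun i hi => Submodule.subset_span ⟨i, by simp [hi]⟩
      rintro _ ⟨i, rfl⟩
      by_cases hi : i ∈ S
      · exact hmem i hi
      · have hfC : f i ∈ Zc C := Zc_of_spt hCE (hf i) fun e he => by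
          by_cases heE : e ∈ E
          · exact hall e (mem_sdiff.2 ⟨heE, he⟩) i (by simpa using hi)
          · exact (hf i).1 e heE
        rcases hC.Zc_cases hfC with h0 | h1
        · rw [h0]; exact Submodule.zero_mem _
        · rw [h1, ← h]; exact Submodule.sum_mem _ hmem
    · intro e
      have hg : ∑ i, nz ((if i ∈ S then f i else 0 : Vec V) e) = ∑ i ∈ S, nz (f i e) := by
        rw [← sum_add_sum_compl S, sum_congr rfl (g := fun i => nz (f i e))
          (fun i hi => by rw [if_pos hi])]
        rw [sum_eq_zero (s := Sᶜ), add_zero]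
        intro i hi
        rw [if_neg (by simpa using hi)]; rfl
      rw [hg]
      have a3 := nz_split (f := f) S e
      have a4 := hcnt e
      by_cases he : e ∈ C
      · have a2 := nz_sum (f := f) Sᶜ e
        rw [hcomp S h, ind_pos he] at a2
        have := nat_cast_z2' a2
        rw [ind_pos he, nz_one]; omega
      · rw [ind_neg he, nz_zero]; omega
    · rw [← h, ← sum_add_sum_compl S, sum_congr rfl (g := f) (fun i hi => by rw [if_pos hi]),
        sum_eq_zero (s := Sᶜ), add_zero]
      intro i hi
      rw [if_neg (by simpa using hi)]
  obtain ⟨S, hS⟩ := hS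
  by_cases hA : ∃ e ∈ E \ C, ∃ i ∈ S, f i e ≠ 0
  · refine main S hS fun e' he' => ?_
    obtain ⟨e, he, hi⟩ := hA
    have hb := hone e he e' he'
    have hside : ∃ i ∈ S, f i e' ≠ 0 := by
      clear he'
      induction hb with
      | refl => exact hi
      | @tail b d _ hst ih =>
        obtain ⟨k1, k2, v, k3, k4, k5⟩ := hst
        obtain ⟨i, hi, hib⟩ := ih
        obtain ⟨j, hj⟩ := hcov d (mem_sdiff.1 k2).1
        by_cases hjS : j ∈ S
        · exact ⟨j, hjS, hj⟩
        · refine (side hT hE hC hCE hf hs S (z := v) ?_ k4 k5 hi (by simpa using hjS) hib hj).elim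
          intro e _ hve
          exact hdich S hS e fun h => k3 ⟨e, h, hve⟩
    obtain ⟨i, hi, hie⟩ := hside
    exact (hdich S hS e' (mem_sdiff.1 he').2).resolve_left fun h => hie (h i hi)
  · push Not at hA
    refine main Sᶜ (hcomp S hS) fun e he i hi => hA e he i (by simpa using hi)

end
end PB

namespace PB
section
open Classical Finset
variable {V : Type} {E E1 E2 C P1 P2 : Finset (Sym2 V)} {x y : V}

lemma Circ.rch (hC : Circ C) {r v : V} (hr : r ∈ vs C) (hv : v ∈ vs C) :
    Relation.ReflTransGen (fun x y => s(x,y) ∈ C) r v := by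
  by_cases h : r = v
  · subst h; exact .refl
  · obtain ⟨P1, P2, hs⟩ := hC.spl hr hv h
    exact Relation.ReflTransGen.mono (fun a b h => hs.sub1 h.1) _ _ hs.p1.rch

/-- degree correction inside a circuit -/
lemma Circ.correct (hC : Circ C) (hE : LL E) {h : Vec V}
    (h0 : ∀ v, v ∉ vs C → dg E h v = 0) : ∃ k, Spt C k ∧ ∀ v, dg C k v = dg E h v := by
  obtain ⟨r, hr⟩ : ∃ r, r ∈ vs C := by
    obtain ⟨a, b, P1, P2, hs⟩ := hC
    exact ⟨a, vs_mono hs.sub1 hs.p1.left_mem⟩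
  have hk : ∀ v, ∃ k : Vec V, Spt C k ∧ (v ∈ vs C → ∀ w, dg C k w = dl r w + dl v w) := by
    intro v
    by_cases hv : v ∈ vs C
    · obtain ⟨k, h1, h2⟩ := tjoin hC.isLL (hC.rch hr hv)
      exact ⟨k, h1, fun _ => h2⟩
    · exact ⟨0, fun _ _ => rfl, fun h => absurd h hv⟩
  choose k hk1 hk2 using hk
  set U := (vs_finite E).toFinset with hU
  have hsum : ∑ v ∈ U, dg E h v = 0 := by
    rw [handshake hE]
    refine sum_eq_zero fun e he => if_neg ?_
    rintro ⟨-, v, hv, hvU⟩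
    exact hvU ((Set.Finite.mem_toFinset _).2 ⟨e, he, hv⟩)
  refine ⟨∑ v ∈ U, dg E h v • k v, ?_, fun w => ?_⟩
  · intro e he
    rw [Finset.sum_apply]
    refine sum_eq_zero fun v _ => ?_
    simp [hk1 v e he]
  · rw [dg_sum]
    have : ∀ v ∈ U, dg C (dg E h v • k v) w = dg E h v * dl r w + dg E h v * dl v w := by
      intro v _
      rw [dg_smul]
      by_cases hv : v ∈ vs C
      · rw [hk2 v hv, mul_add]
      · rw [h0 v hv]; simp
    rw [sum_congr rfl this, sum_add_distrib, ← sum_mul, hsum, zero_mul, zero_add]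
    by_cases hw : w ∈ U
    · rw [sum_eq_single w]
      · simp [dl]
      · intro b _ hb; simp [dl, Ne.symm hb]
      · intro h; exact absurd hw h
    · rw [dg_not_mem (E := E) fun h => hw ((Set.Finite.mem_toFinset _).2 h)]
      refine sum_eq_zero fun v hv => ?_
      have : w ≠ v := by rintro rfl; exact hw hv
      simp [dl, this]

lemma Zc_split (hC : Circ C) (h1 : LL E1) (hC1 : C ⊆ E1) (hC2 : C ⊆ E2)
    (hv : ∀ v ∈ vs E1, v ∈ vs E2 → v ∈ vs C) {z : Vec V} (hz : z ∈ Zc (E1 ∪ E2)) :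
    ∃ a ∈ Zc E1, ∃ b ∈ Zc E2, z = a + b := by
  set h : Vec V := fun e => if e ∈ E1 ∧ e ∉ C then z e else 0 with hh
  have hs : Spt E1 h := fun e he => by simp [hh, he]
  obtain ⟨k, hk, hkd⟩ := hC.correct h1 (h := h) (by
    intro v hvC
    by_cases hvE : v ∈ vs E1
    · rw [← dg_mono (E' := E1 ∪ E2) subset_union_left hs, ← hz.2 v]
      refine dg_congr fun e he hve => ?_
      have he1 : e ∈ E1 := (mem_union.1 he).resolve_right fun h2 => hvC (hv v hvE ⟨e, h2, hve⟩)
      have : e ∉ C := fun h => hvC ⟨e, h, hve⟩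
      simp [hh, he1, this]
    · exact dg_not_mem hvE)
  have hk1 : Spt E1 k := fun e he => hk e fun h => he (hC1 h)
  have ha : h + k ∈ Zc E1 := by
    refine ⟨fun e he => by simp [hs e he, hk1 e he], fun v => ?_⟩
    rw [dg_add, dg_mono hC1 hk, hkd, z2self]
  refine ⟨h + k, ha, z + (h + k), ?_, ?_⟩
  · refine Zc_of_spt subset_union_right (Submodule.add_mem _ hz (Zc_mono subset_union_left ha)) ?_
    intro e he
    have hc : e ∉ C := fun h => he (hC2 h)
    by_cases he1 : e ∈ E1
    · simp [hh, he1, hc, hk e hc, z2self]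
    · simp [hh, he1, hk e hc, hz.1 e (by simp [he, he1])]
  · rw [add_left_comm, vself, add_zero]

lemma Fac.uniq {ι : Type} [Fintype ι] {f : ι → Vec V} {e0 : Sym2 V}
    (h : ∑ i, nz (f i e0) ≤ 1) {a i : ι} (ha : f a e0 ≠ 0) (hia : i ≠ a) : f i e0 = 0 := by
  by_contra hi
  have h2 : ∑ j ∈ {a, i}, nz (f j e0) ≤ ∑ j, nz (f j e0) :=
    sum_le_sum_of_subset (subset_univ _)
  rw [sum_pair hia.symm] at h2
  have n1 : nz (f a e0) = 1 := by rw [z2ne ha, nz_one]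
  have n2 : nz (f i e0) = 1 := by rw [z2ne hi, nz_one]
  omega

/-- the distinguished member of the facial family along the free side -/
lemma Fac.free {ι : Type} [Fintype ι] {f : ι → Vec V} (hsp : Spl C x y P1 P2) (hCE : C ⊆ E)
    (hv : ∀ v ∈ vs (E \ C), v ∈ vs C → v ∈ vs P1) (hf : ∀ i, f i ∈ Zc E)
    (hcnt : ∀ e, ∑ i, nz (f i e) + nz (ind C e) ≤ 2) (hsum : ∑ i, f i = ind C) :
    ∃ a, ∀ e ∈ P2, f a e = 1 ∧ ∀ i, i ≠ a → f i e = 0 := by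
  obtain ⟨e0, he0⟩ := hsp.p2.nonempty
  have hconst : ∀ i, ∃ c, ∀ e ∈ P2, f i e = c := by
    intro i
    apply hsp.p2.const
    intro v hvx hvy
    by_cases hv2 : v ∈ vs P2
    · rw [← (hf i).2 v]
      have hv1 : v ∉ vs P1 := fun h => (hsp.vx v h hv2).elim hvx hvy
      refine sum_subset (hsp.sub2.trans hCE) fun e he he2 => if_neg fun hve => hv1 ?_
      by_cases heC : e ∈ C
      · rw [hsp.un, mem_union] at heC
        exact ⟨e, heC.resolve_right he2, hve⟩
      · exact hv v ⟨e, by simp [he, heC], hve⟩ (vs_mono hsp.sub2 hv2)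
    · exact dg_not_mem hv2
  have hc1 : ∑ i, nz (f i e0) ≤ 1 := by
    have := hcnt e0
    rw [ind_pos (hsp.sub2 he0), nz_one] at this
    omega
  obtain ⟨a, ha⟩ : ∃ a, f a e0 ≠ 0 := by
    by_contra hcon
    push Not at hcon
    have : (∑ i, f i) e0 = 0 := sum_zero_of fun i _ => hcon i
    rw [hsum, ind_pos (hsp.sub2 he0)] at this
    exact one_ne_zero this
  refine ⟨a, fun e he => ⟨?_, fun i hi => ?_⟩⟩
  · obtain ⟨c, hc⟩ := hconst a
    rw [hc e he, ← hc e0 he0]; exact z2ne ha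
  · obtain ⟨c, hc⟩ := hconst i
    rw [hc e he, ← hc e0 he0]; exact Fac.uniq hc1 ha hi

theorem Fac_lens (hsp : Spl C x y P1 P2) (hL1 : LL E1) (hC1 : C ⊆ E1) (hC2 : C ⊆ E2)
    (hint : E1 ∩ E2 = C) (hv : ∀ v ∈ vs E1, v ∈ vs E2 → v ∈ vs C)
    (hv1 : ∀ v ∈ vs (E1 \ C), v ∈ vs C → v ∈ vs P1)
    (hv2 : ∀ v ∈ vs (E2 \ C), v ∈ vs C → v ∈ vs P2) (hF1 : Fac E1 C) (hF2 : Fac E2 C) :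
    Fac (E1 ∪ E2) C := by
  have hC : Circ C := ⟨_, _, _, _, hsp⟩
  obtain ⟨ι1, _, f1, hf1, hs1, hcnt1, hsum1⟩ := hF1
  obtain ⟨ι2, _, f2, hf2, hs2, hcnt2, hsum2⟩ := hF2
  obtain ⟨a, ha⟩ := Fac.free hsp hC1 hv1 hf1 hcnt1 hsum1
  obtain ⟨b, hb⟩ := Fac.free hsp.swap hC2 hv2 hf2 hcnt2 hsum2
  set K := f1 a + f2 b + ind C with hK
  let g : (ι1 ⊕ ι2) ⊕ Unit → Vec V := fun t =>
    Sum.elim (Sum.elim (fun i => if i = a then 0 else f1 i) (fun j => if j = b then 0 else f2 j))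
      (fun _ => K) t
  have e1 : ∑ i, (if i = a then 0 else f1 i) = f1 a + ind C := by
    rw [← hsum1, ← add_sum_erase _ _ (mem_univ a), ← add_sum_erase _ f1 (mem_univ a), if_pos rfl,
      zero_add, ← add_assoc, vself, zero_add]
    exact sum_congr rfl fun i hi => if_neg (ne_of_mem_erase hi)
  have e2 : ∑ i, (if i = b then 0 else f2 i) = f2 b + ind C := by
    rw [← hsum2, ← add_sum_erase _ _ (mem_univ b), ← add_sum_erase _ f2 (mem_univ b), if_pos rfl,
      zero_add, ← add_assoc, vself, zero_add]
    exact sum_congr rfl fun i hi => if_neg (ne_of_mem_erase hi)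
  have hgsum : ∑ t, g t = ind C := by
    simp only [g, Fintype.sum_sum_type, Sum.elim_inl, Sum.elim_inr, univ_unique, sum_singleton]
    rw [e1, e2, hK]
    have : f1 a + ind C + (f2 b + ind C) + (f1 a + f2 b + ind C) =
      (f1 a + f1 a) + (f2 b + f2 b) + (ind C + ind C) + ind C := by abel
    rw [this]; simp [vself]
  have hin : ind C ∈ Submodule.span (ZMod 2) (Set.range g) := by
    rw [← hgsum]
    exact Submodule.sum_mem _ fun t _ => Submodule.subset_span ⟨t, rfl⟩
  have hin1 : ∀ i, f1 i ∈ Submodule.span (ZMod 2) (Set.range g) := by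
    intro i
    by_cases hi : i = a
    · subst hi
      have : f1 i = (∑ j, if j = i then 0 else f1 j) + ind C := by
        rw [e1, add_assoc, vself, add_zero]
      rw [this]
      refine Submodule.add_mem _ (Submodule.sum_mem _ fun t _ => ?_) hin
      exact Submodule.subset_span ⟨.inl (.inl t), rfl⟩
    · exact Submodule.subset_span ⟨.inl (.inl i), by simp [g, hi]⟩
  have hin2 : ∀ i, f2 i ∈ Submodule.span (ZMod 2) (Set.range g) := by
    intro i
    by_cases hi : i = b
    · subst hi
      have : f2 i = (∑ j, if j = i then 0 else f2 j) + ind C := by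
        rw [e2, add_assoc, vself, add_zero]
      rw [this]
      refine Submodule.add_mem _ (Submodule.sum_mem _ fun t _ => ?_) hin
      exact Submodule.subset_span ⟨.inl (.inr t), rfl⟩
    · exact Submodule.subset_span ⟨.inl (.inr i), by simp [g, hi]⟩
  refine ⟨_, inferInstance, g, ?_, ?_, ?_, hgsum⟩
  · have z1 : ∀ i, f1 i ∈ Zc (E1 ∪ E2) := fun i => Zc_mono subset_union_left (hf1 i)
    have z2 : ∀ i, f2 i ∈ Zc (E1 ∪ E2) := fun i => Zc_mono subset_union_right (hf2 i)
    have z3 : ind C ∈ Zc (E1 ∪ E2) := Zc_mono (hC1.trans subset_union_left) hC.ind_mem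
    rintro ((i | i) | i)
    · by_cases hi : i = a
      · simp [g, hi]
      · simpa [g, hi] using z1 i
    · by_cases hi : i = b
      · simp [g, hi]
      · simpa [g, hi] using z2 i
    · exact Submodule.add_mem _ (Submodule.add_mem _ (z1 a) (z2 b)) z3
  · intro z hz
    obtain ⟨p, hp, q, hq, rfl⟩ := Zc_split hC hL1 hC1 hC2 hv hz
    refine Submodule.add_mem _ ?_ ?_
    · exact Submodule.span_le.2 (by rintro _ ⟨i, rfl⟩; exact hin1 i) (hs1 p hp)
    · exact Submodule.span_le.2 (by rintro _ ⟨i, rfl⟩; exact hin2 i) (hs2 q hq)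
  · intro e
    have n1 : ∑ i, nz ((if i = a then (0 : Vec V) else f1 i) e) + nz (f1 a e) = ∑ i, nz (f1 i e) := by
      rw [← add_sum_erase _ _ (mem_univ a), ← add_sum_erase _ (fun i => nz (f1 i e)) (mem_univ a),
        if_pos rfl, add_comm]
      simp only [Pi.zero_apply, nz_zero, zero_add]
      congr 1
      exact sum_congr rfl fun i hi => by rw [if_neg (ne_of_mem_erase hi)]
    have n2 : ∑ i, nz ((if i = b then (0 : Vec V) else f2 i) e) + nz (f2 b e) = ∑ i, nz (f2 i e) := by
      rw [← add_sum_erase _ _ (mem_univ b), ← add_sum_erase _ (fun i => nz (f2 i e)) (mem_univ b),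
        if_pos rfl, add_comm]
      simp only [Pi.zero_apply, nz_zero, zero_add]
      congr 1
      exact sum_congr rfl fun i hi => by rw [if_neg (ne_of_mem_erase hi)]
    simp only [g, Fintype.sum_sum_type, Sum.elim_inl, Sum.elim_inr, univ_unique, sum_singleton, hK,
      Pi.add_apply]
    have c1 := hcnt1 e
    have c2 := hcnt2 e
    by_cases heC : e ∈ C
    · rw [ind_pos heC] at c1 c2 ⊢
      rw [nz_one] at *
      rw [hsp.un, mem_union] at heC
      rcases heC with he | he
      · have : f1 a e + f2 b e + 1 = f1 a e := by
          rw [(hb e he).1, add_assoc, z2self, add_zero]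
        rw [this]
        have : ∑ i, nz ((if i = b then (0 : Vec V) else f2 i) e) = 0 := by
          refine sum_eq_zero fun i _ => ?_
          split_ifs with h
          · simp
          · rw [(hb e he).2 i h, nz_zero]
        omega
      · have : f1 a e + f2 b e + 1 = f2 b e := by
          rw [(ha e he).1, add_comm, ← add_assoc, z2self, zero_add]
        rw [this]
        have : ∑ i, nz ((if i = a then (0 : Vec V) else f1 i) e) = 0 := by
          refine sum_eq_zero fun i _ => ?_
          split_ifs with h
          · simp
          · rw [(ha e he).2 i h, nz_zero]
        omega
    · rw [ind_neg heC] at c1 c2 ⊢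
      rw [nz_zero, add_zero] at *
      by_cases he1 : e ∈ E1
      · have he2 : e ∉ E2 := fun h => heC (by rw [← hint]; simp [he1, h])
        have : ∑ i, nz (f2 i e) = 0 := sum_eq_zero fun i _ => by rw [(hf2 i).1 e he2, nz_zero]
        rw [(hf2 b).1 e he2, add_zero, add_zero]
        omega
      · have : ∑ i, nz (f1 i e) = 0 := sum_eq_zero fun i _ => by rw [(hf1 i).1 e he1, nz_zero]
        rw [(hf1 a).1 e he1, zero_add, add_zero]
        omega
end
end PB

namespace PB
section
open Classical Finset
variable {V : Type} {E C P1 P2 : Finset (Sym2 V)} {x y : V}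

lemma Spl.drop (h : Spl C x y P1 P2) {A : Set V} (hA : A ⊆ vs P2) (hx : x ∉ A)
    (h2 : ∃ v ∈ A, ∃ w ∈ A, v ≠ w) :
    ∃ w Q1 Q2, Spl C w y Q1 Q2 ∧ vs P1 ⊆ vs Q1 ∧ A ⊆ vs Q2 ∧ #Q2 < #P2 := by
  obtain ⟨p1, p2, un, dj, vx⟩ := h
  cases p2 with
  | single hne =>
    exfalso
    obtain ⟨v, hv, w, hw, hvw⟩ := h2
    have h1 : ∀ v ∈ A, v = y := fun v hv =>
      (vs_single.1 (hA hv)).resolve_left fun h => hx (h ▸ hv)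
    exact hvw ((h1 v hv).trans (h1 w hw).symm)
  | @cons _ w _ P hP hxP =>
    have hn : s(x,w) ∉ P := fun h => hxP ⟨_, h, by simp⟩
    have hwx : w ≠ x := by rintro rfl; exact hxP hP.left_mem
    have hwy : w ≠ y := hP.ne
    have hw1 : w ∉ vs P1 := fun h =>
      (vx w h (vs_insert.2 (Or.inr (Or.inl rfl)))).elim hwx hwy
    refine ⟨w, insert s(w,x) P1, P, ⟨.cons p1 hw1, hP, ?_, ?_, ?_⟩, vs_mono (subset_insert _ _), ?_, ?_⟩
    · rw [un, Sym2.eq_swap]; ext e; simp only [mem_union, mem_insert]; tauto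
    · rw [Sym2.eq_swap]
      rw [disjoint_insert_left]
      exact ⟨hn, dj.mono_right (subset_insert _ _)⟩
    · intro v hv hvP
      rcases vs_insert.1 hv with h | h | h
      · exact Or.inl h
      · exact absurd (h ▸ hvP) hxP
      · rcases vx v h (vs_mono (subset_insert _ _) hvP) with h | h
        · exact absurd (h ▸ hvP) hxP
        · exact Or.inr h
    · intro v hv
      rcases vs_insert.1 (hA hv) with h | h | h
      · exact absurd (h ▸ hv) hx
      · rw [h]; exact hP.left_mem
      · exact h
    · rw [card_insert_of_notMem hn]; omega

lemma ind_inj {P Q : Finset (Sym2 V)} (h : ind P = ind Q) : P = Q := by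
  ext e
  have := congrFun h e
  simp only [ind] at this
  by_cases h1 : e ∈ P <;> by_cases h2 : e ∈ Q <;> simp [h1, h2] at this ⊢

lemma ind_union {P Q : Finset (Sym2 V)} (h : Disjoint P Q) : ind (P ∪ Q) = ind P + ind Q := by
  ext e
  simp only [ind, mem_union, Pi.add_apply]
  by_cases h1 : e ∈ P
  · have : e ∉ Q := disjoint_left.1 h h1
    simp [h1, this]
  · simp [h1]

lemma Spl.path_eq (h : Spl C x y P1 P2) {Q : Finset (Sym2 V)} (hQ : Q ⊆ C) (hp : Pth x y Q) :
    Q = P1 ∨ Q = P2 := by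
  have hC : Circ C := ⟨_, _, _, _, h⟩
  have hz : ind Q + ind P1 ∈ Zc C := by
    refine ⟨fun e he => ?_, fun v => ?_⟩
    · rw [Pi.add_apply, ind_neg fun h' => he (hQ h'), ind_neg fun h' => he (h.sub1 h'), add_zero]
    · rw [dg_add, dg_mono hQ (ind_spt (subset_refl _)), dg_mono h.sub1 (ind_spt (subset_refl _)),
        hp.dg_ind, h.p1.dg_ind, z2self]
  rcases hC.Zc_cases hz with h0 | h1
  · left
    apply ind_inj
    calc ind Q = (ind Q + ind P1) + ind P1 := by rw [add_assoc, vself, add_zero]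
      _ = _ := by rw [h0, zero_add]
  · right
    apply ind_inj
    rw [h.un, ind_union h.dj] at h1
    calc ind Q = (ind Q + ind P1) + ind P1 := by rw [add_assoc, vself, add_zero]
      _ = _ := by rw [h1, add_comm, ← add_assoc, vself, zero_add]

/-- a set with a pair of attachments at the ends confines the other bridges -/
lemma Spl.confine (h : Spl C x y P1 P2) {u w : V} {Q1 Q2 : Finset (Sym2 V)} (h' : Spl C u w Q1 Q2)
    (hx : x ∈ vs Q2) (hy : y ∈ vs Q2) {K : Set V} (hK : K ⊆ vs Q1) : K ⊆ vs P1 ∨ K ⊆ vs P2 := by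
  obtain ⟨Q, hQ, hp, hends⟩ := h'.p2.sub hx hy h.p1.ne
  have aux : ∀ {P1 P2}, Spl C x y P1 P2 → Q = P1 → K ⊆ vs P2 := by
    intro P1 P2 h e v hv
    subst e
    have hvC : v ∈ vs C := vs_mono h'.sub1 (hK hv)
    rw [h.vsu] at hvC
    rcases hvC with hv1 | hv2
    · rcases hends v hv1 (h'.vx v (hK hv) (vs_mono hQ hv1)) with rfl | rfl
      · exact h.p2.left_mem
      · exact h.p2.right_mem
    · exact hv2
  rcases h.path_eq (hQ.trans h'.sub2) hp with e | e
  · exact Or.inr (aux h e)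
  · exact Or.inl (aux h.swap e)

/-- two attachments -/
lemma T2.att (hT : T2 E C) {e : Sym2 V} (he : e ∈ E \ C) :
    ∃ v ∈ att E C e, ∃ w ∈ att E C e, v ≠ w := by
  obtain ⟨v, w, hvw, hv, hv', hw, hw'⟩ := hT ((E \ C).filter fun f => Br E C e f)
    (filter_subset _ _) ⟨e, by simpa using ⟨by simpa using he, Br.refl⟩⟩
  have key : ∀ v, v ∈ vs ((E \ C).filter fun f => Br E C e f) →
      v ∈ vs (E \ (E \ C).filter fun f => Br E C e f) → v ∈ PB.att E C e := by
    rintro v ⟨f, hf, hvf⟩ ⟨g, hg, hvg⟩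
    rw [mem_filter] at hf
    refine ⟨?_, f, hf.2, hvf⟩
    by_contra hvC
    rw [mem_sdiff, mem_filter] at hg
    have hgC : g ∉ C := fun h => hvC ⟨g, h, hvg⟩
    have hg' : g ∈ E \ C := mem_sdiff.2 ⟨hg.1, hgC⟩
    exact hg.2 ⟨hg', hf.2.trans (Br.step hf.1 hg' hvC hvf hvg)⟩
  exact ⟨v, key v hv hv', w, key w hw hw', hvw⟩

lemma closed_inherit {X : Finset (Sym2 V)} (hX : X ⊆ E \ C)
    (hcl : ∀ f ∈ X, ∀ g, Br E C f g → g ∈ X) (hG : Good E C) (hT : T2 E C) (hCE : C ⊆ E) :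
    Good (C ∪ X) C ∧ T2 (C ∪ X) C ∧ (C ∪ X) \ C = X := by
  have hsub : C ∪ X ⊆ E := union_subset hCE (hX.trans sdiff_subset)
  have hXe : (C ∪ X) \ C = X := by
    ext f
    simp only [mem_sdiff, mem_union]
    constructor
    · tauto
    · intro h; exact ⟨Or.inr h, (mem_sdiff.1 (hX h)).2⟩
  refine ⟨⟨fun e he => hG.1 e (hsub he), Pl_mono hsub hG.2.1, ?_⟩, ?_, hXe⟩
  · intro f hf g hg hfg
    rw [hXe] at hf hg
    have hbr : ∀ g, Br E C f g → Br (C ∪ X) C f g := by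
      intro g h
      induction h with
      | refl => exact .refl
      | @tail a b hfa hs ih =>
        refine .tail ih ⟨?_, ?_, hs.2.2⟩
        · rw [hXe]; exact hcl f hf _ hfa
        · rw [hXe]; exact hcl f hf _ (.tail hfa hs)
    obtain ⟨x, y, P1, P2, h1, h2, h3⟩ := hG.2.2 f (hX hf) g (hX hg) fun h => hfg (hbr g h)
    refine ⟨x, y, P1, P2, h1, ?_, ?_⟩
    · rintro v ⟨hv, k, hk, hvk⟩; exact h2 ⟨hv, k, hk.mono hsub, hvk⟩
    · rintro v ⟨hv, k, hk, hvk⟩; exact h3 ⟨hv, k, hk.mono hsub, hvk⟩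
  · intro Y hY hYn
    rw [hXe] at hY
    obtain ⟨v, w, hvw, hv, hv', hw, hw'⟩ := hT Y (hY.trans hX) hYn
    have key : ∀ v, v ∈ vs Y → v ∈ vs (E \ Y) → v ∈ vs ((C ∪ X) \ Y) := by
      rintro v ⟨f, hf, hvf⟩ ⟨g, hg, hvg⟩
      by_cases hvC : v ∈ vs C
      · obtain ⟨c, hc, hvc⟩ := hvC
        exact ⟨c, mem_sdiff.2 ⟨mem_union_left _ hc, fun h => (mem_sdiff.1 (hX (hY h))).2 hc⟩, hvc⟩
      · rw [mem_sdiff] at hg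
        have hg' : g ∈ E \ C := mem_sdiff.2 ⟨hg.1, fun h => hvC ⟨g, h, hvg⟩⟩
        exact ⟨g, mem_sdiff.2 ⟨mem_union_right _
          (hcl f (hY hf) g (Br.step (hX (hY hf)) hg' hvC hvf hvg)), hg.2⟩, hvg⟩
    exact ⟨v, w, hvw, hv, key v hv hv', hw, key w hw hw'⟩

theorem Fac_all (hC : Circ C) (hCE : C ⊆ E) (hG : Good E C) (hT : T2 E C) : Fac E C := by
  induction hn : #(E \ C) using Nat.strong_induction_on generalizing E with
  | _ n ih =>
  by_cases hone : ∀ e ∈ E \ C, ∀ e' ∈ E \ C, Br E C e e'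
  · exact Fac_single hG.1 hG.2.1 hT hC hCE hone
  push Not at hone
  obtain ⟨e, he, e', he', hee⟩ := hone
  have hex : ∃ m, ∃ x y P1 P2, Spl C x y P1 P2 ∧ att E C e ⊆ vs P2 ∧
      (∃ e' ∈ E \ C, ¬ Br E C e e' ∧ att E C e' ⊆ vs P1) ∧ #P2 = m := by
    obtain ⟨x, y, P1, P2, h1, h2, h3⟩ := hG.2.2 e he e' he' hee
    exact ⟨_, x, y, P2, P1, h1.swap, h2, ⟨e', he', hee, h3⟩, rfl⟩
  obtain ⟨x, y, P1, P2, hsp, hM, ⟨e', he', hee, hK⟩, hmin⟩ := Nat.find_spec hex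
  have hleast := fun m (hm : m < #P2) => Nat.find_min hex (hmin ▸ hm)
  have hx : x ∈ att E C e := by
    by_contra hx
    obtain ⟨w, Q1, Q2, k1, k2, k3, k4⟩ := hsp.drop hM hx (hT.att he)
    exact hleast _ k4 ⟨w, y, Q1, Q2, k1, k3, ⟨e', he', hee, hK.trans k2⟩, rfl⟩
  have hy : y ∈ att E C e := by
    by_contra hy
    obtain ⟨w, Q1, Q2, k1, k2, k3, k4⟩ := hsp.symm.drop hM hy (hT.att he)
    exact hleast _ k4 ⟨w, x, Q1, Q2, k1, k3, ⟨e', he', hee, hK.trans k2⟩, rfl⟩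
  have hdich : ∀ k ∈ E \ C, ¬ Br E C e k → att E C k ⊆ vs P1 ∨ att E C k ⊆ vs P2 := by
    intro k hk hek
    obtain ⟨u, w, Q1, Q2, h1, h2, h3⟩ := hG.2.2 k hk e he fun h => hek h.symm
    exact hsp.confine h1 (h3 hx) (h3 hy) h2
  set X1 := (E \ C).filter fun k => ¬ Br E C e k ∧ att E C k ⊆ vs P1 with hX1
  set X2 := (E \ C).filter fun k => ¬ (¬ Br E C e k ∧ att E C k ⊆ vs P1) with hX2
  have hcong : ∀ f g, Br E C f g → ((¬ Br E C e f ∧ att E C f ⊆ vs P1) ↔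
      (¬ Br E C e g ∧ att E C g ⊆ vs P1)) := by
    intro f g h
    rw [att_congr h]
    have : Br E C e f ↔ Br E C e g := ⟨fun h' => h'.trans h, fun h' => h'.trans h.symm⟩
    rw [this]
  have hcl1 : ∀ f ∈ X1, ∀ g, Br E C f g → g ∈ X1 := by
    intro f hf g h
    rw [hX1, mem_filter] at hf ⊢
    exact ⟨h.mem hf.1, (hcong f g h).1 hf.2⟩
  have hcl2 : ∀ f ∈ X2, ∀ g, Br E C f g → g ∈ X2 := by
    intro f hf g h
    rw [hX2, mem_filter] at hf ⊢
    exact ⟨h.mem hf.1, fun h' => hf.2 ((hcong f g h).2 h')⟩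
  have hun : X1 ∪ X2 = E \ C := filter_union_filter_not_eq _ _
  have hdj : Disjoint X1 X2 := disjoint_filter_filter_not _ _ _
  have he2 : e ∈ X2 := mem_filter.2 ⟨he, fun h => h.1 Br.refl⟩
  have he1 : e' ∈ X1 := mem_filter.2 ⟨he', hee, hK⟩
  have hcard : #X1 + #X2 = n := by rw [← card_union_of_disjoint hdj, hun, hn]
  have hp1 : 0 < #X1 := card_pos.2 ⟨_, he1⟩
  have hp2 : 0 < #X2 := card_pos.2 ⟨_, he2⟩
  obtain ⟨a1, a2, a3⟩ := closed_inherit (filter_subset _ _) hcl1 hG hT hCE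
  obtain ⟨b1, b2, b3⟩ := closed_inherit (filter_subset _ _) hcl2 hG hT hCE
  have F1 := ih (#X1) (by omega) subset_union_left a1 a2 (by rw [a3])
  have F2 := ih (#X2) (by omega) subset_union_left b1 b2 (by rw [b3])
  have hE : E = (C ∪ X1) ∪ (C ∪ X2) := by
    rw [union_union_union_comm, union_self, hun, union_sdiff_of_subset hCE]
  have hfin := Fac_lens hsp a1.1 subset_union_left subset_union_left (E1 := C ∪ X1) (E2 := C ∪ X2)
    (by rw [← union_inter_distrib_left, disjoint_iff_inter_eq_empty.1 hdj, union_empty])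
    (by
      intro v hv1 hv2
      by_contra hvC
      rw [vs_union] at hv1 hv2
      obtain ⟨f, hf, hvf⟩ := hv1.resolve_left hvC
      obtain ⟨g, hg, hvg⟩ := hv2.resolve_left hvC
      exact disjoint_left.1 hdj (hcl1 f hf g
        (Br.step (filter_subset _ _ hf) (filter_subset _ _ hg) hvC hvf hvg)) hg)
    (by
      rw [a3]
      rintro v ⟨f, hf, hvf⟩ hvC
      exact (mem_filter.1 hf).2.2 ⟨hvC, f, Br.refl, hvf⟩)
    (by
      rw [b3]
      rintro v ⟨f, hf, hvf⟩ hvC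
      have hva : v ∈ att E C f := ⟨hvC, f, Br.refl, hvf⟩
      rw [mem_filter] at hf
      by_cases hb : Br E C e f
      · rw [← att_congr hb] at hva; exact hM hva
      · rcases hdich f hf.1 hb with h | h
        · exact absurd ⟨hb, h⟩ hf.2
        · exact h hva)
    F1 F2
  rwa [← hE] at hfin
end
end PB

namespace PB
section
open Classical Finset
variable {V : Type} {E C P1 P2 Q : Finset (Sym2 V)} {x y : V}

inductive Dec : Finset (Sym2 V) → Finset (Sym2 V) → Prop
  | base {C : Finset (Sym2 V)} : Circ C → Dec C C
  | theta {C P1 P2 Q E1 E2 : Finset (Sym2 V)} {x y : V} : Spl C x y P1 P2 → Pth x y Q →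
      (∀ v ∈ vs Q, v ∈ vs C → v = x ∨ v = y) → Disjoint Q C → Dec E1 (Q ∪ P1) → Dec E2 (Q ∪ P2) →
      (∀ v ∈ vs E1, v ∈ vs E2 → v ∈ vs Q) → E1 ∩ E2 = Q → Q ∪ P1 ⊆ E1 → Q ∪ P2 ⊆ E2 →
      Dec (E1 ∪ E2) C

lemma T2_sub {A B : Finset (Sym2 V)} {C' : Finset (Sym2 V)} (hT : T2 (A ∪ B) C)
    (hv : ∀ v ∈ vs A, v ∈ vs B → v ∈ vs C') (hC' : C' ⊆ A) (hCA : C ∩ A ⊆ C') : T2 A C' := by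
  intro X hX hXn
  have hX1 : ∀ e ∈ X, e ∈ A ∧ e ∉ C' := fun e he => mem_sdiff.1 (hX he)
  obtain ⟨v, w, hvw, hv1, hv2, hw1, hw2⟩ := hT X (fun e he => mem_sdiff.2
    ⟨mem_union_left _ (hX1 e he).1, fun h => (hX1 e he).2 (hCA (mem_inter.2 ⟨h, (hX1 e he).1⟩))⟩) hXn
  have key : ∀ v, v ∈ vs X → v ∈ vs ((A ∪ B) \ X) → v ∈ vs (A \ X) := by
    rintro v ⟨f, hf, hvf⟩ ⟨g, hg, hvg⟩
    rw [mem_sdiff, mem_union] at hg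
    by_cases hgA : g ∈ A
    · exact ⟨g, mem_sdiff.2 ⟨hgA, hg.2⟩, hvg⟩
    · obtain ⟨c, hc, hvc⟩ := hv v ⟨f, (hX1 f hf).1, hvf⟩ ⟨g, hg.1.resolve_left hgA, hvg⟩
      exact ⟨c, mem_sdiff.2 ⟨hC' hc, fun h => (hX1 c h).2 hc⟩, hvc⟩
  exact ⟨v, w, hvw, hv1, key v hv1 hv2, hw1, key w hw1 hw2⟩

lemma Spl.ear (hsp : Spl C x y P1 P2) (hQ : Pth x y Q)
    (hvx : ∀ v ∈ vs Q, v ∈ vs C → v = x ∨ v = y) (hdj : Disjoint Q C) : Spl (Q ∪ P1) x y Q P1 :=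
  ⟨hQ, hsp.p1, rfl, hdj.mono_right hsp.sub1, fun v h1 h2 => hvx v h1 (vs_mono hsp.sub1 h2)⟩

section half
variable {ι : Type} [Fintype ι] {f : ι → Vec V}

noncomputable def Cov (E : Finset (Sym2 V)) (f : ι → Vec V) (S : Finset ι) : Finset (Sym2 V) :=
  E.filter fun e => ∃ i ∈ S, f i e ≠ 0

lemma mem_Cov {S : Finset ι} (hf : ∀ i, f i ∈ Zc E) {e : Sym2 V} {i : ι} (hi : i ∈ S)
    (h : f i e ≠ 0) : e ∈ Cov E f S :=
  mem_filter.2 ⟨by by_contra h'; exact h ((hf i).1 e h'), i, hi, h⟩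

lemma half_sum (hsp : Spl C x y P1 P2) (hdj : Disjoint Q C) (hsum : ∑ i, f i = ind C)
    {S : Finset ι} (hS : ∑ i ∈ S, f i = ind (Q ∪ P1)) : ∑ i ∈ Sᶜ, f i = ind (Q ∪ P2) := by
  have h1 := sum_add_sum_compl S f
  rw [hsum, hS, hsp.un, ind_union hsp.dj, ind_union (hdj.mono_right hsp.sub1)] at h1
  rw [ind_union (hdj.mono_right hsp.sub2)]
  calc _ = (ind Q + ind P1) + ((ind Q + ind P1) + ∑ i ∈ Sᶜ, f i) := by
        rw [← add_assoc, vself, zero_add]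
    _ = ind Q + ind P2 + (ind P1 + ind P1) := by rw [h1]; abel
    _ = _ := by rw [vself, add_zero]

lemma half_cnt (hsp : Spl C x y P1 P2) (hdj : Disjoint Q C) (hsum : ∑ i, f i = ind C)
    (hcnt : ∀ e, ∑ i, nz (f i e) + nz (ind C e) ≤ 2)
    {S : Finset ι} (hS : ∑ i ∈ S, f i = ind (Q ∪ P1)) (e : Sym2 V) :
    (e ∈ P1 → ∑ i ∈ S, nz (f i e) = 1 ∧ ∑ i ∈ Sᶜ, nz (f i e) = 0) ∧
    (e ∈ P2 → ∑ i ∈ S, nz (f i e) = 0 ∧ ∑ i ∈ Sᶜ, nz (f i e) = 1) ∧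
    (e ∈ Q → ∑ i ∈ S, nz (f i e) = 1 ∧ ∑ i ∈ Sᶜ, nz (f i e) = 1) ∧
    (e ∉ Q → ∑ i ∈ S, nz (f i e) = 0 ∨ ∑ i ∈ Sᶜ, nz (f i e) = 0) ∧
    ∑ i ∈ S, nz (f i e) ≤ 2 := by
  have hS' := half_sum hsp hdj hsum hS
  have a1 := nz_sum (f := f) S e
  have a2 := nz_sum (f := f) Sᶜ e
  have a3 := nz_split (f := f) S e
  have a4 := hcnt e
  rw [hS] at a1
  rw [hS'] at a2
  have q1 : e ∈ P1 → e ∉ P2 ∧ e ∉ Q ∧ e ∈ C := fun h =>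
    ⟨disjoint_left.1 hsp.dj h, fun h' => disjoint_left.1 hdj h' (hsp.sub1 h), hsp.sub1 h⟩
  have q2 : e ∈ P2 → e ∉ P1 ∧ e ∉ Q ∧ e ∈ C := fun h =>
    ⟨fun h' => disjoint_left.1 hsp.dj h' h, fun h' => disjoint_left.1 hdj h' (hsp.sub2 h), hsp.sub2 h⟩
  have c1 : e ∈ P1 → ∑ i ∈ S, nz (f i e) = 1 ∧ ∑ i ∈ Sᶜ, nz (f i e) = 0 := by
    intro h
    obtain ⟨h1, h2, h3⟩ := q1 h
    rw [ind_pos (mem_union_right _ h)] at a1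
    rw [ind_pos h3, nz_one] at a4
    have := nat_cast_z2' a1
    omega
  have c2 : e ∈ P2 → ∑ i ∈ S, nz (f i e) = 0 ∧ ∑ i ∈ Sᶜ, nz (f i e) = 1 := by
    intro h
    obtain ⟨h1, h2, h3⟩ := q2 h
    rw [ind_pos (mem_union_right _ h)] at a2
    rw [ind_pos h3, nz_one] at a4
    have := nat_cast_z2' a2
    omega
  refine ⟨c1, c2, ?_, ?_, by omega⟩
  · intro h
    rw [ind_pos (mem_union_left _ h)] at a1 a2
    have := nat_cast_z2' a1
    have := nat_cast_z2' a2
    omega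
  · intro h
    by_cases h1 : e ∈ P1
    · exact Or.inr (c1 h1).2
    by_cases h2 : e ∈ P2
    · exact Or.inl (c2 h2).1
    rw [ind_neg (by simp [h, h1])] at a1
    rw [ind_neg (by simp [h, h2])] at a2
    have := nat_cast_z2 a1
    have := nat_cast_z2 a2
    omega

lemma nz_of_pos {S : Finset ι} {e : Sym2 V} (h : ∑ i ∈ S, nz (f i e) ≠ 0) :
    ∃ i ∈ S, f i e ≠ 0 := by
  by_contra hcon
  push Not at hcon
  exact h (sum_eq_zero fun i hi => by rw [hcon i hi, nz_zero])

lemma half (hsp : Spl C x y P1 P2) (hQ : Pth x y Q) (hQE : Q ⊆ E) (hCE : C ⊆ E)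
    (hdj : Disjoint Q C) (hE : LL E) (hT : T2 E C)
    (hf : ∀ i, f i ∈ Zc E) (hs : ∀ z ∈ Zc E, z ∈ Submodule.span (ZMod 2) (Set.range f))
    (hcnt : ∀ e, ∑ i, nz (f i e) + nz (ind C e) ≤ 2) (hsum : ∑ i, f i = ind C)
    {S : Finset ι} (hS : ∑ i ∈ S, f i = ind (Q ∪ P1)) :
    Cov E f S ∪ Cov E f Sᶜ = E ∧ Cov E f S ∩ Cov E f Sᶜ = Q ∧
    (∀ v ∈ vs (Cov E f S), v ∈ vs (Cov E f Sᶜ) → v ∈ vs Q) ∧ Q ∪ P1 ⊆ Cov E f S ∧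
    #(Cov E f S) < #E ∧ T2 (Cov E f S) (Q ∪ P1) ∧ Fac (Cov E f S) (Q ∪ P1) := by
  have hcir : Circ C := ⟨_, _, _, _, hsp⟩
  have hc := half_cnt hsp hdj hsum hcnt hS
  have hun : Cov E f S ∪ Cov E f Sᶜ = E := by
    refine subset_antisymm (union_subset (filter_subset _ _) (filter_subset _ _)) fun e he => ?_
    obtain ⟨h, h1, h2⟩ := hT.cov hE hcir hCE he
    have : ∃ i, f i e ≠ 0 := by
      by_contra hcon
      push Not at hcon
      obtain ⟨d, hd⟩ := (Submodule.mem_span_range_iff_exists_fun _).1 (hs h h1)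
      apply h2
      rw [← hd]
      apply sum_zero_of (f := fun i => d i • f i)
      intro i _; simp [hcon i]
    obtain ⟨i, hi⟩ := this
    by_cases hiS : i ∈ S
    · exact mem_union_left _ (mem_Cov hf hiS hi)
    · exact mem_union_right _ (mem_Cov hf (mem_compl.2 hiS) hi)
  have hint : Cov E f S ∩ Cov E f Sᶜ = Q := by
    ext e
    constructor
    · intro h
      by_contra hQe
      simp only [Cov, mem_inter, mem_filter] at h
      obtain ⟨⟨-, i, hi, h1⟩, -, j, hj, h2⟩ := h
      have := nz_pos hi h1
      have := nz_pos hj h2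
      have := (hc e).2.2.2.1 hQe
      omega
    · intro h
      have hh := (hc e).2.2.1 h
      obtain ⟨i, hi, h1⟩ := nz_of_pos (f := f) (S := S) (e := e) (by omega)
      obtain ⟨j, hj, h2⟩ := nz_of_pos (f := f) (S := Sᶜ) (e := e) (by omega)
      exact mem_inter.2 ⟨mem_Cov hf hi h1, mem_Cov hf hj h2⟩
  have hvs : ∀ v ∈ vs (Cov E f S), v ∈ vs (Cov E f Sᶜ) → v ∈ vs Q := by
    rintro v ⟨p, hp, hvp⟩ ⟨q, hq, hvq⟩
    by_contra hvQ
    rw [Cov, mem_filter] at hp hq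
    obtain ⟨-, i, hi, h1⟩ := hp
    obtain ⟨-, j, hj, h2⟩ := hq
    refine side hT hE hcir hCE hf hs S (z := v) ?_ hvp hvq hi hj h1 h2
    intro e he hve
    rcases (hc e).2.2.2.1 fun h => hvQ ⟨e, h, hve⟩ with h | h
    · exact Or.inl (nz_sum_zero h)
    · exact Or.inr (nz_sum_zero h)
  have hsub : Q ∪ P1 ⊆ Cov E f S := by
    intro e he
    have : ∑ i ∈ S, nz (f i e) ≠ 0 := by
      rcases mem_union.1 he with h | h
      · have := (hc e).2.2.1 h; omega
      · have := (hc e).1 h; omega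
    obtain ⟨i, hi, h1⟩ := nz_of_pos this
    exact mem_Cov hf hi h1
  have hP2 : ∀ e ∈ P2, e ∉ Cov E f S := by
    intro e he h
    rw [Cov, mem_filter] at h
    obtain ⟨-, i, hi, h1⟩ := h
    have := nz_pos hi h1
    have := (hc e).2.1 he
    omega
  have hcard : #(Cov E f S) < #E := by
    obtain ⟨e, he⟩ := hsp.p2.nonempty
    exact card_lt_card ⟨filter_subset _ _, fun h => hP2 e he (h (hCE (hsp.sub2 he)))⟩
  have hZ : ∀ T : Finset ι, ∀ i ∈ T, f i ∈ Zc (Cov E f T) := by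
    intro T i hi
    refine Zc_of_spt (filter_subset _ _) (hf i) fun e he => ?_
    by_contra h
    exact he (mem_Cov hf hi h)
  refine ⟨hun, hint, hvs, hsub, hcard, ?_, ?_⟩
  · refine T2_sub (B := Cov E f Sᶜ) (C := C) (by rwa [hun]) ?_ hsub ?_
    · intro v h1 h2
      exact vs_mono subset_union_left (hvs v h1 h2)
    · intro e he
      rw [mem_inter] at he
      have h1 := he.1
      rw [hsp.un, mem_union] at h1
      exact mem_union_right _ (h1.resolve_right fun h => hP2 e h he.2)
  · refine ⟨S, inferInstance, fun i => f i, fun i => hZ S i i.2, ?_, ?_, ?_⟩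
    · intro z hz
      obtain ⟨d, hd⟩ := (Submodule.mem_span_range_iff_exists_fun _).1
        (hs z (Zc_mono (filter_subset _ _) hz))
      rw [← sum_add_sum_compl S] at hd
      have ha : ∑ i ∈ S, d i • f i ∈ Zc (Cov E f S) :=
        Submodule.sum_mem _ fun i hi => Submodule.smul_mem _ _ (hZ S i hi)
      have hb : ∑ i ∈ Sᶜ, d i • f i ∈ Zc (Cov E f Sᶜ) :=
        Submodule.sum_mem _ fun i hi => Submodule.smul_mem _ _ (hZ Sᶜ i hi)
      have hb' : ∑ i ∈ Sᶜ, d i • f i ∈ Zc (Cov E f S) := by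
        have : ∑ i ∈ Sᶜ, d i • f i = z - ∑ i ∈ S, d i • f i := by rw [← hd]; abel
        rw [this]; exact Submodule.sub_mem _ hz ha
      have hb0 : ∑ i ∈ Sᶜ, d i • f i ∈ Zc Q := by
        refine Zc_of_spt hQE (Zc_mono (filter_subset _ _) hb) fun e he => ?_
        rw [← hint, mem_inter, not_and_or] at he
        rcases he with h | h
        · exact hb'.1 e h
        · exact hb.1 e h
      rw [hQ.Zc_zero hb0, add_zero] at hd
      rw [← hd]
      exact Submodule.sum_mem _ fun i hi =>
        Submodule.smul_mem _ _ (Submodule.subset_span ⟨⟨i, hi⟩, rfl⟩)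
    · intro e
      have : ∑ i : S, nz (f i e) = ∑ i ∈ S, nz (f i e) := sum_coe_sort S fun i => nz (f i e)
      rw [this]
      have hh := hc e
      by_cases he : e ∈ Q ∪ P1
      · rw [ind_pos he, nz_one]
        rcases mem_union.1 he with h | h
        · have := hh.2.2.1 h; omega
        · have := hh.1 h; omega
      · rw [ind_neg he, nz_zero]; exact hh.2.2.2.2
    · rw [← hS]; exact sum_coe_sort S f

end half

lemma exists_ear (hT : T2 E C) (hE : LL E) {e : Sym2 V} (he : e ∈ E \ C) :
    ∃ x y Q, x ∈ vs C ∧ y ∈ vs C ∧ Pth x y Q ∧ Q ⊆ E \ C ∧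
      ∀ v ∈ vs Q, v ∈ vs C → v = x ∨ v = y := by
  obtain ⟨x, hx, y, hy, hxy⟩ := hT.att he
  refine ⟨x, y, ?_⟩
  suffices h : ∃ Q, Pth x y Q ∧ Q ⊆ E \ C ∧ ∀ v ∈ vs Q, v ∈ vs C → v = x ∨ v = y by
    obtain ⟨Q, h⟩ := h; exact ⟨Q, hx.1, hy.1, h⟩
  have triv : x ∈ e → y ∈ e → ∃ Q, Pth x y Q ∧ Q ⊆ E \ C ∧ ∀ v ∈ vs Q, v ∈ vs C → v = x ∨ v = y := by
    intro h1 h2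
    have : e = s(x,y) := ((Sym2.mem_and_mem_iff hxy).1 ⟨h1, h2⟩)
    subst this
    exact ⟨_, .single hxy, by simpa using he, fun v hv _ => vs_single.1 hv⟩
  rcases att_adj he hx with ⟨h1, -, h3⟩ | ⟨w, hw, hxw⟩
  · obtain ⟨-, g, hg, hyg⟩ := hy
    rw [← h3 g hg] at hyg
    exact triv h1 hyg
  rcases att_adj he hy with ⟨h1, -, h3⟩ | ⟨w', hw', hyw⟩
  · obtain ⟨-, g, hg, hxg⟩ := hx
    rw [← h3 g hg] at hxg
    exact triv hxg h1
  have hr : Rch (E \ C) ({x, y} ∪ Inn E C e) x y := by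
    refine .head ⟨hxw, by simp, Or.inr hw⟩ ?_
    refine .tail ((Inn_conn he hw hw').mono (subset_refl _) Set.subset_union_right) ?_
    exact ⟨by rwa [Sym2.eq_swap], Or.inr hw', by simp⟩
  obtain ⟨P, h1, h2, h3⟩ := Pth.exists_of_rch hr hxy
  refine ⟨P, h2, h1, fun v hv hvC => ?_⟩
  rcases h3 hv with h | h
  · simpa using h
  · exact absurd hvC h.1

theorem Dec_of_Fac (hC : Circ C) (hCE : C ⊆ E) (hE : LL E) (hT : T2 E C) (hF : Fac E C) :
    Dec E C := by
  induction hn : #E using Nat.strong_induction_on generalizing E C with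
  | _ n ih =>
  by_cases hEC : E ⊆ C
  · rw [subset_antisymm hEC hCE]; exact .base hC
  obtain ⟨e, he⟩ := not_subset.1 hEC
  obtain ⟨x, y, Q, hx, hy, hQ, hQE, hvx⟩ := exists_ear hT hE (mem_sdiff.2 he)
  obtain ⟨P1, P2, hsp⟩ := hC.spl hx hy hQ.ne
  have hdj : Disjoint Q C := disjoint_left.2 fun e he => (mem_sdiff.1 (hQE he)).2
  have hQE' := hQE.trans sdiff_subset
  obtain ⟨ι, _, f, hf, hs, hcnt, hsum⟩ := hF
  have hsp1 := hsp.ear hQ hvx hdj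
  have hsp2 := hsp.swap.ear hQ hvx hdj
  have hS : ∃ S : Finset ι, ∑ i ∈ S, f i = ind (Q ∪ P1) := by
    have hz : ind (Q ∪ P1) ∈ Zc E :=
      Zc_mono (union_subset hQE' (hsp.sub1.trans hCE)) (Circ.ind_mem ⟨_, _, _, _, hsp1⟩)
    obtain ⟨c, hc⟩ := (Submodule.mem_span_range_iff_exists_fun _).1 (hs _ hz)
    refine ⟨univ.filter fun i => c i = 1, ?_⟩
    rw [← hc, sum_filter]
    refine sum_congr rfl fun i _ => ?_
    rcases z2 (c i) with h | h <;> simp [h]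
  obtain ⟨S, hS⟩ := hS
  obtain ⟨a1, a2, a3, a4, a5, a6, a7⟩ := half hsp hQ hQE' hCE hdj hE hT hf hs hcnt hsum hS
  have hS' := half_sum hsp hdj hsum hS
  obtain ⟨b1, b2, b3, b4, b5, b6, b7⟩ := half hsp.swap hQ hQE' hCE hdj hE hT hf hs hcnt hsum hS'
  have hLL : ∀ T, LL (Cov E f T) := fun T e he => hE e (filter_subset _ _ he)
  have D1 := ih _ (by omega) ⟨_, _, _, _, hsp1⟩ a4 (hLL S) a6 a7 rfl
  have D2 := ih _ (by omega) ⟨_, _, _, _, hsp2⟩ b4 (hLL Sᶜ) b6 b7 rfl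
  rw [← a1]
  exact Dec.theta hsp hQ hvx hdj D1 D2 a3 a2 a4 b4
end
end PB

namespace PB
section
open Classical Finset

def qd (p : P2) : ℝ := p.1 ^ 2 + p.2 ^ 2
def Dsk : Set P2 := {p | qd p ≤ 1}
def Crc : Set P2 := {p | qd p = 1}
def lf (X Y p : P2) : ℝ := (Y.1 - X.1) * (p.2 - X.2) - (Y.2 - X.2) * (p.1 - X.1)
def Hlf (X Y : P2) : Set P2 := {p | qd p ≤ 1 ∧ 0 ≤ lf X Y p}

lemma qd_cont : Continuous qd := by unfold qd; fun_prop
lemma lf_cont (X Y : P2) : Continuous (lf X Y) := by unfold lf; fun_prop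

lemma lf_swap (X Y p : P2) : lf Y X p = - lf X Y p := by unfold lf; ring

lemma not_int_of_dir {A : Set P2} {p d : P2} (h : ∀ t : ℝ, 0 < t → p + t • d ∉ A) :
    p ∉ interior A := by
  intro hp
  have hc : Continuous fun t : ℝ => p + t • d := by fun_prop
  have h0 : (fun t : ℝ => p + t • d) ⁻¹' interior A ∈ nhds (0 : ℝ) :=
    hc.continuousAt.preimage_mem_nhds (by simpa using isOpen_interior.mem_nhds hp)
  obtain ⟨ε, hε, hb⟩ := Metric.mem_nhds_iff.1 h0
  exact h (ε / 2) (by positivity) (interior_subset (hb (by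
    rw [Metric.mem_ball, dist_zero_right, Real.norm_eq_abs, abs_of_pos (by positivity)]; linarith)))

lemma Dsk_convex : Convex ℝ Dsk := by
  intro p hp q hq a b ha hb hab
  simp only [Dsk, qd, Set.mem_ofPred_eq, Prod.fst_add, Prod.snd_add, Prod.smul_fst, Prod.smul_snd,
    smul_eq_mul] at *
  obtain rfl : b = 1 - a := by linarith
  nlinarith [mul_nonneg ha hb, mul_nonneg (mul_nonneg ha hb) (sq_nonneg (p.1 - q.1)),
    mul_nonneg (mul_nonneg ha hb) (sq_nonneg (p.2 - q.2)), mul_le_mul_of_nonneg_left hp ha,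
    mul_le_mul_of_nonneg_left hq hb]

lemma Hlf_convex (X Y : P2) : Convex ℝ (Hlf X Y) := by
  have : Hlf X Y = Dsk ∩ {p | 0 ≤ lf X Y p} := rfl
  rw [this]
  refine Dsk_convex.inter ?_
  intro p hp q hq a b ha hb hab
  simp only [Set.mem_ofPred_eq] at *
  have : lf X Y (a • p + b • q) = a * lf X Y p + b * lf X Y q := by
    obtain rfl : b = 1 - a := by linarith
    simp only [lf, Prod.fst_add, Prod.snd_add, Prod.smul_fst, Prod.smul_snd, smul_eq_mul]
    ring
  rw [this]; positivity

lemma Dsk_bdd : Bornology.IsBounded Dsk := by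
  refine (Metric.isBounded_closedBall (x := (0 : P2)) (r := 1)).subset fun p hp => ?_
  simp only [Dsk, qd, Set.mem_ofPred_eq] at hp
  rw [mem_closedBall_zero_iff, Prod.norm_def, max_le_iff, Real.norm_eq_abs, Real.norm_eq_abs,
    abs_le_one_iff_mul_self_le_one, abs_le_one_iff_mul_self_le_one]
  constructor <;> nlinarith [sq_nonneg p.1, sq_nonneg p.2]

lemma Dsk_closed : IsClosed Dsk := isClosed_le qd_cont continuous_const
lemma Hlf_closed (X Y : P2) : IsClosed (Hlf X Y) :=
  (isClosed_le qd_cont continuous_const).inter (isClosed_le continuous_const (lf_cont X Y))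

lemma Dsk_int : interior Dsk = {p | qd p < 1} := by
  refine Set.Subset.antisymm (fun p hp => ?_)
    (interior_maximal (fun p hp => (show qd p ≤ 1 from le_of_lt hp)) (isOpen_lt qd_cont continuous_const))
  have hp' : p ∈ Dsk := interior_subset hp
  rcases lt_or_eq_of_le (show qd p ≤ 1 from hp') with h | h
  · exact h
  · exfalso
    refine not_int_of_dir (d := p) (fun t ht hm => ?_) hp
    simp only [Dsk, qd, Set.mem_ofPred_eq, Prod.fst_add, Prod.snd_add, Prod.smul_fst,
      Prod.smul_snd, smul_eq_mul] at *
    have e : (p.1 + t * p.1) ^ 2 + (p.2 + t * p.2) ^ 2 = (1 + t) ^ 2 := by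
      linear_combination (1 + t) ^ 2 * h
    nlinarith

lemma Dsk_frontier : frontier Dsk = Crc := by
  rw [Dsk_closed.frontier_eq, Dsk_int]
  ext p
  simp only [Dsk, Crc, Set.mem_sdiff, Set.mem_ofPred_eq, not_lt]
  constructor
  · rintro ⟨a, b⟩; exact le_antisymm a b
  · intro h; exact ⟨h.le, h.ge⟩

lemma pair_ne {X Y : P2} (h : X ≠ Y) : 0 < (Y.1 - X.1) ^ 2 + (Y.2 - X.2) ^ 2 := by
  by_contra hcon
  apply h
  have h1 : Y.1 - X.1 = 0 := by nlinarith [sq_nonneg (Y.1 - X.1), sq_nonneg (Y.2 - X.2)]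
  have h2 : Y.2 - X.2 = 0 := by nlinarith [sq_nonneg (Y.1 - X.1), sq_nonneg (Y.2 - X.2)]
  ext <;> linarith

lemma Hlf_int {X Y : P2} (h : X ≠ Y) : interior (Hlf X Y) = {p | qd p < 1 ∧ 0 < lf X Y p} := by
  refine Set.Subset.antisymm (fun p hp => ?_)
    (interior_maximal (fun p hp => ⟨hp.1.le, hp.2.le⟩)
      ((isOpen_lt qd_cont continuous_const).inter (isOpen_lt continuous_const (lf_cont X Y))))
  have hp1 : p ∈ interior Dsk := interior_mono (fun p hp => hp.1) hp
  rw [Dsk_int] at hp1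
  refine ⟨hp1, lt_of_le_of_ne (interior_subset hp).2 fun h0 => ?_⟩
  refine not_int_of_dir (d := (Y.2 - X.2, -(Y.1 - X.1))) (fun t ht hm => ?_) hp
  have := hm.2
  have e : lf X Y (p + t • ((Y.2 - X.2, -(Y.1 - X.1)) : P2)) =
      lf X Y p - t * ((Y.1 - X.1) ^ 2 + (Y.2 - X.2) ^ 2) := by
    simp only [lf, Prod.fst_add, Prod.snd_add, Prod.smul_fst, Prod.smul_snd, smul_eq_mul]
    ring
  rw [e, ← h0] at this
  nlinarith [mul_pos ht (pair_ne h)]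

lemma seg_param {X Y p : P2} : p ∈ segment ℝ X Y ↔
    ∃ t ∈ Set.Icc (0 : ℝ) 1, p = (X.1 + t * (Y.1 - X.1), X.2 + t * (Y.2 - X.2)) := by
  rw [segment_eq_image']
  constructor
  · rintro ⟨t, ht, rfl⟩; exact ⟨t, ht, rfl⟩
  · rintro ⟨t, ht, rfl⟩; exact ⟨t, ht, rfl⟩

lemma line_param {X Y p : P2} (h : X ≠ Y) (hp : lf X Y p = 0) :
    ∃ t : ℝ, p = (X.1 + t * (Y.1 - X.1), X.2 + t * (Y.2 - X.2)) := by
  have hn := pair_ne h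
  set N := (Y.1 - X.1) ^ 2 + (Y.2 - X.2) ^ 2 with hN
  refine ⟨((p.1 - X.1) * (Y.1 - X.1) + (p.2 - X.2) * (Y.2 - X.2)) / N, ?_⟩
  have hne : N ≠ 0 := hn.ne'
  unfold lf at hp
  ext
  · field_simp
    rw [hN]
    linear_combination -(Y.2 - X.2) * hp
  · field_simp
    rw [hN]
    linear_combination (Y.1 - X.1) * hp

lemma chord_qd {X Y : P2} (hX : qd X = 1) (hY : qd Y = 1) (t : ℝ) :
    qd (X.1 + t * (Y.1 - X.1), X.2 + t * (Y.2 - X.2)) =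
      1 - t * (1 - t) * ((Y.1 - X.1) ^ 2 + (Y.2 - X.2) ^ 2) := by
  unfold qd at *
  simp only
  linear_combination (1 - t) * hX + t * hY

lemma chord_iff {X Y p : P2} (h : X ≠ Y) (hX : qd X = 1) (hY : qd Y = 1) :
    p ∈ segment ℝ X Y ↔ qd p ≤ 1 ∧ lf X Y p = 0 := by
  have hn := pair_ne h
  rw [seg_param]
  constructor
  · rintro ⟨t, ⟨h0, h1⟩, rfl⟩
    refine ⟨?_, by unfold lf; ring⟩
    rw [chord_qd hX hY]
    have : 0 ≤ t * (1 - t) := mul_nonneg h0 (by linarith)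
    nlinarith [mul_nonneg this hn.le]
  · rintro ⟨h1, h2⟩
    obtain ⟨t, rfl⟩ := line_param h h2
    rw [chord_qd hX hY] at h1
    have : 0 ≤ t * (1 - t) := by
      by_contra hc
      push Not at hc
      nlinarith [mul_neg_of_neg_of_pos hc hn]
    exact ⟨t, ⟨by nlinarith, by nlinarith⟩, rfl⟩

lemma chord_ends {X Y p : P2} (h : X ≠ Y) (hX : qd X = 1) (hY : qd Y = 1) (hp : qd p = 1)
    (hl : lf X Y p = 0) : p = X ∨ p = Y := by
  have hn := pair_ne h
  obtain ⟨t, rfl⟩ := line_param h hl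
  rw [chord_qd hX hY] at hp
  have : t * (1 - t) = 0 := by
    have : t * (1 - t) * ((Y.1 - X.1) ^ 2 + (Y.2 - X.2) ^ 2) = 0 := by linarith
    exact (mul_eq_zero.1 this).resolve_right hn.ne'
  rcases mul_eq_zero.1 this with h | h
  · left; subst h; ext <;> simp
  · right
    obtain rfl : t = 1 := by linarith
    ext <;> simp

/-- a point of the circle on the positive side -/
lemma exists_pos {X Y : P2} (h : X ≠ Y) (hX : qd X = 1) (hY : qd Y = 1) :
    ∃ p, qd p = 1 ∧ 0 < lf X Y p := by
  have hn := pair_ne h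
  set N := (Y.1 - X.1) ^ 2 + (Y.2 - X.2) ^ 2 with hN
  have hs : 0 < Real.sqrt N := Real.sqrt_pos.2 hn
  have hs2 : Real.sqrt N ^ 2 = N := Real.sq_sqrt hn.le
  set s := Real.sqrt N with hsd
  refine ⟨(-(Y.2 - X.2) / s, (Y.1 - X.1) / s), ?_, ?_⟩
  · unfold qd
    simp only
    field_simp
    rw [hs2, hN]; ring
  · have e : lf X Y (-(Y.2 - X.2) / s, (Y.1 - X.1) / s) =
        s - ((Y.1 - X.1) * X.2 - (Y.2 - X.2) * X.1) := by
      unfold lf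
      simp only
      field_simp
      linear_combination hs2.symm - hN
    rw [e]
    have hc : ((Y.1 - X.1) * X.2 - (Y.2 - X.2) * X.1) ^ 2 < N := by
      unfold qd at hX hY
      have id1 : ((Y.1 - X.1) * X.2 - (Y.2 - X.2) * X.1) ^ 2 +
          ((Y.1 - X.1) * X.1 + (Y.2 - X.2) * X.2) ^ 2 = N * (X.1 ^ 2 + X.2 ^ 2) := by
        rw [hN]; ring
      have id2 : (Y.1 - X.1) * X.1 + (Y.2 - X.2) * X.2 = -N / 2 := by
        rw [hN]; linear_combination (1/2) * hY - (1/2) * hX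
      rw [id2, hX] at id1
      nlinarith [mul_pos hn hn]
    have h9 := (abs_lt.1 (abs_lt_of_sq_lt_sq (hc.trans_eq hs2.symm) hs.le)).2
    linarith

lemma Hlf_frontier {X Y : P2} (h : X ≠ Y) (hX : qd X = 1) (hY : qd Y = 1) :
    frontier (Hlf X Y) = {p | qd p = 1 ∧ 0 ≤ lf X Y p} ∪ segment ℝ X Y := by
  rw [(Hlf_closed X Y).frontier_eq, Hlf_int h]
  ext p
  simp only [Set.mem_sdiff, Set.mem_union, chord_iff h hX hY, Hlf, Set.mem_ofPred_eq]
  constructor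
  · rintro ⟨⟨a, b⟩, c⟩
    rcases a.lt_or_eq with a' | a'
    · right
      refine ⟨a, le_antisymm ?_ b⟩
      by_contra hb; push Not at hb; exact c ⟨a', hb⟩
    · exact Or.inl ⟨a', b⟩
  · rintro (⟨a, b⟩ | ⟨a, b⟩)
    · exact ⟨⟨a.le, b⟩, fun h => by linarith [h.1]⟩
    · exact ⟨⟨a, b.ge⟩, fun h => by linarith [h.2]⟩

lemma Hlf_int_nonempty {X Y : P2} (h : X ≠ Y) (hX : qd X = 1) (hY : qd Y = 1) :
    (interior (Hlf X Y)).Nonempty := by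
  rw [Hlf_int h]
  obtain ⟨p, hp, hl⟩ := exists_pos h hX hY
  have hn := pair_ne h
  refine ⟨((1/2) * p.1 + (1/2) * ((X.1 + Y.1) / 2), (1/2) * p.2 + (1/2) * ((X.2 + Y.2) / 2)), ?_, ?_⟩
  · unfold qd at *
    simp only
    nlinarith [sq_nonneg (p.1 - (X.1 + Y.1) / 2), sq_nonneg (p.2 - (X.2 + Y.2) / 2)]
  · unfold lf at *
    simp only
    nlinarith

lemma Hlf_homeo {X Y : P2} (h : X ≠ Y) (hX : qd X = 1) (hY : qd Y = 1) :
    ∃ φ : P2 ≃ₜ P2, φ '' Hlf X Y = Dsk ∧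
      φ '' ({p | qd p = 1 ∧ 0 ≤ lf X Y p} ∪ segment ℝ X Y) = Crc := by
  obtain ⟨f, -, f2, f3⟩ := exists_homeomorph_image_interior_closure_frontier_eq_unitBall
    (Hlf_convex X Y) (Hlf_int_nonempty h hX hY) (Dsk_bdd.subset fun p hp => hp.1)
  obtain ⟨g, -, g2, g3⟩ := exists_homeomorph_image_interior_closure_frontier_eq_unitBall
    Dsk_convex (by rw [Dsk_int]; exact ⟨0, by simp [qd]⟩) Dsk_bdd
  rw [(Hlf_closed X Y).closure_eq] at f2
  rw [Dsk_closed.closure_eq] at g2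
  rw [Hlf_frontier h hX hY] at f3
  rw [Dsk_frontier] at g3
  refine ⟨f.trans g.symm, ?_, ?_⟩
  · have e : ⇑(f.trans g.symm) = g.symm ∘ f := rfl
    rw [e, Set.image_comp, f2, ← g2, ← Set.image_comp]; simp
  · have e : ⇑(f.trans g.symm) = g.symm ∘ f := rfl
    rw [e, Set.image_comp, f3, ← g3, ← Set.image_comp]; simp

lemma qd_smul (c : ℝ) (p : P2) : qd (c • p) = c ^ 2 * qd p := by
  simp only [qd, Prod.smul_fst, Prod.smul_snd, smul_eq_mul]; ring

lemma qd_pos {p : P2} (h : p ≠ 0) : 0 < qd p := by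
  have := pair_ne h.symm
  simpa [qd] using this

lemma Dsk_compl_conn : IsConnected (Dskᶜ) := by
  have h0 : IsConnected ({0}ᶜ : Set P2) :=
    isConnected_compl_singleton_of_one_lt_rank (by
      rw [rank_prod', Module.rank_self]; norm_num) 0
  have e : (fun p : P2 => (1 + 1 / Real.sqrt (qd p)) • p) '' ({0}ᶜ : Set P2) = Dskᶜ := by
    ext p
    simp only [Set.mem_image, Set.mem_compl_iff, Set.mem_singleton_iff, Dsk, Set.mem_ofPred_eq,
      not_le]
    constructor
    · rintro ⟨q, hq, rfl⟩
      have h1 := qd_pos hq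
      have h2 := Real.sqrt_pos.2 h1
      have h3 := Real.sq_sqrt h1.le
      rw [qd_smul]
      have : (1 + 1 / Real.sqrt (qd q)) ^ 2 * qd q = (Real.sqrt (qd q) + 1) ^ 2 := by
        rw [← h3, Real.sqrt_sq h2.le]; field_simp
      rw [this]; nlinarith
    · intro hp
      have h1 : 0 < qd p := by linarith
      have h2 := Real.sqrt_pos.2 h1
      have h3 := Real.sq_sqrt h1.le
      set r := Real.sqrt (qd p) with hr
      have hr1 : 1 < r := by nlinarith
      have hp0 : p ≠ 0 := by rintro rfl; simp [qd] at hp; linarith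
      have hc : 0 < 1 - 1 / r := by rw [sub_pos, div_lt_one h2]; exact hr1
      refine ⟨(1 - 1 / r) • p, smul_ne_zero hc.ne' hp0, ?_⟩
      have hq : Real.sqrt (qd ((1 - 1 / r) • p)) = r - 1 := by
        rw [qd_smul, ← h3, ← mul_pow, Real.sqrt_sq (by positivity)]
        field_simp
      rw [hq, smul_smul]
      have : (1 + 1 / (r - 1)) * (1 - 1 / r) = 1 := by
        have : r - 1 ≠ 0 := by linarith
        field_simp; ring
      rw [this, one_smul]
  rw [← e]
  refine h0.image _ ?_
  refine ContinuousOn.smul (continuousOn_const.add (continuousOn_const.div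
    (Real.continuous_sqrt.comp qd_cont).continuousOn ?_)) continuousOn_id
  intro p hp
  exact (Real.sqrt_pos.2 (qd_pos hp)).ne'
end
end PB

namespace PB
section
open Classical Finset

variable {W : Type} {A B : Set P2} {p q r : P2}

lemma IsArc.left (h : IsArc A p q) : p ∈ A := by
  obtain ⟨γ, -, -, h0, -, rfl⟩ := h; exact ⟨0, by simp, h0⟩

lemma IsArc.right (h : IsArc A p q) : q ∈ A := by
  obtain ⟨γ, -, -, -, h0, rfl⟩ := h; exact ⟨1, by simp, h0⟩

lemma IsArc.ne (h : IsArc A p q) : p ≠ q := by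
  obtain ⟨γ, -, hi, rfl, rfl, rfl⟩ := h
  intro he
  exact zero_ne_one (hi (by simp) (by simp) he)

/-- arcs over an arbitrary interval -/
lemma IsArc.of {γ : ℝ → P2} {a b : ℝ} (hab : a < b) (hc : ContinuousOn γ (Set.Icc a b))
    (hi : Set.InjOn γ (Set.Icc a b)) : IsArc (γ '' Set.Icc a b) (γ a) (γ b) := by
  have hm : ∀ t ∈ Set.Icc (0:ℝ) 1, a + t * (b - a) ∈ Set.Icc a b := by
    rintro t ⟨h0, h1⟩; constructor <;> nlinarith
  refine ⟨fun t => γ (a + t * (b - a)), hc.comp (by fun_prop) hm, ?_, by simp, by simp, ?_⟩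
  · intro s hs t ht h
    have := hi (hm s hs) (hm t ht) h
    have h2 : s * (b - a) = t * (b - a) := by linarith
    exact mul_right_cancel₀ (by linarith) h2
  · ext z; constructor
    · rintro ⟨t, ht, rfl⟩; exact ⟨_, hm t ht, rfl⟩
    · rintro ⟨u, ⟨h1, h2⟩, rfl⟩
      have hp : 0 < b - a := by linarith
      refine ⟨(u - a) / (b - a), ⟨div_nonneg (by linarith) hp.le, ?_⟩, ?_⟩
      · rw [div_le_one hp]; linarith
      · simp only; congr 1; field_simp; ring

lemma IsArc.symm (h : IsArc A p q) : IsArc A q p := by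
  obtain ⟨γ, hc, hi, rfl, rfl, rfl⟩ := h
  have hm : ∀ t ∈ Set.Icc (0:ℝ) 1, 1 - t ∈ Set.Icc (0:ℝ) 1 := by
    rintro t ⟨h0, h1⟩; constructor <;> linarith
  refine ⟨fun t => γ (1 - t), hc.comp (by fun_prop) hm, ?_, by simp, by simp, ?_⟩
  · intro s hs t ht h
    have := hi (hm s hs) (hm t ht) h
    linarith
  · ext z; constructor
    · rintro ⟨t, ht, rfl⟩; exact ⟨_, hm t ht, rfl⟩
    · rintro ⟨u, hu, rfl⟩; exact ⟨1 - u, hm u hu, by simp⟩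

lemma IsArc.concat (h : IsArc A p q) (h' : IsArc B q r) (hd : ∀ z ∈ A, z ∈ B → z = q) :
    IsArc (A ∪ B) p r := by
  obtain ⟨γ, hc, hi, rfl, hq, rfl⟩ := h
  obtain ⟨δ, hc', hi', hq', rfl, rfl⟩ := h'
  set η : ℝ → P2 := fun t => if t ≤ 1 then γ t else δ (t - 1) with hη
  have e1 : ∀ t ∈ Set.Icc (0:ℝ) 1, η t = γ t := fun t ht => by simp [hη, ht.2]
  have e2 : ∀ t ∈ Set.Icc (1:ℝ) 2, η t = δ (t - 1) := by
    intro t ht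
    rcases ht.1.eq_or_lt with rfl | h
    · simp [hη, hq, hq']
    · simp [hη, not_le.2 h]
  have hs : ∀ t ∈ Set.Icc (1:ℝ) 2, t - 1 ∈ Set.Icc (0:ℝ) 1 := by
    rintro t ⟨h0, h1⟩; constructor <;> linarith
  have hU : Set.Icc (0:ℝ) 2 = Set.Icc 0 1 ∪ Set.Icc 1 2 :=
    (Set.Icc_union_Icc_eq_Icc (by norm_num) (by norm_num)).symm
  have c : ContinuousOn η (Set.Icc 0 2) := by
    rw [hU]
    refine ContinuousOn.union_of_isClosed ?_ ?_ isClosed_Icc isClosed_Icc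
    · exact hc.congr e1
    · exact (hc'.comp (f := fun t => t - 1) (by fun_prop) hs).congr e2
  have mix : ∀ s ∈ Set.Icc (0:ℝ) 1, ∀ t ∈ Set.Icc (1:ℝ) 2, η s = η t → s = t := by
    intro s hs' t ht h
    rw [e1 s hs', e2 t ht] at h
    have hz := hd _ ⟨s, hs', rfl⟩ ⟨t - 1, hs t ht, h.symm⟩
    have a1 : s = 1 := hi hs' (by simp) (hz.trans hq.symm)
    have a2 : t - 1 = 0 := hi' (hs t ht) (by simp) (h.symm.trans (hz.trans hq'.symm))
    linarith
  have i : Set.InjOn η (Set.Icc 0 2) := by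
    intro s hs' t ht h
    rw [hU] at hs' ht
    rcases hs' with hs' | hs' <;> rcases ht with ht | ht
    · rw [e1 s hs', e1 t ht] at h; exact hi hs' ht h
    · exact mix s hs' t ht h
    · exact (mix t ht s hs' h.symm).symm
    · rw [e2 s hs', e2 t ht] at h
      have := hi' (hs s hs') (hs t ht) h; linarith
  have := IsArc.of (by norm_num) c i
  have f0 : η 0 = γ 0 := e1 0 (by simp)
  have f2 : η 2 = δ 1 := by rw [e2 2 (by norm_num)]; norm_num
  rw [f0, f2] at this
  convert this using 1
  rw [hU, Set.image_union, Set.image_congr e1, Set.image_congr e2]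
  congr 1
  ext z; constructor
  · rintro ⟨t, ht, rfl⟩
    exact ⟨t + 1, ⟨by linarith [ht.1], by linarith [ht.2]⟩, by simp⟩
  · rintro ⟨t, ht, rfl⟩; exact ⟨_, hs t ht, rfl⟩

lemma IsArc.split (h : IsArc A p q) : ∃ m A1 A2, IsArc A1 p m ∧ IsArc A2 m q ∧ A = A1 ∪ A2 ∧
    ∀ z ∈ A1, z ∈ A2 → z = m := by
  obtain ⟨γ, hc, hi, rfl, rfl, rfl⟩ := h
  have s1 : Set.Icc (0:ℝ) (1/2) ⊆ Set.Icc 0 1 := Set.Icc_subset_Icc le_rfl (by norm_num)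
  have s2 : Set.Icc (1/2:ℝ) 1 ⊆ Set.Icc 0 1 := Set.Icc_subset_Icc (by norm_num) le_rfl
  refine ⟨γ (1/2), γ '' Set.Icc 0 (1/2), γ '' Set.Icc (1/2) 1,
    IsArc.of (by norm_num) (hc.mono s1) (hi.mono s1),
    IsArc.of (by norm_num) (hc.mono s2) (hi.mono s2), ?_, ?_⟩
  · rw [← Set.image_union, Set.Icc_union_Icc_eq_Icc (by norm_num) (by norm_num)]
  · rintro z ⟨s, hs, rfl⟩ ⟨t, ht, h⟩
    have := hi (s2 ht) (s1 hs) h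
    have : s = 1/2 := le_antisymm hs.2 (this ▸ ht.1)
    rw [this]

lemma IsArc.open_conn (h : IsArc A p q) : IsPreconnected (A \ {p, q}) := by
  obtain ⟨γ, hc, hi, rfl, rfl, rfl⟩ := h
  have : γ '' Set.Icc 0 1 \ {γ 0, γ 1} = γ '' Set.Ioo 0 1 := by
    ext z; constructor
    · rintro ⟨⟨t, ht, rfl⟩, hn⟩
      refine ⟨t, ⟨ht.1.lt_of_ne ?_, ht.2.lt_of_ne ?_⟩, rfl⟩
      · rintro rfl; simp at hn
      · rintro rfl; simp at hn
    · rintro ⟨t, ht, rfl⟩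
      have ht' := Set.Ioo_subset_Icc_self ht
      refine ⟨⟨t, ht', rfl⟩, ?_⟩
      rintro (h | h)
      · exact ht.1.ne' (hi ht' (by simp) h)
      · exact ht.2.ne (hi ht' (by simp) h)
  rw [this]
  exact isPreconnected_Ioo.image _ (hc.mono Set.Ioo_subset_Icc_self)

lemma IsArc.map (h : IsArc A p q) (φ : P2 ≃ₜ P2) : IsArc (φ '' A) (φ p) (φ q) := by
  obtain ⟨γ, hc, hi, rfl, rfl, rfl⟩ := h
  exact ⟨φ ∘ γ, φ.continuous.comp_continuousOn hc, φ.injective.comp_injOn hi, rfl, rfl,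
    Set.image_comp _ _ _⟩

lemma IsArc.seg (h : p ≠ q) : IsArc (segment ℝ p q) p q := by
  refine ⟨AffineMap.lineMap p q, AffineMap.lineMap_continuous.continuousOn,
    (AffineMap.lineMap_injective ℝ h).injOn, by simp, by simp, ?_⟩
  rw [segment_eq_image_lineMap]

/-! drawings -/
def Im (E : Finset (Sym2 W)) (a : Sym2 W → Set P2) : Set P2 := ⋃ e ∈ E, a e

lemma mem_Im {E : Finset (Sym2 W)} {a : Sym2 W → Set P2} {z : P2} :
    z ∈ Im E a ↔ ∃ e ∈ E, z ∈ a e := by simp [Im]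

lemma Im_union {E F : Finset (Sym2 W)} {a : Sym2 W → Set P2} :
    Im (E ∪ F) a = Im E a ∪ Im F a := by
  ext z; simp only [mem_Im, mem_union, Set.mem_union, or_and_right, exists_or]

lemma Im_single {e : Sym2 W} {a : Sym2 W → Set P2} : Im {e} a = a e := by
  ext z; simp [mem_Im]

lemma Im_mono {E F : Finset (Sym2 W)} {a : Sym2 W → Set P2} (h : E ⊆ F) : Im E a ⊆ Im F a := by
  intro z hz; rw [mem_Im] at *; obtain ⟨e, he, hz⟩ := hz; exact ⟨e, h he, hz⟩

lemma Im_congr {E : Finset (Sym2 W)} {a b : Sym2 W → Set P2} (h : ∀ e ∈ E, a e = b e) :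
    Im E a = Im E b := by
  ext z; simp only [mem_Im]
  constructor
  · rintro ⟨e, he, hz⟩; exact ⟨e, he, h e he ▸ hz⟩
  · rintro ⟨e, he, hz⟩; exact ⟨e, he, (h e he).symm ▸ hz⟩

lemma Im_map {E : Finset (Sym2 W)} {a : Sym2 W → Set P2} (φ : P2 ≃ₜ P2) :
    Im E (fun e => φ '' a e) = φ '' Im E a := by
  simp only [Im, Set.image_iUnion]

variable {E F : Finset (Sym2 W)} {v : W → P2} {a : Sym2 W → Set P2}

namespace Drw

lemma vmem (D : Drw E v a) {e : Sym2 W} (he : e ∈ E) {w : W} (hw : w ∈ e) : v w ∈ a e := by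
  obtain ⟨u, rfl⟩ := Sym2.mem_iff_exists.1 hw
  exact (D.ar _ _ he).left

lemma vIm (D : Drw E v a) {w : W} (hw : w ∈ vs E) : v w ∈ Im E a := by
  obtain ⟨e, he, hw⟩ := hw
  exact mem_Im.2 ⟨e, he, D.vmem he hw⟩

lemma mono (D : Drw E v a) (h : F ⊆ E) : Drw F v a where
  inj := D.inj.mono (vs_mono h)
  ar := fun x y hxy => D.ar x y (h hxy)
  av := fun e he w hw => D.av e (h he) w (vs_mono h hw)
  aa := fun e he e' he' hne z hz hz' => by
    obtain ⟨w, hw, rfl⟩ := D.aa e (h he) e' (h he') hne z hz hz'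
    exact ⟨w, ⟨e, he, D.av e (h he) w hw hz⟩, rfl⟩

lemma congr (D : Drw E v a) {v' : W → P2} {a' : Sym2 W → Set P2} (hv : ∀ w ∈ vs E, v' w = v w)
    (ha : ∀ e ∈ E, a' e = a e) : Drw E v' a' where
  inj := fun x hx y hy h => D.inj hx hy (by rwa [hv x hx, hv y hy] at h)
  ar := fun x y hxy => by
    rw [ha _ hxy, hv x ⟨_, hxy, by simp⟩, hv y ⟨_, hxy, by simp⟩]; exact D.ar x y hxy
  av := fun e he w hw h => D.av e he w hw (by rwa [ha e he, hv w hw] at h)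
  aa := fun e he e' he' hne z hz hz' => by
    rw [ha e he] at hz; rw [ha e' he'] at hz'
    obtain ⟨w, hw, rfl⟩ := D.aa e he e' he' hne z hz hz'
    exact ⟨w, hw, (hv w hw).symm⟩

lemma map (D : Drw E v a) (φ : P2 ≃ₜ P2) : Drw E (fun w => φ (v w)) (fun e => φ '' a e) where
  inj := fun x hx y hy h => D.inj hx hy (φ.injective h)
  ar := fun x y hxy => (D.ar x y hxy).map φ
  av := fun e he w hw h => D.av e he w hw (by
    obtain ⟨z, hz, h⟩ := h
    rwa [φ.injective h] at hz)
  aa := by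
    rintro e he e' he' hne _ ⟨z, hz, rfl⟩ ⟨z', hz', h⟩
    rw [φ.injective h] at hz'
    obtain ⟨w, hw, rfl⟩ := D.aa e he e' he' hne z hz hz'
    exact ⟨w, hw, rfl⟩

lemma single {x y : W} (h : IsArc (a s(x,y)) (v x) (v y)) : Drw {s(x,y)} v a where
  inj := by
    intro c hc d hd hcd
    rw [vs_single] at hc hd
    rcases hc with rfl | rfl <;> rcases hd with rfl | rfl
    · rfl
    · exact absurd hcd h.ne
    · exact absurd hcd.symm h.ne
    · rfl
  ar := by
    intro c d hcd
    rw [mem_singleton] at hcd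
    rw [hcd]
    rcases Sym2.eq_iff.1 hcd with ⟨rfl, rfl⟩ | ⟨rfl, rfl⟩
    · exact h
    · exact h.symm
  av := by
    intro e he w hw _
    rw [mem_singleton] at he
    subst he
    rw [vs_single] at hw
    simpa using hw
  aa := by
    intro e he e' he' hne
    rw [mem_singleton] at he he'
    exact absurd (he.trans he'.symm) hne

lemma union (D : Drw E v a) (D' : Drw F v a)
    (H : ∀ z ∈ Im E a, z ∈ Im F a → (∃ w, w ∈ vs E ∧ w ∈ vs F ∧ z = v w) ∨
      ∃ e, e ∈ E ∧ e ∈ F ∧ z ∈ a e) : Drw (E ∪ F) v a := by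
  have key : ∀ w ∈ vs E, v w ∈ Im F a → w ∈ vs F := by
    intro w hw hz
    rcases H _ (D.vIm hw) hz with ⟨w', h1, h2, h3⟩ | ⟨e, h1, h2, h3⟩
    · rwa [D.inj hw h1 h3]
    · exact ⟨e, h2, D.av e h1 w hw h3⟩
  have key' : ∀ w ∈ vs F, v w ∈ Im E a → w ∈ vs E := by
    intro w hw hz
    rcases H _ hz (D'.vIm hw) with ⟨w', h1, h2, h3⟩ | ⟨e, h1, h2, h3⟩
    · rwa [D'.inj hw h2 h3]
    · exact ⟨e, h1, D'.av e h2 w hw h3⟩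
  have kaa : ∀ e ∈ E, ∀ e' ∈ F, e ≠ e' → ∀ z ∈ a e, z ∈ a e' → ∃ w ∈ vs (E ∪ F), z = v w := by
    intro e he e' he' hne z hz hz'
    rcases H z (mem_Im.2 ⟨e, he, hz⟩) (mem_Im.2 ⟨e', he', hz'⟩) with ⟨w, h1, h2, h3⟩ | ⟨f, h1, h2, h3⟩
    · exact ⟨w, vs_mono subset_union_left h1, h3⟩
    · by_cases hf : f = e
      · subst hf
        obtain ⟨w, hw, h⟩ := D'.aa f h2 e' he' hne z hz hz'
        exact ⟨w, vs_mono subset_union_right hw, h⟩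
      · obtain ⟨w, hw, h⟩ := D.aa f h1 e he hf z h3 hz
        exact ⟨w, vs_mono subset_union_left hw, h⟩
  refine ⟨?_, ?_, ?_, ?_⟩
  · intro x hx y hy h
    rw [vs_union] at hx hy
    rcases hx with hx | hx <;> rcases hy with hy | hy
    · exact D.inj hx hy h
    · exact D'.inj (key x hx (h ▸ D'.vIm hy)) hy h
    · exact D.inj (key' x hx (h ▸ D.vIm hy)) hy h
    · exact D'.inj hx hy h
  · intro x y hxy
    rcases mem_union.1 hxy with h | h
    · exact D.ar _ _ h
    · exact D'.ar _ _ h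
  · intro e he w hw hz
    rw [vs_union] at hw
    rcases mem_union.1 he with h | h <;> rcases hw with hw | hw
    · exact D.av e h w hw hz
    · exact D.av e h w (key' w hw (mem_Im.2 ⟨e, h, hz⟩)) hz
    · exact D'.av e h w (key w hw (mem_Im.2 ⟨e, h, hz⟩)) hz
    · exact D'.av e h w hw hz
  · intro e he e' he' hne z hz hz'
    rcases mem_union.1 he with h | h <;> rcases mem_union.1 he' with h' | h'
    · obtain ⟨w, hw, h⟩ := D.aa e h e' h' hne z hz hz'
      exact ⟨w, vs_mono subset_union_left hw, h⟩
    · exact kaa e h e' h' hne z hz hz'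
    · exact kaa e' h' e h hne.symm z hz' hz
    · obtain ⟨w, hw, h⟩ := D'.aa e h e' h' hne z hz hz'
      exact ⟨w, vs_mono subset_union_right hw, h⟩

/-- two edge-disjoint parts of a drawing meet only in common vertices -/
lemma meet (D : Drw E v a) {P Q : Finset (Sym2 W)} (hP : P ⊆ E) (hQ : Q ⊆ E) (hd : Disjoint P Q)
    {z : P2} (h1 : z ∈ Im P a) (h2 : z ∈ Im Q a) : ∃ w ∈ vs P, w ∈ vs Q ∧ z = v w := by
  obtain ⟨e, he, h1⟩ := mem_Im.1 h1
  obtain ⟨f, hf, h2⟩ := mem_Im.1 h2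
  have hne : e ≠ f := by rintro rfl; exact Finset.disjoint_left.1 hd he hf
  obtain ⟨w, hw, rfl⟩ := D.aa e (hP he) f (hQ hf) hne z h1 h2
  exact ⟨w, ⟨e, he, D.av e (hP he) w hw h1⟩, ⟨f, hf, D.av f (hQ hf) w hw h2⟩, rfl⟩

lemma path_arc {x y : W} {P : Finset (Sym2 W)} (hP : Pth x y P) (D : Drw P v a) :
    IsArc (Im P a) (v x) (v y) := by
  induction hP with
  | single h => rw [Im_single]; exact D.ar _ _ (by simp)
  | @cons x y z P hP hx ih =>
    have hP' : P ⊆ insert s(x,y) P := subset_insert _ _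
    have e : insert s(x,y) P = {s(x,y)} ∪ P := rfl
    have hd : Disjoint {s(x,y)} P := by
      rw [disjoint_singleton_left]; intro h; exact hx ⟨_, h, by simp⟩
    rw [e, Im_union, Im_single]
    refine (D.ar x y (by simp)).concat (ih (D.mono hP')) ?_
    intro p hp hp'
    obtain ⟨w, h1, h2, rfl⟩ := D.meet (P := {s(x,y)}) (by simp) hP' hd (by rwa [Im_single]) hp'
    rcases vs_single.1 h1 with rfl | rfl
    · exact absurd h2 hx
    · rfl

end Drw

lemma place {x y : W} {P : Finset (Sym2 W)} (hP : Pth x y P) : ∀ {A : Set P2} {p q : P2},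
    IsArc A p q → ∃ v a, Drw P v a ∧ v x = p ∧ v y = q ∧ Im P a = A := by
  induction hP with
  | @single x y h =>
    intro A p q hA
    refine ⟨Function.update (fun _ => q) x p, fun _ => A, Drw.single ?_, by simp, ?_, Im_single⟩
    · rw [Function.update_self, Function.update_of_ne h.symm]; exact hA
    · rw [Function.update_of_ne h.symm]
  | @cons x y z P hP hx ih =>
    intro A p q hA
    obtain ⟨m, A1, A2, h1, h2, rfl, h3⟩ := hA.split
    obtain ⟨v, a, D, hy, hz, hI⟩ := ih h2
    have hxy : y ≠ x := by rintro rfl; exact hx hP.left_mem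
    have hzx : z ≠ x := by rintro rfl; exact hx hP.right_mem
    have hn : ∀ e ∈ P, e ≠ s(x,y) := by rintro e h rfl; exact hx ⟨_, h, by simp⟩
    set v' := Function.update v x p with hv'
    set a' := Function.update a s(x,y) A1 with ha'
    have ea : ∀ e ∈ P, a' e = a e := fun e he => Function.update_of_ne (hn e he) _ _
    have ev : ∀ w ∈ vs P, v' w = v w := fun w hw =>
      Function.update_of_ne (by rintro rfl; exact hx hw) _ _
    have e1 : a' s(x,y) = A1 := Function.update_self _ _ _
    have e2 : v' x = p := Function.update_self _ _ _
    have e3 : v' y = m := (ev y hP.left_mem).trans hy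
    have D1 : Drw {s(x,y)} v' a' := Drw.single (by rw [e1, e2, e3]; exact h1)
    have D2 : Drw P v' a' := D.congr ev ea
    have hI' : Im P a' = A2 := (Im_congr ea).trans hI
    have e : insert s(x,y) P = {s(x,y)} ∪ P := rfl
    refine ⟨v', a', ?_, e2, (ev z hP.right_mem).trans hz, ?_⟩
    · rw [e]
      refine D1.union D2 fun t ht ht' => Or.inl ⟨y, vs_single.2 (Or.inr rfl), hP.left_mem, ?_⟩
      rw [Im_single, e1] at ht
      rw [hI'] at ht'
      rw [e3]; exact h3 t ht ht'
    · rw [e, Im_union, Im_single, e1, hI']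

end
end PB

namespace PB
section
open Classical Finset

variable {W : Type}

lemma sides_aux {A1 A2 : Set P2} {X Y : P2} (hu : A1 ∪ A2 = Crc)
    (hX1 : X ∈ A1) (hX2 : X ∈ A2) (hY1 : Y ∈ A1) (hY2 : Y ∈ A2)
    (h1 : A1 \ {X, Y} ⊆ {p | 0 < lf X Y p}) (h2 : A2 \ {X, Y} ⊆ {p | lf X Y p < 0}) :
    A1 = {p | qd p = 1 ∧ 0 ≤ lf X Y p} ∧ A2 = {p | qd p = 1 ∧ 0 ≤ lf Y X p} := by
  have lX : lf X Y X = 0 := by unfold lf; ring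
  have lY : lf X Y Y = 0 := by unfold lf; ring
  have c1 : ∀ z ∈ A1, z = X ∨ z = Y ∨ 0 < lf X Y z := by
    intro z hz
    by_cases h : z = X
    · exact Or.inl h
    by_cases h' : z = Y
    · exact Or.inr (Or.inl h')
    · exact Or.inr (Or.inr (h1 ⟨hz, by simp [h, h']⟩))
  have c2 : ∀ z ∈ A2, z = X ∨ z = Y ∨ lf X Y z < 0 := by
    intro z hz
    by_cases h : z = X
    · exact Or.inl h
    by_cases h' : z = Y
    · exact Or.inr (Or.inl h')
    · exact Or.inr (Or.inr (h2 ⟨hz, by simp [h, h']⟩))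
  have m1 : ∀ z ∈ A1, qd z = 1 := fun z hz => by
    have : z ∈ Crc := hu ▸ Or.inl hz
    exact this
  have m2 : ∀ z ∈ A2, qd z = 1 := fun z hz => by
    have : z ∈ Crc := hu ▸ Or.inr hz
    exact this
  have m : ∀ z, qd z = 1 → z ∈ A1 ∨ z ∈ A2 := fun z hz => by
    have : z ∈ A1 ∪ A2 := by rw [hu]; exact hz
    exact this
  constructor
  · ext z; constructor
    · intro hz
      refine ⟨m1 z hz, ?_⟩
      rcases c1 z hz with rfl | rfl | h
      · exact lX.ge
      · exact lY.ge
      · exact h.le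
    · rintro ⟨hq, hl⟩
      rcases m z hq with h | h
      · exact h
      · rcases c2 z h with rfl | rfl | h
        · exact hX1
        · exact hY1
        · linarith
  · ext z; constructor
    · intro hz
      refine ⟨m2 z hz, ?_⟩
      rw [lf_swap]
      rcases c2 z hz with rfl | rfl | h
      · rw [lX]; simp
      · rw [lY]; simp
      · linarith
    · rintro ⟨hq, hl⟩
      rw [lf_swap] at hl
      rcases m z hq with h | h
      · rcases c1 z h with rfl | rfl | h
        · exact hX2
        · exact hY2
        · linarith
      · exact h

lemma sides {A1 A2 : Set P2} {X Y : P2} (hu : A1 ∪ A2 = Crc) (h1 : IsArc A1 X Y)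
    (h2 : IsArc A2 X Y) :
    (A1 = {p | qd p = 1 ∧ 0 ≤ lf X Y p} ∧ A2 = {p | qd p = 1 ∧ 0 ≤ lf Y X p}) ∨
    (A2 = {p | qd p = 1 ∧ 0 ≤ lf X Y p} ∧ A1 = {p | qd p = 1 ∧ 0 ≤ lf Y X p}) := by
  have hXY := h1.ne
  have hX : qd X = 1 := by
    have : X ∈ Crc := hu ▸ Or.inl h1.left
    exact this
  have hY : qd Y = 1 := by
    have : Y ∈ Crc := hu ▸ Or.inl h1.right
    exact this
  have hUo : IsOpen {p | 0 < lf X Y p} := isOpen_lt continuous_const (lf_cont X Y)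
  have hVo : IsOpen {p | lf X Y p < 0} := isOpen_lt (lf_cont X Y) continuous_const
  have hdj : Disjoint {p | 0 < lf X Y p} {p | lf X Y p < 0} := by
    rw [Set.disjoint_left]; intro p hp hp'
    exact lt_asymm (show 0 < lf X Y p from hp) hp'
  have key : ∀ A, A ⊆ Crc → IsArc A X Y → A \ {X, Y} ⊆ {p | 0 < lf X Y p} ∨
      A \ {X, Y} ⊆ {p | lf X Y p < 0} := by
    intro A hA h
    refine h.open_conn.subset_or_subset hUo hVo hdj ?_
    rintro z ⟨hz, hn⟩
    rcases lt_trichotomy (lf X Y z) 0 with h | h | h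
    · exact Or.inr h
    · exact absurd (chord_ends hXY hX hY (show qd z = 1 from hA hz) h) (by simpa using hn)
    · exact Or.inl h
  have lX : lf X Y X = 0 := by unfold lf; ring
  have lY : lf X Y Y = 0 := by unfold lf; ring
  have hA1 : A1 ⊆ Crc := hu ▸ Set.subset_union_left
  have hA2 : A2 ⊆ Crc := hu ▸ Set.subset_union_right
  rcases key A1 hA1 h1 with k1 | k1 <;> rcases key A2 hA2 h2 with k2 | k2
  · exfalso
    obtain ⟨z, hz, hl⟩ := exists_pos hXY.symm hY hX
    rw [lf_swap] at hl
    have hn : z ∉ ({X, Y} : Set P2) := by rintro (rfl | rfl) <;> linarith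
    have hz' : z ∈ A1 ∪ A2 := by rw [hu]; exact hz
    rcases hz' with h | h
    · have : 0 < lf X Y z := k1 ⟨h, hn⟩
      linarith
    · have : 0 < lf X Y z := k2 ⟨h, hn⟩
      linarith
  · exact Or.inl (sides_aux hu h1.left h2.left h1.right h2.right k1 k2)
  · exact Or.inr (sides_aux ((Set.union_comm _ _).trans hu) h2.left h1.left h2.right h1.right k2 k1)
  · exfalso
    obtain ⟨z, hz, hl⟩ := exists_pos hXY hX hY
    have hn : z ∉ ({X, Y} : Set P2) := by rintro (rfl | rfl) <;> linarith
    have hz' : z ∈ A1 ∪ A2 := by rw [hu]; exact hz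
    rcases hz' with h | h
    · have : lf X Y z < 0 := k1 ⟨h, hn⟩
      linarith
    · have : lf X Y z < 0 := k2 ⟨h, hn⟩
      linarith

/-- every drawing of `C` on the unit circle extends to a drawing of `E` in the disk -/
def Draw (E C : Finset (Sym2 W)) : Prop := ∀ v a, Drw C v a → Im C a = Crc →
  ∃ v' a', Drw E v' a' ∧ (∀ w ∈ vs C, v' w = v w) ∧ (∀ e ∈ C, a' e = a e) ∧ Im E a' ⊆ Dsk

lemma Draw.half {E P Q : Finset (Sym2 W)} (h : Draw E (Q ∪ P)) {X Y : P2} (hXY : X ≠ Y)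
    (hX : qd X = 1) (hY : qd Y = 1) {v : W → P2} {a : Sym2 W → Set P2} (D : Drw (Q ∪ P) v a)
    (hP : Im P a = {p | qd p = 1 ∧ 0 ≤ lf X Y p}) (hQ : Im Q a = segment ℝ X Y) :
    ∃ v' a', Drw E v' a' ∧ (∀ w ∈ vs (Q ∪ P), v' w = v w) ∧ (∀ e ∈ Q ∪ P, a' e = a e) ∧
      Im E a' ⊆ Hlf X Y := by
  obtain ⟨φ, f1, f2⟩ := Hlf_homeo hXY hX hY
  obtain ⟨v', a', D', hv, ha, hI⟩ := h _ _ (D.map φ) (by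
    rw [Im_map, Im_union, hP, hQ, Set.union_comm, f2])
  refine ⟨_, _, D'.map φ.symm, fun w hw => by rw [hv w hw]; simp, fun e he => ?_, ?_⟩
  · rw [ha e he, ← Set.image_comp]; simp
  · rw [Im_map, Set.image_subset_iff]
    intro z hz
    have := hI hz
    rw [← f1] at this
    obtain ⟨t, ht, rfl⟩ := this
    simpa using ht

lemma Draw.theta {C R1 R2 Q E1 E2 : Finset (Sym2 W)} {x y : W} (hs : Spl C x y R1 R2)
    (hQ : Pth x y Q) (hQC : ∀ u ∈ vs Q, u ∈ vs C → u = x ∨ u = y) (hd : Disjoint Q C)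
    (h1 : Draw E1 (Q ∪ R1)) (h2 : Draw E2 (Q ∪ R2)) (hv : ∀ u ∈ vs E1, u ∈ vs E2 → u ∈ vs Q)
    (he : E1 ∩ E2 = Q) (hs1 : Q ∪ R1 ⊆ E1) (hs2 : Q ∪ R2 ⊆ E2)
    {v₀ : W → P2} {a₀ : Sym2 W → Set P2} (D : Drw C v₀ a₀)
    (hR1 : Im R1 a₀ = {p | qd p = 1 ∧ 0 ≤ lf (v₀ x) (v₀ y) p})
    (hR2 : Im R2 a₀ = {p | qd p = 1 ∧ 0 ≤ lf (v₀ y) (v₀ x) p}) :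
    ∃ v' a', Drw (E1 ∪ E2) v' a' ∧ (∀ w ∈ vs C, v' w = v₀ w) ∧ (∀ e ∈ C, a' e = a₀ e) ∧
      Im (E1 ∪ E2) a' ⊆ Dsk := by
  have hxC : x ∈ vs C := vs_mono hs.sub1 hs.p1.left_mem
  have hyC : y ∈ vs C := vs_mono hs.sub1 hs.p1.right_mem
  have hXY : v₀ x ≠ v₀ y := fun h => hs.p1.ne (D.inj hxC hyC h)
  have hX : qd (v₀ x) = 1 := by
    have := (D.mono hs.sub1).vIm hs.p1.left_mem
    rw [hR1] at this; exact this.1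
  have hY : qd (v₀ y) = 1 := by
    have := (D.mono hs.sub1).vIm hs.p1.right_mem
    rw [hR1] at this; exact this.1
  obtain ⟨vq, aq, Dq, qx, qy, qI⟩ := place hQ (IsArc.seg hXY)
  set v : W → P2 := fun w => if w ∈ vs C then v₀ w else vq w with hvd
  set a : Sym2 W → Set P2 := fun e => if e ∈ C then a₀ e else aq e with had
  have vC : ∀ w ∈ vs C, v w = v₀ w := fun w hw => by simp [hvd, hw]
  have aC : ∀ e ∈ C, a e = a₀ e := fun e hw => by simp [had, hw]
  have vQ : ∀ w ∈ vs Q, v w = vq w := by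
    intro w hw
    by_cases hc : w ∈ vs C
    · rw [vC w hc]
      rcases hQC w hw hc with rfl | rfl
      · exact qx.symm
      · exact qy.symm
    · simp [hvd, hc]
  have aQ : ∀ e ∈ Q, a e = aq e := by
    intro e hq
    have : e ∉ C := Finset.disjoint_left.1 hd hq
    simp [had, this]
  have DC : Drw C v a := D.congr vC aC
  have DQ : Drw Q v a := Dq.congr vQ aQ
  have IQ : Im Q a = segment ℝ (v₀ x) (v₀ y) := (Im_congr aQ).trans qI
  have I1 : Im R1 a = {p | qd p = 1 ∧ 0 ≤ lf (v₀ x) (v₀ y) p} :=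
    (Im_congr fun e h => aC e (hs.sub1 h)).trans hR1
  have I2 : Im R2 a = {p | qd p = 1 ∧ 0 ≤ lf (v₀ y) (v₀ x) p} :=
    (Im_congr fun e h => aC e (hs.sub2 h)).trans hR2
  have ends : ∀ z ∈ segment ℝ (v₀ x) (v₀ y), qd z = 1 → z = v x ∨ z = v y := by
    intro z hz hq
    rw [vC x hxC, vC y hyC]
    exact chord_ends hXY hX hY hq ((chord_iff hXY hX hY).1 hz).2
  have D1 : Drw (Q ∪ R1) v a := by
    refine DQ.union (DC.mono hs.sub1) fun z hz hz' => Or.inl ?_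
    rw [IQ] at hz; rw [I1] at hz'
    rcases ends z hz hz'.1 with h | h
    · exact ⟨x, hQ.left_mem, hs.p1.left_mem, h⟩
    · exact ⟨y, hQ.right_mem, hs.p1.right_mem, h⟩
  have D2 : Drw (Q ∪ R2) v a := by
    refine DQ.union (DC.mono hs.sub2) fun z hz hz' => Or.inl ?_
    rw [IQ] at hz; rw [I2] at hz'
    rcases ends z hz hz'.1 with h | h
    · exact ⟨x, hQ.left_mem, hs.p2.left_mem, h⟩
    · exact ⟨y, hQ.right_mem, hs.p2.right_mem, h⟩
  obtain ⟨v1, a1, F1, v1e, a1e, J1⟩ := h1.half hXY hX hY D1 I1 IQ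
  obtain ⟨v2, a2, F2, v2e, a2e, J2⟩ := h2.half hXY.symm hY hX D2 I2
    (by rw [IQ, segment_symm])
  set v' : W → P2 := fun w => if w ∈ vs E1 then v1 w else v2 w with hvd'
  set a' : Sym2 W → Set P2 := fun e => if e ∈ E1 then a1 e else a2 e with had'
  have qs1 : Q ⊆ Q ∪ R1 := subset_union_left
  have qs2 : Q ⊆ Q ∪ R2 := subset_union_left
  have w1 : ∀ w ∈ vs E1, v' w = v1 w := fun w hw => by simp [hvd', hw]
  have b1 : ∀ e ∈ E1, a' e = a1 e := fun w hw => by simp [had', hw]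
  have w2 : ∀ w ∈ vs E2, v' w = v2 w := by
    intro w hw
    by_cases hc : w ∈ vs E1
    · have := hv w hc hw
      rw [w1 w hc, v1e w (vs_mono qs1 this), v2e w (vs_mono qs2 this)]
    · simp [hvd', hc]
  have b2 : ∀ e ∈ E2, a' e = a2 e := by
    intro e h
    by_cases hc : e ∈ E1
    · have : e ∈ Q := he ▸ mem_inter.2 ⟨hc, h⟩
      rw [b1 e hc, a1e e (qs1 this), a2e e (qs2 this)]
    · simp [had', hc]
  have J1' : Im E1 a' ⊆ Hlf (v₀ x) (v₀ y) := by rw [Im_congr b1]; exact J1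
  have J2' : Im E2 a' ⊆ Hlf (v₀ y) (v₀ x) := by rw [Im_congr b2]; exact J2
  have r1 : R1 ⊆ Q ∪ R1 := subset_union_right
  have r2 : R2 ⊆ Q ∪ R2 := subset_union_right
  refine ⟨v', a', ?_, ?_, ?_, ?_⟩
  · refine (F1.congr w1 b1).union (F2.congr w2 b2) fun z hz hz' => Or.inr ?_
    have k1 := J1' hz
    have k2 := J2' hz'
    have k3 := k2.2
    rw [lf_swap] at k3
    have : z ∈ segment ℝ (v₀ x) (v₀ y) :=
      (chord_iff hXY hX hY).2 ⟨k1.1, le_antisymm (by linarith) k1.2⟩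
    rw [← IQ] at this
    obtain ⟨e, heQ, hze⟩ := mem_Im.1 this
    refine ⟨e, hs1 (qs1 heQ), hs2 (qs2 heQ), ?_⟩
    rwa [b1 e (hs1 (qs1 heQ)), a1e e (qs1 heQ)]
  · intro w hw
    rw [← vC w hw]
    rw [hs.vsu] at hw
    rcases hw with hw | hw
    · rw [w1 w (vs_mono (r1.trans hs1) hw), v1e w (vs_mono r1 hw)]
    · rw [w2 w (vs_mono (r2.trans hs2) hw), v2e w (vs_mono r2 hw)]
  · intro e h
    rw [← aC e h]
    rw [hs.un, mem_union] at h
    rcases h with h | h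
    · rw [b1 e (hs1 (r1 h)), a1e e (r1 h)]
    · rw [b2 e (hs2 (r2 h)), a2e e (r2 h)]
  · rw [Im_union]
    exact Set.union_subset (fun z hz => (J1' hz).1) (fun z hz => (J2' hz).1)

lemma Draw_of_Dec {E C : Finset (Sym2 W)} (h : Dec E C) : Draw E C := by
  induction h with
  | base hC => exact fun v a D hI => ⟨v, a, D, fun _ _ => rfl, fun _ _ => rfl, hI.le.trans
      fun p hp => le_of_eq (show qd p = 1 from hp)⟩
  | theta hs hQ hQC hd _ _ hv he hs1 hs2 ih1 ih2 =>
    intro v a D hI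
    have hu := hI
    rw [hs.un, Im_union] at hu
    rcases sides hu (Drw.path_arc hs.p1 (D.mono hs.sub1)) (Drw.path_arc hs.p2 (D.mono hs.sub2))
      with ⟨k1, k2⟩ | ⟨k1, k2⟩
    · exact Draw.theta hs hQ hQC hd ih1 ih2 hv he hs1 hs2 D k1 k2
    · exact Draw.theta hs.symm hQ.symm (fun u h h' => (hQC u h h').symm) hd ih1 ih2 hv he hs1 hs2
        D k2 k1

/-- a cycle can be drawn on the unit circle -/
lemma Circ.draw {C : Finset (Sym2 W)} (hC : Circ C) : ∃ v a, Drw C v a ∧ Im C a = Crc := by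
  obtain ⟨x, y, R1, R2, hs⟩ := hC
  have arcs : ∀ σ : ℝ, σ ^ 2 = 1 → IsArc {p | qd p = 1 ∧ 0 ≤ σ * p.2} (-1, 0) (1, 0) := by
    intro σ hσ
    have hsq : ∀ t ∈ Set.Icc (-1 : ℝ) 1, 0 ≤ 1 - t ^ 2 := by
      rintro t ⟨h0, h1⟩; nlinarith
    have := IsArc.of (γ := fun t => (t, σ * Real.sqrt (1 - t ^ 2))) (a := -1) (b := 1) (by norm_num)
      (by fun_prop) (fun s _ t _ h => (Prod.ext_iff.1 h).1)
    convert this using 1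
    · ext p; constructor
      · rintro ⟨h1, h2⟩
        unfold qd at h1
        refine ⟨p.1, ⟨by nlinarith [sq_nonneg p.2], by nlinarith [sq_nonneg p.2]⟩, ?_⟩
        have : 1 - p.1 ^ 2 = (σ * p.2) ^ 2 := by rw [mul_pow, hσ]; linarith
        ext
        · rfl
        · simp only
          rw [this, Real.sqrt_sq h2, ← mul_assoc, ← sq, hσ, one_mul]
      · rintro ⟨t, ht, rfl⟩
        refine ⟨?_, ?_⟩
        · unfold qd
          simp only
          rw [mul_pow, hσ, Real.sq_sqrt (hsq t ht)]; ring
        · simp only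
          rw [← mul_assoc, ← sq, hσ, one_mul]; positivity
    · simp
    · simp
  obtain ⟨v1, a1, D1, x1, y1, I1⟩ := place hs.p1 (arcs 1 (by norm_num))
  obtain ⟨v2, a2, D2, x2, y2, I2⟩ := place hs.p2 (arcs (-1) (by norm_num))
  set v : W → P2 := fun w => if w ∈ vs R1 then v1 w else v2 w with hvd
  set a : Sym2 W → Set P2 := fun e => if e ∈ R1 then a1 e else a2 e with had
  have e1 : ∀ w ∈ vs R1, v w = v1 w := fun w hw => by simp [hvd, hw]
  have f1 : ∀ e ∈ R1, a e = a1 e := fun w hw => by simp [had, hw]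
  have e2 : ∀ w ∈ vs R2, v w = v2 w := by
    intro w hw
    by_cases hc : w ∈ vs R1
    · rw [e1 w hc]
      rcases hs.vx w hc hw with rfl | rfl
      · rw [x1, x2]
      · rw [y1, y2]
    · simp [hvd, hc]
  have f2 : ∀ e ∈ R2, a e = a2 e := by
    intro e h
    have : e ∉ R1 := Finset.disjoint_right.1 hs.dj h
    simp [had, this]
  have I1' := (Im_congr f1).trans I1
  have I2' := (Im_congr f2).trans I2
  refine ⟨v, a, ?_, ?_⟩
  · rw [hs.un]
    refine (D1.congr e1 f1).union (D2.congr e2 f2) fun z hz hz' => Or.inl ?_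
    rw [I1'] at hz; rw [I2'] at hz'
    have k0 := hz.1
    have k1 := hz.2
    have k2 := hz'.2
    have k3 : z.2 = 0 := by linarith
    unfold qd at k0
    rw [k3] at k0
    have : (z.1 - 1) * (z.1 + 1) = 0 := by linarith
    rcases mul_eq_zero.1 this with h | h
    · refine ⟨y, hs.p1.right_mem, hs.p2.right_mem, ?_⟩
      rw [e1 y hs.p1.right_mem, y1]
      ext
      · simp only; linarith
      · exact k3
    · refine ⟨x, hs.p1.left_mem, hs.p2.left_mem, ?_⟩
      rw [e1 x hs.p1.left_mem, x1]
      ext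
      · simp only; linarith
      · exact k3
  · rw [hs.un, Im_union, I1', I2']
    ext z
    simp only [Set.mem_union, Set.mem_ofPred_eq, Crc, ← and_or_left, and_iff_left_iff_imp]
    intro _
    rcases le_total 0 z.2 with h | h
    · left; linarith
    · right; linarith
end
end PB

namespace PB
section
open Classical Finset

variable {W : Type}

lemma Pth_of_walk {H : SimpleGraph W} {u v : W} (p : H.Walk u v) (hp : p.IsPath) (huv : u ≠ v) :
    Pth u v p.edges.toFinset ∧ ∀ x ∈ vs p.edges.toFinset, x ∈ p.support := by
  have key : ∀ x ∈ vs p.edges.toFinset, x ∈ p.support := by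
    rintro x ⟨e, he, hx⟩
    exact SimpleGraph.Walk.mem_support_iff_exists_mem_edges.2
      (Or.inr ⟨e, List.mem_toFinset.1 he, hx⟩)
  refine ⟨?_, key⟩
  induction p with
  | nil => exact absurd rfl huv
  | @cons a b c h p ih =>
    rw [SimpleGraph.Walk.cons_isPath_iff] at hp
    have hab : a ≠ b := h.ne
    by_cases hbc : b = c
    · subst hbc
      have : p = SimpleGraph.Walk.nil := SimpleGraph.Walk.isPath_iff_eq_nil.1 hp.1
      subst this
      simpa using Pth.single hab
    · have kk : ∀ x ∈ vs p.edges.toFinset, x ∈ p.support := by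
        rintro x ⟨e, he, hx⟩
        exact SimpleGraph.Walk.mem_support_iff_exists_mem_edges.2
          (Or.inr ⟨e, List.mem_toFinset.1 he, hx⟩)
      have := Pth.cons (x := a) (ih hp.1 hbc kk) (fun hx => hp.2 (kk a hx))
      simpa using this

lemma Circ_of_walk {H : SimpleGraph W} {u : W} (p : H.Walk u u) (hp : p.IsCycle) :
    Circ p.edges.toFinset := by
  cases p with
  | nil => simp at hp
  | @cons _ b _ h p =>
    rw [SimpleGraph.Walk.cons_isCycle_iff] at hp
    have hne : u ≠ b := h.ne
    refine ⟨b, u, {s(b,u)}, p.edges.toFinset, Pth.single hne.symm,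
      (Pth_of_walk p hp.1 hne.symm).1, ?_, ?_, ?_⟩
    · rw [SimpleGraph.Walk.edges_cons, List.toFinset_cons, Sym2.eq_swap]; rfl
    · rw [disjoint_singleton_left, List.mem_toFinset, Sym2.eq_swap]; exact hp.2
    · intro x hx _; exact vs_single.1 hx

section
variable [Finite W]

noncomputable def ES (B : (⊤ : SimpleGraph W).Subgraph) : Finset (Sym2 W) :=
  (Set.toFinite B.edgeSet).toFinset

lemma mem_ES {B : (⊤ : SimpleGraph W).Subgraph} {e : Sym2 W} : e ∈ ES B ↔ e ∈ B.edgeSet := by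
  simp [ES]

lemma ES_vs {B : (⊤ : SimpleGraph W).Subgraph} {w : W} (h : w ∈ vs (ES B)) : w ∈ B.verts := by
  obtain ⟨e, he, hw⟩ := h
  exact B.mem_verts_of_mem_edge (mem_ES.1 he) hw

lemma ES_mono {A B : (⊤ : SimpleGraph W).Subgraph} (h : A ≤ B) : ES A ⊆ ES B := fun e he =>
  mem_ES.2 (SimpleGraph.Subgraph.edgeSet_mono h (mem_ES.1 he))

lemma ES_sup (A B : (⊤ : SimpleGraph W).Subgraph) : ES (A ⊔ B) = ES A ∪ ES B := by
  ext e; simp only [mem_ES, mem_union, SimpleGraph.Subgraph.edgeSet_sup, Set.mem_union]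

lemma ES_LL (B : (⊤ : SimpleGraph W).Subgraph) : LL (ES B) := by
  intro e he
  exact SimpleGraph.not_isDiag_of_mem_edgeSet _ (B.edgeSet_subset (mem_ES.1 he))

lemma ES_cyc {C : (⊤ : SimpleGraph W).Subgraph} (h : IsCycleSubgraph C) :
    Circ (ES C) ∧ ∀ w ∈ C.verts, w ∈ vs (ES C) := by
  obtain ⟨v, p, hp, hs, he⟩ := h
  have hE : ES C = (p.map C.hom).edges.toFinset := by
    ext e
    rw [mem_ES, ← C.image_coe_edgeSet_coe, List.mem_toFinset, SimpleGraph.Walk.edges_map,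
      List.mem_map]
    constructor
    · rintro ⟨f, hf, rfl⟩; exact ⟨f, he f hf, rfl⟩
    · rintro ⟨f, hf, rfl⟩; exact ⟨f, p.edges_subset_edgeSet hf, rfl⟩
  refine ⟨?_, ?_⟩
  · rw [hE]
    exact Circ_of_walk _ (hp.map C.hom_injective)
  · intro w hw
    obtain ⟨f, hf, hwf⟩ :=
      (SimpleGraph.Walk.mem_support_iff_exists_mem_edges_of_not_nil hp.not_nil).1 (hs ⟨w, hw⟩)
    have : f.map Subtype.val ∈ C.edgeSet := by
      rw [← C.image_coe_edgeSet_coe]; exact ⟨f, p.edges_subset_edgeSet hf, rfl⟩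
    exact ⟨f.map Subtype.val, mem_ES.2 this, Sym2.mem_map.2 ⟨_, hwf, rfl⟩⟩

lemma Drw_of_emb {B : (⊤ : SimpleGraph W).Subgraph} (D : PlaneEmb B) :
    Drw (ES B) D.vert D.arc where
  inj := D.vert_inj.mono fun w hw => ES_vs hw
  ar := fun u v h => D.arc_spec u v (mem_ES.1 h)
  av := by
    intro e he w hw h
    induction e with | _ u v =>
    have := D.arc_vert u v w (mem_ES.1 he) (ES_vs hw) h
    simpa using this
  aa := by
    intro e he e' he' hne p hp hp'
    obtain ⟨w, hw, rfl⟩ := D.arc_inter e e' (mem_ES.1 he) (mem_ES.1 he') hne p ⟨hp, hp'⟩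
    induction e with | _ u v =>
    refine ⟨w, ⟨_, he, ?_⟩, rfl⟩
    have := D.arc_vert u v w (mem_ES.1 he) hw hp
    simpa using this

lemma drawing_closed {B : (⊤ : SimpleGraph W).Subgraph} (D : PlaneEmb B) : IsClosed D.drawing := by
  refine ((Set.toFinite _).isClosed).union ?_
  refine (Set.toFinite B.edgeSet).isClosed_biUnion ?_
  intro e he
  induction e with | _ u v =>
  obtain ⟨γ, hc, -, -, -, h⟩ := D.arc_spec u v he
  rw [← h]
  exact (isCompact_Icc.image_of_continuousOn hc).isClosed

lemma Pl_of_emb {B : (⊤ : SimpleGraph W).Subgraph} (D : PlaneEmb B) : Pl (ES B) := by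
  have h := Pl_plus (ES_LL B) (Drw_of_emb D) isOpen_empty isPreconnected_empty
    (fun _ _ => Set.empty_disjoint _) ∅ (by simp) (by simp)
  refine minor_sets (plusE_LL (ES_LL B) ∅) (ES_LL B) h (fun u => {some u}) ?_ ?_ ?_
  · rintro u w huw x rfl h
    exact huw (Option.some.inj h)
  · rintro u a rfl b rfl; exact Relation.ReflTransGen.refl
  · intro u v huv
    refine ⟨_, rfl, _, rfl, ?_⟩
    exact mem_union_left _ (mem_image.2 ⟨_, huv, by simp⟩)

lemma NO_of_emb {B C : (⊤ : SimpleGraph W).Subgraph} (D : PlaneEmb B) (hC : IsCycleSubgraph C)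
    (hCB : C ≤ B) (hD : D.BoundsOuterFace C) : NO (ES B) (ES C) := by
  obtain ⟨F, ⟨p, hp, rfl⟩, -, hfr⟩ := hD
  obtain ⟨hc, hv⟩ := ES_cyc hC
  have hsub := connectedComponentIn_subset D.drawingᶜ p
  refine NO_of_Pl (ES_LL B) (ES_mono hCB) hc (Set.toFinite C.verts).toFinset ?_ ?_
  · intro v h; simpa using ES_vs h
  · refine Pl_plus (F := connectedComponentIn D.drawingᶜ p) (ES_LL B) (Drw_of_emb D) (drawing_closed D).isOpen_compl.connectedComponentIn
      isPreconnected_connectedComponentIn ?_ _ ?_ ?_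
    · intro e he
      rw [Set.disjoint_left]
      intro z hz hz'
      refine hsub hz (Or.inr ?_)
      simp only [Set.mem_iUnion]
      exact ⟨e, mem_ES.1 he, hz'⟩
    · intro w hw
      exact vs_mono (ES_mono hCB) (hv w (by simpa using hw))
    · intro w hw
      apply frontier_subset_closure
      rw [hfr]
      exact Or.inl ⟨w, by simpa using hw, rfl⟩

lemma outer_of_draw {R C : (⊤ : SimpleGraph W).Subgraph} (hC : IsCycleSubgraph C) (hCR : C ≤ R)
    (D : PlaneEmb R) (hIm : Im (ES R) D.arc ⊆ Dsk) (hv : ∀ w, D.vert w ∈ Dsk)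
    (hCc : Im (ES C) D.arc = Crc) : D.BoundsOuterFace C := by
  have hsub : D.drawing ⊆ Dsk := by
    rintro z (⟨w, -, rfl⟩ | hz)
    · exact hv w
    · simp only [Set.mem_iUnion] at hz
      obtain ⟨e, he, hz⟩ := hz
      exact hIm (mem_Im.2 ⟨e, mem_ES.2 he, hz⟩)
  have hImC : D.image C = Crc := by
    rw [← hCc]
    ext z; constructor
    · rintro (⟨w, hw, rfl⟩ | hz)
      · exact ((Drw_of_emb D).mono (ES_mono hCR)).vIm ((ES_cyc hC).2 w hw)
      · simp only [Set.mem_iUnion] at hz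
        obtain ⟨e, he, hz⟩ := hz
        exact mem_Im.2 ⟨e, mem_ES.2 he, hz⟩
    · intro hz
      obtain ⟨e, he, hz⟩ := mem_Im.1 hz
      right
      simp only [Set.mem_iUnion]
      exact ⟨e, mem_ES.1 he, hz⟩
  have hCd : Crc ⊆ D.drawing := by
    rw [← hCc]
    intro z hz
    obtain ⟨e, he, hz⟩ := mem_Im.1 hz
    right
    simp only [Set.mem_iUnion]
    exact ⟨e, mem_ES.1 (ES_mono hCR he), hz⟩
  have hp : ((2, 0) : P2) ∈ Dskᶜ := by
    intro h
    have : qd (2, 0) ≤ 1 := h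
    unfold qd at this; norm_num at this
  refine ⟨Dskᶜ, ⟨(2, 0), fun h => hp (hsub h), ?_⟩, ?_, ?_⟩
  · refine Set.Subset.antisymm (Dsk_compl_conn.isPreconnected.subset_connectedComponentIn hp
      (Set.compl_subset_compl.2 hsub)) ?_
    have h1 : IsOpen {p | qd p < 1} := isOpen_lt qd_cont continuous_const
    have h2 : IsOpen (Dskᶜ) := Dsk_closed.isOpen_compl
    have hd : Disjoint {p | qd p < 1} Dskᶜ := by
      rw [Set.disjoint_left]; intro z hz hz'
      exact hz' (show qd z ≤ 1 from le_of_lt hz)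
    have hK := isPreconnected_connectedComponentIn (F := D.drawingᶜ) (x := ((2, 0) : P2))
    have hm : ((2, 0) : P2) ∈ connectedComponentIn D.drawingᶜ (2, 0) :=
      mem_connectedComponentIn fun h => hp (hsub h)
    rcases hK.subset_or_subset h1 h2 hd (by
      intro z hz
      have hz' : z ∉ Crc := fun h => connectedComponentIn_subset _ _ hz (hCd h)
      rcases lt_trichotomy (qd z) 1 with h | h | h
      · exact Or.inl h
      · exact absurd h hz'
      · exact Or.inr (not_le.2 h)) with h | h
    · exact absurd (show qd (2, 0) ≤ 1 from le_of_lt (h hm)) hp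
    · exact h
  · intro hb
    obtain ⟨r, hr⟩ := hb.subset_closedBall 0
    have hq : ((|r| + 2, 0) : P2) ∈ Dskᶜ := by
      intro h
      have : qd (|r| + 2, 0) ≤ 1 := h
      unfold qd at this
      simp only at this
      nlinarith [abs_nonneg r]
    have := hr hq
    rw [mem_closedBall_zero_iff, Prod.norm_def, max_le_iff, Real.norm_eq_abs] at this
    have h3 := (le_abs_self _).trans this.1
    simp only at h3
    linarith [le_abs_self r]
  · rw [frontier_compl, Dsk_frontier, hImC]
end
end
end PB

/-- Let `B` be a planar graph having an embedding with nested cycles `C₁`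
(bounding the outer face) and `C₂` (bounding an inner face), with at least two vertex-disjoint
paths joining `C₁` and `C₂`. Let `I` be a graph with `B ∩ I = C₂` such that `R = B ∪ I` is
planar. Then `R` has a planar embedding in which `C₁` bounds the outer face. -/
theorem union_has_embedding_with_C1_outer
    {W : Type} [Finite W] (B I C₁ C₂ : (⊤ : SimpleGraph W).Subgraph)
    (hC₁cyc : IsCycleSubgraph C₁) (hC₂cyc : IsCycleSubgraph C₂)
    (hC₁B : C₁ ≤ B) (hC₂B : C₂ ≤ B)
    (hdisj : Disjoint C₁.verts C₂.verts)
    (hB : ∃ D : PlaneEmb B, D.BoundsOuterFace C₁ ∧ D.BoundsInnerFace C₂ ∧ D.Nested C₁ C₂)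
    (hpaths : TwoDisjointPathsBetween B C₁ C₂)
    (hBI : B ⊓ I = C₂)
    (hplanar : Nonempty (PlaneEmb (B ⊔ I))) :
    ∃ D' : PlaneEmb (B ⊔ I), D'.BoundsOuterFace C₁ := by
  classical
  obtain ⟨D, hD, -, -⟩ := hB
  obtain ⟨D₂⟩ := hplanar
  have hFin : Fintype W := Fintype.ofFinite W
  obtain ⟨c1, v1⟩ := PB.ES_cyc hC₁cyc
  obtain ⟨c2, v2⟩ := PB.ES_cyc hC₂cyc
  have hBIv : ∀ w, w ∈ B.verts → w ∈ I.verts → w ∈ C₂.verts := by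
    intro w h h'
    rw [← hBI]; exact ⟨h, h'⟩
  have hNO : PB.NO (PB.ES B ∪ PB.ES I) (PB.ES C₁) := by
    refine PB.NO_union c1 c2 (PB.ES_mono hC₂B) ?_ ?_ ?_ (PB.NO_of_emb D hC₁cyc hC₁B hD)
    · intro v h h'
      exact Set.disjoint_left.1 hdisj (PB.ES_vs h') (PB.ES_vs h)
    · intro v h h'
      exact v2 v (hBIv v (PB.ES_vs h) (PB.ES_vs h'))
    · intro v h h'
      have := PB.ES_vs h'
      exact Set.disjoint_left.1 hdisj this (hBIv v (SimpleGraph.Subgraph.verts_mono hC₁B this) (PB.ES_vs h))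
  rw [← PB.ES_sup] at hNO
  have hCR : C₁ ≤ B ⊔ I := hC₁B.trans le_sup_left
  obtain ⟨E, hRE, hG, hT, hall⟩ := PB.augment c1 (PB.ES_mono hCR)
    ⟨PB.ES_LL (B ⊔ I), PB.Pl_of_emb D₂, hNO⟩
  have hCE := (PB.ES_mono hCR).trans hRE
  have hDec := PB.Dec_of_Fac c1 hCE hG.1 hT (PB.Fac_all c1 hCE hG hT)
  obtain ⟨v₀, a₀, D₀, hI₀⟩ := c1.draw
  obtain ⟨v, a, DE, hv, ha, hI⟩ := PB.Draw_of_Dec hDec v₀ a₀ D₀ hI₀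
  let D' : PlaneEmb (B ⊔ I) :=
    { vert := v
      arc := a
      vert_inj := fun x _ y _ h => DE.inj (hall x) (hall y) h
      arc_spec := fun x y h => DE.ar x y (hRE (PB.mem_ES.2 h))
      arc_vert := fun x y w h _ hw => by
        have := DE.av s(x, y) (hRE (PB.mem_ES.2 h)) w (hall w) hw
        simpa using this
      arc_inter := fun e e' he he' hne p hp => by
        obtain ⟨w, hw, rfl⟩ := DE.aa e (hRE (PB.mem_ES.2 he)) e' (hRE (PB.mem_ES.2 he')) hne p
          hp.1 hp.2
        exact ⟨w, (B ⊔ I).mem_verts_of_mem_edge he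
          (DE.av e (hRE (PB.mem_ES.2 he)) w hw hp.1), rfl⟩ }
  refine ⟨D', PB.outer_of_draw hC₁cyc hCR D' ((PB.Im_mono hRE).trans hI)
    (fun w => hI (DE.vIm (hall w))) ?_⟩
  exact (PB.Im_congr ha).trans hI₀
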